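/- Let φ be a plurisubharmonic function on the unit polydisc Δⁿ ⊂ ℂⁿ with φ(z) < 0 for every z ∈ Δⁿ, and let F be a holomorphic function on Δⁿ satisfying ∫_{Δⁿ} |F|² e^{−φ} dλ_n < +∞. Then there exist r ∈ (0,1) and p > 1 such that ∫_{Δⁿ_r} |F|² e^{−pφ} dλ_n < +∞. -/

import Mathlib

open MeasureTheory Set Filter ENNReal Complex

/-- `φ : D → [−∞, +∞)` is plurisubharmonic on an open `D ⊆ ℂⁿ`: it is upper
semicontinuous, nowhere `+∞`, not identically `−∞` on any connected component,
and its restriction to the intersection of `D` with every complex line is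
subharmonic, i.e. satisfies the sub-mean value inequality
`φ(z₀) ≤ (1/2π) ∫₀^{2π} φ(z₀ + ρ e^{iθ} w) dθ` whenever the closed disc
`{z₀ + t w : |t| ≤ ρ}` lies in `D`.  (For the extended-real valued `φ`, the
circle mean is encoded through its truncations `φ ⊔ M`, `M ∈ ℝ`, which are
real-valued and decrease to `φ`; this is equivalent to the usual inequality
since `φ` is bounded above on the compact circle.) -/
def PlurisubharmonicOn {n : ℕ} (φ : (Fin n → ℂ) → EReal) (D : Set (Fin n → ℂ)) : Prop :=
  UpperSemicontinuousOn φ D ∧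
  (∀ z ∈ D, φ z ≠ ⊤) ∧
  (∀ z ∈ D, ∃ y ∈ connectedComponentIn D z, φ y ≠ ⊥) ∧
  ∀ z₀ ∈ D, ∀ w : Fin n → ℂ, ∀ ρ : ℝ, 0 < ρ →
    (∀ t : ℂ, ‖t‖ ≤ ρ → z₀ + t • w ∈ D) →
    ∀ M : ℝ, φ z₀ ≤
      (((2 * Real.pi)⁻¹ * ∫ θ in (0 : ℝ)..(2 * Real.pi),
        (φ (z₀ + ((ρ : ℂ) * Complex.exp (θ * Complex.I)) • w) ⊔ (M : EReal)).toReal : ℝ) : EReal)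

namespace SOC

section neumann
variable {X : Type*}

lemma l1_norm (f : lp (fun _ : X => ℂ) 1) : ‖f‖ = ∑' i, ‖f i‖ := by
  rw [lp.norm_eq_tsum_rpow (by simp)]
  simp

lemma l1_summable (f : lp (fun _ : X => ℂ) 1) : Summable fun i => ‖f i‖ := by
  have := lp.memℓp f
  rw [memℓp_gen_iff (by simp)] at this
  simpa using this

lemma l1_mem (f : X → ℂ) (hf : Summable fun i => ‖f i‖) : Memℓp f 1 := by
  rw [memℓp_gen_iff (by simp)]
  simpa using hf

lemma l1_summable_smul (d : X → lp (fun _ : X => ℂ) 1) (hd : ∀ α, ‖d α‖ ≤ 1 / 2)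
    (x : lp (fun _ : X => ℂ) 1) : Summable fun α => x α • d α := by
  apply Summable.of_norm_bounded (g := fun α => ‖x α‖ * (1 / 2))
  · exact (l1_summable x).mul_right _
  · intro i
    rw [norm_smul]
    gcongr
    exact hd i

lemma neumann (d : X → lp (fun _ : X => ℂ) 1) (hd : ∀ α, ‖d α‖ ≤ 1 / 2)
    (y : lp (fun _ : X => ℂ) 1) :
    ∃ x : lp (fun _ : X => ℂ) 1, y = x + ∑' α, x α • d α := by
  let D₀ : lp (fun _ : X => ℂ) 1 →ₗ[ℂ] lp (fun _ : X => ℂ) 1 :=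
    { toFun := fun x => ∑' α, x α • d α
      map_add' := by
        intro x y
        rw [← (l1_summable_smul d hd x).tsum_add (l1_summable_smul d hd y)]
        congr 1
        ext1 α
        simp [add_smul]
      map_smul' := by
        intro c x
        simp only [RingHom.id_apply]
        rw [← (l1_summable_smul d hd x).tsum_const_smul c]
        congr 1
        ext1 α
        simp [mul_smul] }
  let D : lp (fun _ : X => ℂ) 1 →L[ℂ] lp (fun _ : X => ℂ) 1 :=
    D₀.mkContinuous (1 / 2) (by
      intro x
      rw [l1_norm x, ← tsum_mul_left]
      apply tsum_of_norm_bounded (((l1_summable x).mul_left _).hasSum)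
      intro i
      rw [norm_smul, mul_comm]
      gcongr
      exact hd i)
  have hD : ‖-D‖ < 1 := by
    rw [norm_neg]
    exact lt_of_le_of_lt (LinearMap.mkContinuous_norm_le _ (by norm_num) _) (by norm_num)
  obtain ⟨u, hu⟩ := isUnit_one_sub_of_norm_lt_one hD
  refine ⟨(↑u⁻¹ : lp (fun _ : X => ℂ) 1 →L[ℂ] lp (fun _ : X => ℂ) 1) y, ?_⟩
  have h1 : ((u : lp (fun _ : X => ℂ) 1 →L[ℂ] lp (fun _ : X => ℂ) 1) *
      (↑u⁻¹ : lp (fun _ : X => ℂ) 1 →L[ℂ] lp (fun _ : X => ℂ) 1)) y = y := by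
    rw [Units.mul_inv]; rfl
  rw [hu] at h1
  simpa [D, D₀] using h1.symm
end neumann

variable {n : ℕ}

/-- monomials -/
noncomputable def mon (z : Fin n → ℂ) (α : Fin n → ℕ) : ℂ := ∏ i, z i ^ α i

/-- sum of the power series with coefficients `a` -/
noncomputable def ev (a : (Fin n → ℕ) → ℂ) (z : Fin n → ℂ) : ℂ := ∑' α, a α * mon z α

/-- injective multiplicative grading of multi-indices by natural numbers -/
noncomputable def NN (α : Fin n → ℕ) : ℕ := ∏ i : Fin n, (Nat.nth Nat.Prime i) ^ α i

/-- weights -/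
noncomputable def om (s : ℕ) (α : Fin n → ℕ) : ℝ := ((NN α : ℝ)⁻¹) ^ s

/-- convergence of a power series -/
def CV (s : ℕ) (a : (Fin n → ℕ) → ℂ) : Prop := Summable fun α => ‖a α‖ * om s α

lemma prime_nth (i : ℕ) : (Nat.nth Nat.Prime i).Prime := Nat.prime_nth_prime i

lemma NN_pos (α : Fin n → ℕ) : 0 < NN α :=
  Finset.prod_pos fun i _ => pow_pos (prime_nth i).pos _

lemma NN_add (α β : Fin n → ℕ) : NN (α + β) = NN α * NN β := by
  simp [NN, pow_add, Finset.prod_mul_distrib]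

lemma NN_inj : Function.Injective (NN (n := n)) := by
  intro α β h
  have key : ∀ (γ : Fin n → ℕ) (j : Fin n), (NN γ).factorization (Nat.nth Nat.Prime j) = γ j := by
    intro γ j
    unfold NN
    rw [Nat.factorization_prod (fun (i : Fin n) _ => (pow_pos (prime_nth i).pos _).ne')]
    rw [Finset.sum_apply']
    rw [Finset.sum_eq_single j]
    · rw [(prime_nth j).factorization_pow]; simp
    · intro i _ hij
      rw [(prime_nth i).factorization_pow]
      rw [Finsupp.single_apply, if_neg]
      intro h
      exact hij (Fin.ext (Nat.nth_injective Nat.infinite_setOf_prime h))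
    · simp
  ext j
  rw [← key α j, ← key β j, h]

lemma om_pos (s : ℕ) (α : Fin n → ℕ) : 0 < om s α :=
  pow_pos (inv_pos.mpr (by exact_mod_cast NN_pos α)) _

lemma om_add (s : ℕ) (α β : Fin n → ℕ) : om s (α + β) = om s α * om s β := by
  simp [om, NN_add, mul_pow, mul_comm]

lemma om_anti {s t : ℕ} (h : s ≤ t) (α : Fin n → ℕ) : om t α ≤ om s α := by
  have : (1 : ℝ) ≤ NN α := by exact_mod_cast NN_pos α
  exact pow_le_pow_of_le_one (by positivity) (inv_le_one_of_one_le₀ this) h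

lemma CV.mono {s t : ℕ} (h : s ≤ t) {a : (Fin n → ℕ) → ℂ} (ha : CV s a) : CV t a := by
  apply Summable.of_nonneg_of_le _ _ ha
  · intro α; have := om_pos t α; positivity
  · intro α; have := om_anti h α; gcongr

/-- polydisc on which weight-`s` series converge -/
def PD (s : ℕ) : Set (Fin n → ℂ) := {z | ∀ i, ‖z i‖ ≤ ((Nat.nth Nat.Prime i : ℝ)⁻¹) ^ s}

lemma mon_le {s : ℕ} {z : Fin n → ℂ} (hz : z ∈ PD s) (α : Fin n → ℕ) : ‖mon z α‖ ≤ om s α := by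
  unfold mon om NN
  push_cast
  rw [norm_prod, ← Finset.prod_inv_distrib, ← Finset.prod_pow]
  apply Finset.prod_le_prod
  · intros; positivity
  · intro i _
    rw [norm_pow, ← inv_pow, ← pow_mul, mul_comm, pow_mul]
    exact pow_le_pow_left₀ (norm_nonneg _) (hz i) _

lemma mon_add (z : Fin n → ℂ) (α β : Fin n → ℕ) : mon z (α + β) = mon z α * mon z β := by
  simp [mon, pow_add, Finset.prod_mul_distrib]

lemma CV.summable {s : ℕ} {a : (Fin n → ℕ) → ℂ} (ha : CV s a) {z : Fin n → ℂ} (hz : z ∈ PD s) :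
    Summable fun α => a α * mon z α := by
  apply Summable.of_norm_bounded ha
  intro α
  rw [norm_mul]
  have := mon_le hz α
  gcongr

lemma CV.add {s : ℕ} {a b : (Fin n → ℕ) → ℂ} (ha : CV s a) (hb : CV s b) : CV s (a + b) := by
  apply Summable.of_nonneg_of_le _ _ (Summable.add ha hb)
  · intro α; have := om_pos s α; positivity
  · intro α; have := om_pos s α
    rw [← add_mul]
    have := norm_add_le (a α) (b α)
    simp only [Pi.add_apply]; gcongr

lemma CV.smul {s : ℕ} {a : (Fin n → ℕ) → ℂ} (c : ℂ) (ha : CV s a) : CV s (c • a) := by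
  have : Summable fun α => ‖c‖ * (‖a α‖ * om s α) := Summable.mul_left _ ha
  unfold CV
  simpa [mul_assoc] using this

lemma CV.sub {s : ℕ} {a b : (Fin n → ℕ) → ℂ} (ha : CV s a) (hb : CV s b) : CV s (a - b) := by
  have := ha.add (hb.smul (-1))
  convert this using 1
  ext; simp; ring

lemma ev_add {s : ℕ} {a b : (Fin n → ℕ) → ℂ} (ha : CV s a) (hb : CV s b) {z : Fin n → ℂ}
    (hz : z ∈ PD s) : ev (a + b) z = ev a z + ev b z := by
  unfold ev
  rw [← (ha.summable hz).tsum_add (hb.summable hz)]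
  simp [add_mul]

lemma ev_smul (c : ℂ) (a : (Fin n → ℕ) → ℂ) (z : Fin n → ℂ) : ev (c • a) z = c * ev a z := by
  unfold ev
  rw [← tsum_mul_left]
  simp [mul_assoc]

lemma ev_sub {s : ℕ} {a b : (Fin n → ℕ) → ℂ} (ha : CV s a) (hb : CV s b) {z : Fin n → ℂ}
    (hz : z ∈ PD s) : ev (a - b) z = ev a z - ev b z := by
  unfold ev
  rw [← (ha.summable hz).tsum_sub (hb.summable hz)]
  simp [sub_mul]

lemma PD_nhds (s : ℕ) : ∃ ρ > 0, ∀ z : Fin n → ℂ, (∀ i, ‖z i‖ < ρ) → z ∈ PD s := by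
  refine ⟨∏ i : Fin n, ((Nat.nth Nat.Prime i : ℝ)⁻¹) ^ s, ?_, ?_⟩
  · apply Finset.prod_pos
    intro i _
    have : (0:ℝ) < Nat.nth Nat.Prime i := by exact_mod_cast (prime_nth i).pos
    positivity
  · intro z hz i
    refine (hz i).le.trans ?_
    have h1 : ∀ j : Fin n, ((Nat.nth Nat.Prime j : ℝ)⁻¹) ^ s ≤ 1 := by
      intro j
      apply pow_le_one₀ (by positivity)
      apply inv_le_one_of_one_le₀
      exact_mod_cast (prime_nth j).one_lt.le
    rw [← Finset.mul_prod_erase _ _ (Finset.mem_univ i)]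
    apply mul_le_of_le_one_right (by positivity)
    apply Finset.prod_le_one
    · intros; positivity
    · intro j _; exact h1 j

/-- tails become small relative to the leading term -/
lemma tail_small {s₀ : ℕ} {g : (Fin n → ℕ) → ℂ} (hg : CV s₀ g) (α : Fin n → ℕ)
    (hlead : ∀ β, NN β ≤ NN α → g β = 0) :
    ∀ᶠ s in atTop, CV s g ∧ ∑' β, ‖g β‖ * om s β ≤ 1 / 2 * om s α := by
  have hNα : (0:ℝ) < NN α := by exact_mod_cast NN_pos α
  have key : Tendsto (fun t : ℕ => ∑' β, ‖g β‖ * om s₀ β * ((NN α : ℝ) / NN β) ^ t) atTop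
      (nhds (∑' β : Fin n → ℕ, (0:ℝ))) := by
    apply tendsto_tsum_of_dominated_convergence hg
    · intro β
      by_cases hβ : NN β ≤ NN α
      · simp [hlead β hβ]
      · rw [← mul_zero (‖g β‖ * om s₀ β)]
        apply Filter.Tendsto.const_mul
        apply _root_.tendsto_pow_atTop_nhds_zero_of_lt_one (by positivity)
        rw [div_lt_one (by exact_mod_cast NN_pos β)]
        exact_mod_cast not_le.mp hβ
    · filter_upwards with t β
      have := om_pos s₀ β
      rw [Real.norm_of_nonneg (by positivity)]
      by_cases hβ : NN β ≤ NN α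
      · simp [hlead β hβ]
      · apply mul_le_of_le_one_right (by positivity)
        apply pow_le_one₀ (by positivity)
        rw [div_le_one (by exact_mod_cast NN_pos β)]
        exact_mod_cast (not_le.mp hβ).le
  rw [tsum_zero] at key
  have hev := key.eventually (gt_mem_nhds (show (0:ℝ) < 1 / 2 * om s₀ α by
    have := om_pos s₀ α; positivity))
  rw [eventually_atTop] at hev ⊢
  obtain ⟨t₀, ht₀⟩ := hev
  refine ⟨s₀ + t₀, fun s hs => ⟨hg.mono (by omega), ?_⟩⟩
  obtain ⟨t, rfl⟩ : ∃ t, s = s₀ + t := ⟨s - s₀, by omega⟩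
  have h2 := (ht₀ t (by omega)).le
  have h3 : ∀ β : Fin n → ℕ, ‖g β‖ * om (s₀ + t) β =
      (‖g β‖ * om s₀ β * ((NN α : ℝ) / NN β) ^ t) * ((NN α : ℝ)⁻¹) ^ t := by
    intro β
    unfold om
    have h4 : (0:ℝ) < NN β := by exact_mod_cast NN_pos β
    rw [pow_add, div_pow, inv_pow, inv_pow, inv_pow]
    field_simp
  simp_rw [h3]
  rw [tsum_mul_right]
  calc _ ≤ (1 / 2 * om s₀ α) * ((NN α : ℝ)⁻¹) ^ t := by gcongr
    _ = _ := by unfold om; rw [pow_add]; ring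

end SOC

namespace SOC
variable {n : ℕ}

lemma hasSum_of_eq {X E : Type*} [AddCommMonoid E] [TopologicalSpace E] {f g : X → E} {v : E}
    (h : ∀ x, f x = g x) (hg : HasSum g v) : HasSum f v := by
  rwa [show f = g from funext h]

lemma hasSum_shift {E : Type*} [AddCommMonoid E] [TopologicalSpace E] (β : Fin n → ℕ)
    (G : (Fin n → ℕ) → E) (hG : ∀ γ, ¬ β ≤ γ → G γ = 0) {v : E}
    (h : HasSum (fun δ => G (δ + β)) v) : HasSum G v := by
  have hinj : Function.Injective (fun δ : Fin n → ℕ => δ + β) := fun x y h => by simpa using h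
  rw [← hinj.hasSum_iff]
  · exact h
  · intro γ hγ
    apply hG
    intro hle
    exact hγ ⟨γ - β, tsub_add_cancel_of_le hle⟩

/-- evaluation functional on normalized coefficients -/
lemma exists_evalCLM (s : ℕ) (z : Fin n → ℂ) (hz : z ∈ PD s) :
    ∃ Lz : lp (fun _ : Fin n → ℕ => ℂ) 1 →L[ℂ] ℂ,
      ∀ x, Lz x = ∑' γ, x γ * (mon z γ / om s γ) := by
  have hb : ∀ (x : lp (fun _ : Fin n → ℕ => ℂ) 1) γ, ‖x γ * (mon z γ / om s γ)‖ ≤ ‖x γ‖ := by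
    intro x γ
    rw [norm_mul, norm_div]
    apply mul_le_of_le_one_right (norm_nonneg _)
    rw [Complex.norm_real, Real.norm_of_nonneg (om_pos s γ).le, div_le_one (om_pos s γ)]
    exact mon_le hz γ
  have hs : ∀ (x : lp (fun _ : Fin n → ℕ => ℂ) 1), Summable fun γ => x γ * (mon z γ / om s γ) :=
    fun x => Summable.of_norm_bounded (l1_summable x) (hb x)
  let L₀ : lp (fun _ : Fin n → ℕ => ℂ) 1 →ₗ[ℂ] ℂ :=
    { toFun := fun x => ∑' γ, x γ * (mon z γ / om s γ)
      map_add' := by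
        intro x y
        rw [← (hs x).tsum_add (hs y)]
        congr 1; ext1 γ; simp [add_mul]
      map_smul' := by
        intro c x
        simp only [RingHom.id_apply, smul_eq_mul]
        rw [← tsum_mul_left]
        congr 1; ext1 γ; simp [mul_assoc] }
  refine ⟨L₀.mkContinuous 1 ?_, fun x => rfl⟩
  intro x
  rw [one_mul, l1_norm]
  exact tsum_of_norm_bounded (l1_summable x).hasSum (hb x)

/-- division by finitely many power series with small tails -/
lemma division (s : ℕ) (B : Finset (Fin n → ℕ)) (t : (Fin n → ℕ) → (Fin n → ℕ) → ℂ)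
    (ht : ∀ β ∈ B, CV s (t β)) (hts : ∀ β ∈ B, ∑' γ, ‖t β γ‖ * om s γ ≤ 1 / 2 * om s β)
    (a : (Fin n → ℕ) → ℂ) (ha : CV s a) :
    ∃ (r : (Fin n → ℕ) → ℂ) (q : (Fin n → ℕ) → (Fin n → ℕ) → ℂ),
      CV s r ∧ (∀ β ∈ B, CV s (q β)) ∧ (∀ α, (∃ β ∈ B, β ≤ α) → r α = 0) ∧
      ∀ z ∈ PD s, ev a z = ∑ β ∈ B, ev (q β) z * (mon z β + ev (t β) z) + ev r z := by
  classical
  let P : (Fin n → ℕ) → Prop := fun α => ∃ β ∈ B, β ≤ α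
  have hP : ∀ α, ∃ β, P α → (β ∈ B ∧ β ≤ α) := by
    intro α
    by_cases h : P α
    · obtain ⟨β, h1, h2⟩ := h
      exact ⟨β, fun _ => ⟨h1, h2⟩⟩
    · exact ⟨0, fun h' => absurd h' h⟩
  choose idx hidx using hP
  -- the perturbation
  let d₀ : (Fin n → ℕ) → (Fin n → ℕ) → ℂ := fun α γ =>
    if P α ∧ α - idx α ≤ γ then t (idx α) (γ - (α - idx α)) * (om s γ / om s α : ℝ) else 0
  have hd₀ : ∀ α, P α → ∀ δ, d₀ α (δ + (α - idx α)) =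
      t (idx α) δ * (om s δ / om s (idx α) : ℝ) := by
    intro α hα δ
    have h1 : α - idx α ≤ δ + (α - idx α) := le_add_self
    simp only [d₀, hα, h1, and_self, if_true, add_tsub_cancel_right]
    congr 2
    have h2 : om s α = om s (α - idx α) * om s (idx α) := by
      rw [← om_add, tsub_add_cancel_of_le (hidx α hα).2]
    rw [om_add, h2]
    have := om_pos s (α - idx α)
    have := om_pos s (idx α)
    field_simp
  have hd₀z : ∀ α γ, ¬ (α - idx α ≤ γ) → d₀ α γ = 0 := by
    intro α γ h; simp only [d₀]; rw [if_neg (fun h' => h h'.2)]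
  have hd₀n : ∀ α, ¬ P α → d₀ α = 0 := by
    intro α h; ext γ; simp [d₀, h]
  have hsum : ∀ α, ∃ v ≤ (1/2 : ℝ), HasSum (fun γ => ‖d₀ α γ‖) v := by
    intro α
    by_cases h : P α
    · refine ⟨(∑' γ, ‖t (idx α) γ‖ * om s γ) / om s (idx α), ?_, ?_⟩
      · rw [div_le_iff₀ (om_pos _ _)]
        exact hts _ (hidx α h).1
      · apply hasSum_shift (α - idx α)
        · intro γ hγ; rw [hd₀z α γ hγ, norm_zero]
        · have h1 := (ht _ (hidx α h).1).hasSum.div_const (om s (idx α))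
          refine hasSum_of_eq (fun δ => ?_) h1
          rw [hd₀ α h, norm_mul, Complex.norm_real, Real.norm_of_nonneg, mul_div_assoc]
          have := om_pos s δ
          have := om_pos s (idx α)
          positivity
    · refine ⟨0, by norm_num, ?_⟩
      rw [hd₀n α h]; simpa using hasSum_zero
  let d : (Fin n → ℕ) → lp (fun _ : Fin n → ℕ => ℂ) 1 := fun α =>
    ⟨d₀ α, l1_mem _ (hsum α).choose_spec.2.summable⟩
  have hd : ∀ α, ‖d α‖ ≤ 1 / 2 := by
    intro α
    rw [l1_norm]
    obtain ⟨v, hv, hv2⟩ := hsum α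
    change ∑' γ, ‖d₀ α γ‖ ≤ _
    rw [hv2.tsum_eq]; exact hv
  let y : lp (fun _ : Fin n → ℕ => ℂ) 1 := ⟨fun γ => a γ * (om s γ : ℝ), l1_mem _ (by
    have : Summable _ := ha
    convert this using 2 with γ
    rw [norm_mul, Complex.norm_real, Real.norm_of_nonneg (om_pos s γ).le])⟩
  obtain ⟨x, hx⟩ := neumann d hd y
  have hxs := l1_summable x
  refine ⟨fun α => if P α then 0 else x α / (om s α : ℝ),
    fun β δ => if P (δ + β) ∧ idx (δ + β) = β then x (δ + β) / (om s (δ + β) : ℝ) else 0, ?_, ?_, ?_, ?_⟩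
  · apply Summable.of_nonneg_of_le _ _ hxs
    · intro α; have := om_pos s α; positivity
    · intro α
      have := om_pos s α
      by_cases h : P α
      · simp [h]
      · simp only [h, if_false]
        rw [norm_div, Complex.norm_real, Real.norm_of_nonneg this.le, div_mul_cancel₀ _ this.ne']
  · intro β _
    have h1 : Summable fun δ => ‖x (δ + β)‖ * (om s β)⁻¹ := by
      apply Summable.mul_right
      exact hxs.comp_injective (i := fun δ => δ + β) (fun x y h => by simpa using h)
    apply Summable.of_nonneg_of_le _ _ h1
    · intro α; have := om_pos s α; positivity
    · intro δ
      have := om_pos s δ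
      have := om_pos s β
      beta_reduce; split_ifs with h
      · rw [norm_div, Complex.norm_real, Real.norm_of_nonneg (om_pos _ _).le, om_add]
        apply le_of_eq; field_simp
      · simp; positivity
  · intro α hα
    have : P α := hα
    simp [this]
  · intro z hz
    obtain ⟨Lz, hLz⟩ := exists_evalCLM s z hz
    have h1 : Lz y = ev a z := by
      rw [hLz]; unfold ev
      congr 1; ext1 γ
      change a γ * (om s γ : ℝ) * _ = _
      have : (om s γ : ℂ) ≠ 0 := by exact_mod_cast (om_pos s γ).ne'
      field_simp
    have hsm := l1_summable_smul d hd x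
    have h2 : Lz y = ∑' α, (x α * (mon z α / om s α) + x α * Lz (d α)) := by
      conv_lhs => rw [hx]
      rw [map_add, ContinuousLinearMap.map_tsum _ hsm, hLz x, ← Summable.tsum_add]
      · simp
      · apply Summable.of_norm_bounded hxs
        intro γ
        rw [norm_mul, norm_div]
        apply mul_le_of_le_one_right (norm_nonneg _)
        rw [Complex.norm_real, Real.norm_of_nonneg (om_pos s γ).le, div_le_one (om_pos s γ)]
        exact mon_le hz γ
      · exact Lz.summable hsm
    have h3 : ∀ α, P α → Lz (d α) = mon z (α - idx α) / om s α * ev (t (idx α)) z := by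
      intro α hα
      rw [hLz]
      have h4 := ((ht _ (hidx α hα).1).summable hz).hasSum.mul_left (mon z (α - idx α) / (om s α : ℂ))
      apply HasSum.tsum_eq
      apply hasSum_shift (α - idx α)
      · intro γ hγ
        change d₀ α γ * _ = 0
        rw [hd₀z α γ hγ, zero_mul]
      · refine hasSum_of_eq (fun δ => ?_) h4
        change d₀ α _ * _ = _
        rw [hd₀ α hα, mon_add, om_add]
        have h2 : om s α = om s (α - idx α) * om s (idx α) := by
          rw [← om_add, tsub_add_cancel_of_le (hidx α hα).2]
        rw [h2]
        push_cast
        have h5 : (om s δ : ℂ) ≠ 0 := by exact_mod_cast (om_pos s δ).ne'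
        have h6 : (om s (α - idx α) : ℂ) ≠ 0 := by exact_mod_cast (om_pos s _).ne'
        have h7 : (om s (idx α) : ℂ) ≠ 0 := by exact_mod_cast (om_pos s _).ne'
        field_simp
    have h3' : ∀ α, ¬ P α → Lz (d α) = 0 := by
      intro α hα
      have : d α = 0 := by
        apply Subtype.ext
        exact hd₀n α hα
      rw [this, map_zero]
    rw [← h1, h2]
    -- split the sum
    have hterm : ∀ α, x α * (mon z α / om s α) + x α * Lz (d α) =
        (∑ β ∈ B, (if P α ∧ idx α = β then
          x α / (om s α : ℝ) * mon z (α - β) * (mon z β + ev (t β) z) else 0)) +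
        (if P α then 0 else x α / (om s α : ℝ)) * mon z α := by
      intro α
      by_cases hα : P α
      · simp only [hα, true_and, if_true, zero_mul, add_zero]
        rw [Finset.sum_ite_eq, if_pos (hidx α hα).1, h3 α hα]
        have : mon z α = mon z (α - idx α) * mon z (idx α) := by
          rw [← mon_add, tsub_add_cancel_of_le (hidx α hα).2]
        rw [this]; ring
      · simp only [hα, false_and, if_false, h3' α hα]
        simp; ring
    simp_rw [hterm]
    have hS : ∀ β ∈ B, HasSum (fun α => if P α ∧ idx α = β then
          x α / (om s α : ℝ) * mon z (α - β) * (mon z β + ev (t β) z) else 0)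
        (ev (fun δ => if P (δ + β) ∧ idx (δ + β) = β then x (δ + β) / (om s (δ + β) : ℝ) else 0) z
          * (mon z β + ev (t β) z)) := by
      intro β hβ
      apply hasSum_shift β
      · intro γ hγ
        rw [if_neg]
        rintro ⟨h1, h2⟩
        exact hγ (h2 ▸ (hidx γ h1).2)
      · have hq : CV s (fun δ => if P (δ + β) ∧ idx (δ + β) = β then x (δ + β) / (om s (δ + β) : ℝ) else 0) := by
          have h1 : Summable fun δ => ‖x (δ + β)‖ * (om s β)⁻¹ := by
            apply Summable.mul_right
            exact hxs.comp_injective (i := fun δ => δ + β) (fun x y h => by simpa using h)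
          apply Summable.of_nonneg_of_le _ _ h1
          · intro α; have := om_pos s α; positivity
          · intro δ
            have := om_pos s δ
            have := om_pos s β
            beta_reduce; split_ifs with h
            · rw [norm_div, Complex.norm_real, Real.norm_of_nonneg (om_pos _ _).le, om_add]
              apply le_of_eq; field_simp
            · simp; positivity
        refine hasSum_of_eq (fun δ => ?_) ((hq.summable hz).hasSum.mul_right (mon z β + ev (t β) z))
        rw [add_tsub_cancel_right]
        split_ifs <;> simp
    have hR : CV s (fun α => if P α then 0 else x α / (om s α : ℝ)) := by
      apply Summable.of_nonneg_of_le _ _ hxs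
      · intro α; have := om_pos s α; positivity
      · intro α
        have := om_pos s α
        by_cases h : P α
        · simp [h]
        · simp only [h, if_false]
          rw [norm_div, Complex.norm_real, Real.norm_of_nonneg this.le, div_mul_cancel₀ _ this.ne']
    have hfin := (hasSum_sum hS).add (hR.summable hz).hasSum
    exact hfin.tsum_eq
end SOC

namespace SOC
variable {n : ℕ}

/-- germ-like modules of functions near the origin -/
structure GermMod (J : Set ((Fin n → ℂ) → ℂ)) : Prop where
  zero : (fun _ => 0) ∈ J
  add : ∀ f ∈ J, ∀ g ∈ J, (fun z => f z + g z) ∈ J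
  smul : ∀ (c : ℂ), ∀ f ∈ J, (fun z => c * f z) ∈ J
  mul : ∀ (s : ℕ) (q : (Fin n → ℕ) → ℂ), CV s q → ∀ f ∈ J, (fun z => ev q z * f z) ∈ J
  loc : ∀ f ∈ J, ∀ g : (Fin n → ℂ) → ℂ, ∀ ρ > 0,
    (∀ z, (∀ i, ‖z i‖ < ρ) → f z = g z) → g ∈ J

lemma GermMod.sum {J : Set ((Fin n → ℂ) → ℂ)} (hJ : GermMod J) {ι : Type*} (B : Finset ι)
    (f : ι → (Fin n → ℂ) → ℂ) (hf : ∀ β ∈ B, f β ∈ J) : (fun z => ∑ β ∈ B, f β z) ∈ J := by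
  classical
  induction B using Finset.induction_on with
  | empty => simpa using hJ.zero
  | insert β B hβ ih =>
    simp only [Finset.sum_insert hβ]
    exact hJ.add _ (hf β (by simp)) _ (ih fun γ hγ => hf γ (by simp [hγ]))

lemma ev_single (β : Fin n → ℕ) (z : Fin n → ℂ) : ev (Pi.single β 1) z = mon z β := by
  unfold ev
  rw [tsum_eq_single β]
  · simp
  · intro γ hγ; simp [Pi.single_apply, hγ]

lemma CV_single (s : ℕ) (β : Fin n → ℕ) : CV s (Pi.single β 1) := by
  apply summable_of_ne_finset_zero (s := {β})
  intro γ hγ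
  have : γ ≠ β := by simpa using hγ
  simp [Pi.single_apply, this]

lemma closure1 {J : Set ((Fin n → ℂ) → ℂ)} (hJ : GermMod J) {s₀ : ℕ} {a : (Fin n → ℕ) → ℂ}
    (ha : CV s₀ a)
    (H : ∀ S : Finset (Fin n → ℕ), ∃ b s, CV s b ∧ ev b ∈ J ∧ ∀ β ∈ S, b β = a β) : ev a ∈ J := by
  classical
  let E : (Fin n → ℕ) → Prop := fun α => ∃ b s, CV s b ∧ ev b ∈ J ∧ b α = 1 ∧
    ∀ β, NN β < NN α → b β = 0
  have hBfin : {α | Minimal E α}.Finite :=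
    WellQuasiOrderedLE.finite_of_isAntichain (setOfPred_minimal_antichain E)
  let B := hBfin.toFinset
  have hB : ∀ β ∈ B, E β := fun β hβ => ((hBfin.mem_toFinset).mp hβ).prop
  have hB2 : ∀ α, E α → ∃ β ∈ B, β ≤ α := by
    intro α hα
    obtain ⟨β, h1, h2⟩ := exists_minimal_le_of_wellFoundedLT E α hα
    exact ⟨β, (hBfin.mem_toFinset).mpr h2, h1⟩
  choose! g sg hg1 hg2 hg3 hg4 using hB
  let t : (Fin n → ℕ) → (Fin n → ℕ) → ℂ := fun β => g β - Pi.single β 1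
  have htail : ∀ β ∈ B, ∀ᶠ s in atTop, CV s (t β) ∧ ∑' γ, ‖t β γ‖ * om s γ ≤ 1 / 2 * om s β := by
    intro β hβ
    apply tail_small ((hg1 β hβ).sub (CV_single _ β))
    intro γ hγ
    rcases hγ.lt_or_eq with h | h
    · have : γ ≠ β := by rintro rfl; exact lt_irrefl _ h
      simp [t, Pi.single_apply, this, hg4 β hβ γ h]
    · have := NN_inj h; subst this
      simp [t, hg3 γ hβ]
  have hall : ∀ᶠ s in atTop, ∀ β ∈ B, CV s (t β) ∧ ∑' γ, ‖t β γ‖ * om s γ ≤ 1 / 2 * om s β := by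
    rw [Filter.eventually_all_finset]; exact htail
  obtain ⟨s, hs, hs0⟩ := (hall.and (eventually_ge_atTop s₀)).exists
  obtain ⟨r, q, hr, hq, hr0, hdiv⟩ := division s B t (fun β hβ => (hs β hβ).1)
    (fun β hβ => (hs β hβ).2) a (ha.mono hs0)
  have hgt : ∀ β ∈ B, ∀ z ∈ PD s, mon z β + ev (t β) z = ev (g β) z := by
    intro β hβ z hz
    have : g β = Pi.single β 1 + t β := by simp [t]
    rw [this, ev_add (CV_single _ _) (hs β hβ).1 hz, ev_single]
  obtain ⟨ρ, hρ, hPD⟩ := PD_nhds (n := n) s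
  have hJsum : (fun z => ∑ β ∈ B, ev (q β) z * ev (g β) z) ∈ J := by
    apply hJ.sum
    intro β hβ
    exact hJ.mul s _ (hq β hβ) _ (hg2 β hβ)
  have hdiv2 : ∀ z ∈ PD s, ev a z = ∑ β ∈ B, ev (q β) z * ev (g β) z + ev r z := by
    intro z hz
    rw [hdiv z hz]
    congr 1
    apply Finset.sum_congr rfl
    intro β hβ
    rw [hgt β hβ z hz]
  have hrz : r = 0 := by
    by_contra hne
    have hex : ∃ α, r α ≠ 0 := by
      by_contra h; push Not at h; exact hne (funext h)
    obtain ⟨α, hα, hmin⟩ : ∃ α, r α ≠ 0 ∧ ∀ β, NN β < NN α → r β = 0 := by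
      let Q : Set ℕ := NN '' {α | r α ≠ 0}
      have hQ : Q.Nonempty := by
        obtain ⟨α, hα⟩ := hex
        exact ⟨_, α, hα, rfl⟩
      obtain ⟨α, hα, hα2⟩ := Nat.sInf_mem hQ
      refine ⟨α, hα, fun β hβ => ?_⟩
      by_contra hne
      have : sInf Q ≤ NN β := Nat.sInf_le ⟨β, hne, rfl⟩
      omega
    have hSfin : {β : Fin n → ℕ | NN β ≤ NN α}.Finite :=
      Set.Finite.preimage (f := NN) NN_inj.injOn (Set.finite_Iic (NN α))
    obtain ⟨b, sb, hb1, hb2, hb3⟩ := H hSfin.toFinset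
    have hb3' : ∀ β, NN β ≤ NN α → b β = a β := fun β hβ => hb3 β ((hSfin.mem_toFinset).mpr hβ)
    let sm := max s sb
    have hbm := hb1.mono (le_max_right s sb)
    have ham := (ha.mono hs0).mono (le_max_left s sb)
    have hrm := hr.mono (le_max_left s sb)
    have hcm : CV sm (b - a + r) := (hbm.sub ham).add hrm
    have hcJ : ev (b - a + r) ∈ J := by
      obtain ⟨ρ', hρ', hPD'⟩ := PD_nhds (n := n) sm
      refine hJ.loc (fun z => ev b z + (-1) * ∑ β ∈ B, ev (q β) z * ev (g β) z)
        (hJ.add _ hb2 _ (hJ.smul (-1) _ hJsum)) _ (min ρ ρ') (lt_min hρ hρ') ?_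
      intro z hz
      have h1 := hPD z (fun i => (hz i).trans_le (min_le_left _ _))
      have h2 := hPD' z (fun i => (hz i).trans_le (min_le_right _ _))
      rw [ev_add (hbm.sub ham) hrm h2, ev_sub hbm ham h2, hdiv2 z h1]
      ring
    have hEα : E α := by
      refine ⟨(r α)⁻¹ • (b - a + r), sm, hcm.smul _, ?_, ?_, ?_⟩
      · have := hJ.smul (r α)⁻¹ _ hcJ
        refine hJ.loc _ this _ 1 one_pos ?_
        intro z _
        rw [ev_smul]
      · simp [hb3' α le_rfl, hα]
      · intro β hβ
        simp [hb3' β hβ.le, hmin β hβ]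
    exact hα (hr0 α (hB2 α hEα))
  refine hJ.loc _ hJsum _ ρ hρ ?_
  intro z hz
  rw [hdiv2 z (hPD z hz), hrz]
  simp [ev]

lemma closure2 {J : Set ((Fin n → ℂ) → ℂ)} (hJ : GermMod J) {s₀ : ℕ} {a : (Fin n → ℕ) → ℂ}
    (ha : CV s₀ a) (c : ℕ → (Fin n → ℕ) → ℂ) (hc : ∀ k, ∃ s, CV s (c k)) (hcJ : ∀ k, ev (c k) ∈ J)
    (hlim : ∀ α, Tendsto (fun k => c k α) atTop (nhds (a α))) : ev a ∈ J := by
  apply closure1 hJ ha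
  intro S
  let U : Submodule ℂ (S → ℂ) :=
    { carrier := {x | ∃ b s, CV s b ∧ ev b ∈ J ∧ ∀ β : S, x β = b β}
      zero_mem' := by
        refine ⟨0, 0, ?_, ?_, by simp⟩
        · unfold CV; simpa using summable_zero
        · refine hJ.loc _ hJ.zero _ 1 one_pos ?_
          intro z _; simp [ev]
      add_mem' := by
        rintro x y ⟨b, s, h1, h2, h3⟩ ⟨b', s', h1', h2', h3'⟩
        have k1 := h1.mono (le_max_left s s')
        have k2 := h1'.mono (le_max_right s s')
        refine ⟨b + b', max s s', k1.add k2, ?_, ?_⟩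
        · obtain ⟨ρ', hρ', hPD'⟩ := PD_nhds (n := n) (max s s')
          refine hJ.loc _ (hJ.add _ h2 _ h2') _ ρ' hρ' ?_
          intro z hz
          rw [ev_add k1 k2 (hPD' z hz)]
        · intro β; simp [h3 β, h3' β]
      smul_mem' := by
        rintro w x ⟨b, s, h1, h2, h3⟩
        refine ⟨w • b, s, h1.smul _, ?_, ?_⟩
        · refine hJ.loc _ (hJ.smul w _ h2) _ 1 one_pos ?_
          intro z hz
          rw [ev_smul]
        · intro β; simp [h3 β] }
  have hcl : IsClosed (U : Set (S → ℂ)) := U.closed_of_finiteDimensional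
  have hmem : (fun β : S => a β) ∈ U := by
    apply hcl.mem_of_tendsto (b := atTop) (f := fun k => fun β : S => c k β)
    · rw [tendsto_pi_nhds]
      intro β; exact hlim β
    · refine Filter.Eventually.of_forall fun k => ?_
      obtain ⟨s, hs⟩ := hc k
      exact ⟨c k, s, hs, hcJ k, fun β => rfl⟩
  obtain ⟨b, s, h1, h2, h3⟩ := hmem
  exact ⟨b, s, h1, h2, fun β hβ => (h3 ⟨β, hβ⟩).symm⟩
end SOC

namespace SOC

lemma geo_summable (n : ℕ) {x : ℝ} (h0 : 0 ≤ x) (h1 : x < 1) :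
    Summable fun α : Fin n → ℕ => x ^ (∑ i, α i) := by
  induction n with
  | zero => exact (hasSum_fintype _).summable
  | succ n ih =>
    rw [← (Fin.consEquiv (fun _ : Fin (n+1) => ℕ)).summable_iff]
    have h2 : Summable fun p : ℕ × (Fin n → ℕ) => x ^ p.1 * x ^ (∑ i, p.2 i) :=
      Summable.mul_of_nonneg (f := fun k : ℕ => x ^ k) (g := fun α : Fin n → ℕ => x ^ (∑ i, α i))
        (summable_geometric_of_lt_one h0 h1) ih (fun k => pow_nonneg h0 _)
        (fun k => pow_nonneg h0 _)
    refine h2.congr ?_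
    intro p
    simp [Fin.sum_univ_succ, Fin.consEquiv, pow_add]

lemma mon_norm_le {n : ℕ} (z : Fin n → ℂ) (α : Fin n → ℕ) : ‖mon z α‖ ≤ ‖z‖ ^ (∑ i, α i) := by
  unfold mon
  rw [norm_prod, ← Finset.prod_pow_eq_pow_sum]
  apply Finset.prod_le_prod
  · intros; positivity
  · intro i _
    rw [norm_pow]
    exact pow_le_pow_left₀ (norm_nonneg _) (norm_le_pi_norm z i) _

lemma summable_coef {n : ℕ} {a : (Fin n → ℕ) → ℂ} {R M : ℝ} (hR : 0 < R)
    (ha : ∀ α, ‖a α‖ * R ^ (∑ i, α i) ≤ M) {z : Fin n → ℂ} (hz : ‖z‖ < R) :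
    Summable fun α => ‖a α * mon z α‖ := by
  have h1 : ‖z‖ / R < 1 := by rwa [div_lt_one hR]
  apply Summable.of_nonneg_of_le (fun _ => norm_nonneg _) _
    ((geo_summable n (by positivity) h1).mul_left M)
  intro α
  rw [norm_mul, div_pow]
  calc ‖a α‖ * ‖mon z α‖ ≤ ‖a α‖ * ‖z‖ ^ (∑ i, α i) := by gcongr; exact mon_norm_le z α
    _ = (‖a α‖ * R ^ (∑ i, α i)) * (‖z‖ ^ (∑ i, α i) / R ^ (∑ i, α i)) := by field_simp
    _ ≤ _ := by gcongr; exact ha α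

section param
variable {E : Type*} [NormedAddCommGroup E] [NormedSpace ℂ E] [FiniteDimensional ℂ E]

lemma fderiv_bound {E : Type*} [NormedAddCommGroup E] [NormedSpace ℂ E]
    {f : E → ℂ} {R M : ℝ} (hf : DifferentiableOn ℂ f (Metric.ball 0 R))
    (hM : ∀ z ∈ Metric.ball (0 : E) R, ‖f z‖ ≤ M) {z : E} {δ : ℝ} (hδ : 0 < δ) (hz : ‖z‖ + δ ≤ R) :
    ‖fderiv ℂ f z‖ ≤ 2 * M / δ := by
  have hsub : Metric.ball z δ ⊆ Metric.ball 0 R := by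
    apply Metric.ball_subset_ball'
    rw [dist_zero_right]; linarith
  apply Complex.norm_fderiv_le_div_of_mapsTo_ball (hf.mono hsub) _ hδ
  intro y hy
  rw [mem_closedBall_iff_norm]
  have h1 := hM y (hsub hy)
  have h2 := hM z (hsub (Metric.mem_ball_self hδ))
  have := norm_sub_le (f y) (f z)
  linarith

lemma circle_param {G : ℂ × E → ℂ} {R R' M : ℝ} (hR' : 0 < R') (hRR : R' < R)
    (hG : DifferentiableOn ℂ G (Metric.ball 0 R)) (hM : ∀ z ∈ Metric.ball (0 : ℂ × E) R, ‖G z‖ ≤ M)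
    (g : ℂ → ℂ) (hg : ContinuousOn g (Metric.sphere 0 R')) :
    DifferentiableOn ℂ (fun x => ∮ ζ in C(0, R'), g ζ * G (ζ, x)) (Metric.ball 0 R) := by
  intro x₀ hx₀
  have hx₀' : ‖x₀‖ < R := by simpa using hx₀
  obtain ⟨δ, hδ, hδ1, hδ2⟩ : ∃ δ > 0, ‖x₀‖ + 2 * δ ≤ R ∧ R' + 2 * δ ≤ R := by
    refine ⟨min ((R - ‖x₀‖) / 2) ((R - R') / 2), ?_, ?_, ?_⟩
    · apply lt_min <;> linarith
    · have := min_le_left ((R - ‖x₀‖) / 2) ((R - R') / 2); linarith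
    · have := min_le_right ((R - ‖x₀‖) / 2) ((R - R') / 2); linarith
  apply DifferentiableAt.differentiableWithinAt
  have hmap : ∀ θ : ℝ, ‖circleMap 0 R' θ‖ = R' := by
    intro θ; simp [abs_of_pos hR']
  have hin : ∀ θ : ℝ, ∀ x ∈ Metric.ball x₀ δ, ‖(circleMap 0 R' θ, x)‖ + δ ≤ R := by
    intro θ x hx
    rw [Prod.norm_def, hmap]
    have : ‖x‖ ≤ ‖x₀‖ + δ := by
      have h1 := norm_sub_norm_le x x₀
      rw [mem_ball_iff_norm] at hx
      linarith
    have := max_le_iff.mpr (⟨by linarith, by linarith⟩ : R' ≤ R - δ ∧ ‖x‖ ≤ R - δ)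
    simp only; linarith
  have hgc : Continuous fun θ : ℝ => g (circleMap 0 R' θ) := by
    apply hg.comp_continuous (continuous_circleMap 0 R')
    intro θ; simp [abs_of_pos hR']
  have hdc : Continuous fun θ : ℝ => deriv (circleMap 0 R') θ := by
    simp only [deriv_circleMap]
    fun_prop
  have hGc : ∀ x ∈ Metric.ball x₀ δ, Continuous fun θ : ℝ => G (circleMap 0 R' θ, x) := by
    intro x hx
    apply hG.continuousOn.comp_continuous
    · exact (continuous_circleMap 0 R').prodMk continuous_const
    · intro θ
      rw [mem_ball_zero_iff]; have := hin θ x hx; linarith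
  let L : E →L[ℂ] ℂ × E := ContinuousLinearMap.inr ℂ ℂ E
  have hDx : ∀ θ : ℝ, ∀ x ∈ Metric.ball x₀ δ, HasFDerivAt (fun x => G (circleMap 0 R' θ, x))
      ((fderiv ℂ G (circleMap 0 R' θ, x)).comp L) x := by
    intro θ x hx
    have h1 : DifferentiableAt ℂ G (circleMap 0 R' θ, x) := by
      apply hG.differentiableAt
      apply Metric.isOpen_ball.mem_nhds
      rw [mem_ball_zero_iff]; have := hin θ x hx; linarith
    exact h1.hasFDerivAt.comp x (hasFDerivAt_prodMk_right _ _)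
  have hL : ‖L‖ ≤ 1 := ContinuousLinearMap.norm_inr_le_one ℂ ℂ E
  let w : ℝ → ℂ := fun θ => deriv (circleMap 0 R') θ * g (circleMap 0 R' θ)
  have hw : Continuous w := hdc.mul hgc
  have hbd : ∀ θ : ℝ, ∀ x ∈ Metric.ball x₀ δ, ‖(fderiv ℂ G (circleMap 0 R' θ, x)).comp L‖ ≤ 2 * M / δ := by
    intro θ x hx
    have h3 := fderiv_bound hG hM hδ (hin θ x hx)
    calc _ ≤ ‖fderiv ℂ G (circleMap 0 R' θ, x)‖ * ‖L‖ := ContinuousLinearMap.opNorm_comp_le _ _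
      _ ≤ ‖fderiv ℂ G (circleMap 0 R' θ, x)‖ * 1 := by gcongr
      _ ≤ _ := by rw [mul_one]; exact h3
  have hM0 : 0 ≤ 2 * M / δ := (norm_nonneg _).trans (hbd 0 x₀ (Metric.mem_ball_self hδ))
  borelize E
  have key := intervalIntegral.hasFDerivAt_integral_of_dominated_loc_of_lip (𝕜 := ℂ) (μ := volume)
    (a := 0) (b := 2 * Real.pi)
    (F := fun x θ => w θ * G (circleMap 0 R' θ, x)) (x₀ := x₀)
    (F' := fun θ => w θ • (fderiv ℂ G (circleMap 0 R' θ, x₀)).comp L)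
    (s := Metric.ball x₀ δ) (bound := fun θ => ‖w θ‖ * (2 * M / δ)) (Metric.ball_mem_nhds _ hδ)
    ?_ ?_ ?_ ?_ ?_ ?_
  · have := key.2.differentiableAt
    unfold circleIntegral
    simpa [w, mul_assoc] using this
  · filter_upwards [Metric.ball_mem_nhds x₀ hδ] with x hx
    exact (hw.mul (hGc x hx)).aestronglyMeasurable
  · exact (hw.mul (hGc x₀ (Metric.mem_ball_self hδ))).intervalIntegrable _ _
  · apply AEStronglyMeasurable.smul hw.aestronglyMeasurable
    apply Continuous.comp_aestronglyMeasurable (g := fun A : ℂ × E →L[ℂ] ℂ => A.comp L)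
    · fun_prop
    · have : FiniteDimensional ℂ (ℂ × E) := inferInstance
      have : ProperSpace (ℂ × E) := FiniteDimensional.proper ℂ _
      have : ProperSpace E := FiniteDimensional.proper ℂ _
      have : SecondCountableTopology (ℂ × E →L[ℂ] ℂ) := by
        have : ProperSpace (ℂ × E →L[ℂ] ℂ) := FiniteDimensional.proper ℂ _
        infer_instance
      have h1 := (measurable_fderiv ℂ G).comp
        ((continuous_circleMap 0 R').prodMk (continuous_const (y := x₀))).measurable
      exact h1.aestronglyMeasurable
  · refine Filter.Eventually.of_forall fun θ _ => ?_
    have h1 : LipschitzOnWith (‖w θ‖ * (2 * M / δ)).toNNReal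
        (fun x => w θ * G (circleMap 0 R' θ, x)) (Metric.ball x₀ δ) := by
      apply Convex.lipschitzOnWith_of_nnnorm_hasFDerivWithin_le (𝕜 := ℂ)
        (f' := fun x => w θ • (fderiv ℂ G (circleMap 0 R' θ, x)).comp L)
      · intro x hx
        exact ((hDx θ x hx).const_mul (w θ)).hasFDerivWithinAt
      · intro x hx
        rw [← NNReal.coe_le_coe, coe_nnnorm, norm_smul, Real.coe_toNNReal _ (by positivity)]
        gcongr
        exact hbd θ x hx
      · exact convex_ball _ _
    rwa [Real.nnabs_of_nonneg (by positivity)]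
  · exact (hw.norm.mul continuous_const).intervalIntegrable _ _
  · refine Filter.Eventually.of_forall fun θ _ => ?_
    exact (hDx θ x₀ (Metric.mem_ball_self hδ)).const_mul (w θ)
end param
end SOC

namespace SOC

lemma cons_mem_ball {n : ℕ} {R : ℝ} (ζ : ℂ) (x : Fin n → ℂ) :
    (Fin.cons ζ x : Fin (n+1) → ℂ) ∈ Metric.ball (0 : Fin (n+1) → ℂ) R ↔
      (ζ, x) ∈ Metric.ball (0 : ℂ × (Fin n → ℂ)) R := by
  rw [mem_ball_zero_iff, mem_ball_zero_iff, Prod.norm_def]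
  by_cases hR : 0 < R
  · rw [pi_norm_lt_iff hR, Fin.forall_fin_succ, max_lt_iff, pi_norm_lt_iff hR]
    simp
  · constructor <;> intro h
    · exact absurd ((norm_nonneg _).trans_lt h) hR
    · rw [← Prod.norm_def] at h
      exact absurd ((norm_nonneg _).trans_lt h) hR

theorem exists_powerseries (n : ℕ) {R R' : ℝ} (hR' : 0 < R') (hRR : R' < R) :
    ∀ (M : ℝ) (F : (Fin n → ℂ) → ℂ), DifferentiableOn ℂ F (Metric.ball 0 R) →
    (∀ z ∈ Metric.ball (0 : Fin n → ℂ) R, ‖F z‖ ≤ M) →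
    ∃ a : (Fin n → ℕ) → ℂ, (∀ α, ‖a α‖ * R' ^ (∑ i, α i) ≤ M) ∧
      ∀ z : Fin n → ℂ, ‖z‖ < R' → HasSum (fun α => a α * mon z α) (F z) := by
  induction n with
  | zero =>
    intro M F hF hM
    refine ⟨fun _ => F 0, ?_, ?_⟩
    · intro α
      simpa using hM 0 (Metric.mem_ball_self (hR'.trans hRR))
    · intro z hz
      have : z = 0 := Subsingleton.elim _ _
      subst this
      have := hasSum_fintype (fun α : Fin 0 → ℕ => F 0 * mon 0 α)
      simpa [mon] using this
  | succ n ih =>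
    intro M F hF hM
    let G : ℂ × (Fin n → ℂ) → ℂ := fun p => F (Fin.cons p.1 p.2)
    have hG : DifferentiableOn ℂ G (Metric.ball 0 R) := by
      have h1 : DifferentiableOn ℂ (Fin.consEquivL ℂ (fun _ : Fin (n+1) => ℂ)) (Metric.ball 0 R) :=
        (Fin.consEquivL ℂ (fun _ : Fin (n+1) => ℂ)).differentiable.differentiableOn
      refine DifferentiableOn.comp (g := F) hF h1 ?_
      intro p hp
      exact (cons_mem_ball p.1 p.2).mpr hp
    have hGM : ∀ p ∈ Metric.ball (0 : ℂ × (Fin n → ℂ)) R, ‖G p‖ ≤ M := by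
      intro p hp
      exact hM _ ((cons_mem_ball p.1 p.2).mpr hp)
    let c : ℕ → (Fin n → ℂ) → ℂ := fun k x =>
      (2 * Real.pi * I)⁻¹ * ∮ ζ in C(0, R'), (ζ⁻¹ ^ k * ζ⁻¹) * G (ζ, x)
    have hc : ∀ k, DifferentiableOn ℂ (c k) (Metric.ball 0 R) := by
      intro k
      apply DifferentiableOn.const_mul
      apply circle_param hR' hRR hG hGM
      have : ContinuousOn (fun ζ : ℂ => ζ⁻¹) (Metric.sphere 0 R') := by
        apply continuousOn_id.inv₀
        intro ζ hζ h
        have h' : ζ = 0 := h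
        rw [h', mem_sphere_zero_iff_norm, norm_zero] at hζ
        exact hR'.ne hζ
      exact (this.pow k).mul this
    have hcM : ∀ k, ∀ x ∈ Metric.ball (0 : Fin n → ℂ) R, ‖c k x‖ ≤ M / R' ^ k := by
      intro k x hx
      have h1 := circleIntegral.norm_two_pi_i_inv_smul_integral_le_of_norm_le_const
        (f := fun ζ => (ζ⁻¹ ^ k * ζ⁻¹) * G (ζ, x)) (c := 0) (R := R')
        (C := (R'⁻¹ ^ k * R'⁻¹) * M) hR'.le ?_
      · simp only [c]
        rw [smul_eq_mul] at h1
        refine h1.trans (le_of_eq ?_)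
        rw [inv_pow]
        field_simp
      · intro ζ hζ
        rw [mem_sphere_zero_iff_norm] at hζ
        rw [norm_mul, norm_mul, norm_pow, norm_inv, hζ]
        gcongr
        apply hGM
        rw [mem_ball_zero_iff] at hx ⊢
        rw [Prod.norm_def]
        exact max_lt (by simp only; rw [hζ]; exact hRR) hx
    have h1d : ∀ ζ : ℂ, ‖ζ‖ < R' → ∀ x ∈ Metric.ball (0 : Fin n → ℂ) R,
        HasSum (fun k => c k x * ζ ^ k) (G (ζ, x)) := by
      intro ζ hζ x hx
      have hd : DifferentiableOn ℂ (fun ζ => G (ζ, x)) (Metric.ball 0 R) := by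
        refine DifferentiableOn.comp (g := G) hG (f := fun ζ => (ζ, x)) ?_ ?_
        · exact (differentiable_id.prodMk (differentiable_const x)).differentiableOn
        · intro ζ hζ
          rw [mem_ball_zero_iff] at hx hζ ⊢
          rw [Prod.norm_def]
          exact max_lt hζ hx
      have hd2 : DiffContOnCl ℂ (fun ζ => G (ζ, x)) (Metric.ball 0 (R'.toNNReal : ℝ)) := by
        rw [Real.coe_toNNReal _ hR'.le]
        apply (hd.mono _).diffContOnCl
        rw [closure_ball _ hR'.ne']
        exact Metric.closedBall_subset_ball hRR
      have h2 := hd2.hasFPowerSeriesOnBall (by simpa using hR')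
      have h3 := h2.hasSum (y := ζ) (by
        rw [Metric.mem_eball, edist_zero_right, enorm_lt_coe]
        rw [← NNReal.coe_lt_coe, Real.coe_toNNReal _ hR'.le]
        exact hζ)
      rw [zero_add] at h3
      refine hasSum_of_eq ?_ h3
      intro k
      rw [cauchyPowerSeries_apply, Real.coe_toNNReal _ hR'.le]
      simp only [c, smul_eq_mul, sub_zero]
      rw [mul_assoc, mul_comm _ (ζ ^ k), ← smul_eq_mul (ζ ^ k), ← circleIntegral.integral_smul]
      congr 2; ext z
      simp only [smul_eq_mul, div_pow, inv_pow]
      ring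
    choose a' ha1 ha2 using fun k => ih (M / R' ^ k) (c k) (hc k) (hcM k)
    let a : (Fin (n+1) → ℕ) → ℂ := fun α => a' (α 0) (Fin.tail α)
    have haM : ∀ α, ‖a α‖ * R' ^ (∑ i, α i) ≤ M := by
      intro α
      have := ha1 (α 0) (Fin.tail α)
      rw [le_div_iff₀ (by positivity)] at this
      rw [Fin.sum_univ_succ, pow_add]
      calc _ = ‖a α‖ * R' ^ (∑ i : Fin n, α i.succ) * R' ^ (α 0) := by ring
        _ ≤ M := this
    refine ⟨a, haM, ?_⟩
    intro z hz
    have hs := (summable_coef hR' haM hz).of_norm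
    rw [← (Fin.consEquiv (fun _ : Fin (n+1) => ℕ)).hasSum_iff]
    have hs2 := ((Fin.consEquiv (fun _ : Fin (n+1) => ℕ)).summable_iff).mpr hs
    have hz0 : ‖z 0‖ < R' := (norm_le_pi_norm z 0).trans_lt hz
    have hzt : ‖Fin.tail z‖ < R' := by
      rw [pi_norm_lt_iff hR']
      intro i; exact (norm_le_pi_norm z i.succ).trans_lt hz
    have h4 : ∀ k, HasSum (fun α' : Fin n → ℕ =>
        ((fun α => a α * mon z α) ∘ (Fin.consEquiv (fun _ : Fin (n+1) => ℕ))) (k, α'))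
        (c k (Fin.tail z) * z 0 ^ k) := by
      intro k
      refine hasSum_of_eq ?_ ((ha2 k (Fin.tail z) hzt).mul_right (z 0 ^ k))
      intro α'
      simp [a, mon, Fin.consEquiv, Fin.prod_univ_succ, Fin.tail]
      ring
    have h5 := hs2.hasSum.prod_fiberwise h4
    have h6 := h1d (z 0) hz0 (Fin.tail z) (by rw [mem_ball_zero_iff]; linarith)
    have h7 : G (z 0, Fin.tail z) = F z := by simp [G]
    rw [h7] at h6
    rw [← h5.unique h6]
    exact hs2.hasSum
end SOC

namespace SOC
variable {n : ℕ}

lemma NN_ge (α : Fin n → ℕ) : 2 ^ (∑ i, α i) ≤ NN α := by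
  unfold NN
  rw [← Finset.prod_pow_eq_pow_sum]
  apply Finset.prod_le_prod'
  intro i _
  exact Nat.pow_le_pow_left (prime_nth i).two_le _

lemma CV_of_bound {R : ℝ} (hR : 0 < R) : ∃ s : ℕ, ∀ (a : (Fin n → ℕ) → ℂ) (M : ℝ),
    (∀ α, ‖a α‖ * R ^ (∑ i, α i) ≤ M) → CV s a := by
  obtain ⟨s, hs⟩ := exists_pow_lt_of_lt_one hR (show (1/2 : ℝ) < 1 by norm_num)
  refine ⟨s, fun a M hM => ?_⟩
  have hx : (1/2:ℝ)^s / R < 1 := by rwa [div_lt_one hR]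
  apply Summable.of_nonneg_of_le _ _ ((geo_summable n (by positivity) hx).mul_left M)
  · intro α; have := om_pos s α; positivity
  · intro α
    have h1 : om s α ≤ ((1/2:ℝ)^s) ^ (∑ i, α i) := by
      unfold om
      rw [← pow_mul, mul_comm, pow_mul]
      apply pow_le_pow_left₀ (by positivity)
      rw [one_div, inv_pow]
      apply inv_anti₀ (by positivity)
      exact_mod_cast NN_ge α
    rw [div_pow]
    calc ‖a α‖ * om s α ≤ ‖a α‖ * ((1/2:ℝ)^s) ^ (∑ i, α i) := by gcongr
      _ = (‖a α‖ * R ^ (∑ i, α i)) * (((1/2:ℝ)^s) ^ (∑ i, α i) / R ^ (∑ i, α i)) := by field_simp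
      _ ≤ _ := by gcongr; exact hM α

lemma coef_compact {R M : ℝ} (hR : 0 < R) (b : ℕ → (Fin n → ℕ) → ℂ)
    (hb : ∀ j α, ‖b j α‖ * R ^ (∑ i, α i) ≤ M) :
    ∃ (b' : (Fin n → ℕ) → ℂ) (σ : ℕ → ℕ), StrictMono σ ∧ (∀ α, ‖b' α‖ * R ^ (∑ i, α i) ≤ M) ∧
      (∀ z, ‖z‖ < R → Tendsto (fun j => ev (b (σ j)) z) atTop (nhds (ev b' z))) := by
  let K : Set ((Fin n → ℕ) → ℂ) := Set.pi univ fun α => Metric.closedBall 0 (M / R ^ (∑ i, α i))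
  have hK : IsCompact K := isCompact_univ_pi fun α => isCompact_closedBall _ _
  have hmem : ∀ j, b j ∈ K := by
    intro j α _
    rw [mem_closedBall_zero_iff, le_div_iff₀ (by positivity)]
    exact hb j α
  obtain ⟨b', hb', σ, hσ, hlim⟩ := hK.tendsto_subseq hmem
  rw [tendsto_pi_nhds] at hlim
  refine ⟨b', σ, hσ, ?_, ?_⟩
  · intro α
    have := hb' α (mem_univ _)
    rwa [mem_closedBall_zero_iff, le_div_iff₀ (by positivity)] at this
  · intro z hz
    have hx : ‖z‖ / R < 1 := by rwa [div_lt_one hR]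
    unfold ev
    apply tendsto_tsum_of_dominated_convergence ((geo_summable n (by positivity) hx).mul_left M)
    · intro α
      exact (hlim α).mul_const _
    · filter_upwards with j α
      rw [norm_mul, div_pow]
      calc _ ≤ ‖b (σ j) α‖ * ‖z‖ ^ (∑ i, α i) := by gcongr; exact mon_norm_le z α
        _ = (‖b (σ j) α‖ * R ^ (∑ i, α i)) * (‖z‖ ^ (∑ i, α i) / R ^ (∑ i, α i)) := by field_simp
        _ ≤ _ := by gcongr; exact hb _ α

lemma continuousOn_ev {R M : ℝ} (hR : 0 < R) {a : (Fin n → ℕ) → ℂ}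
    (ha : ∀ α, ‖a α‖ * R ^ (∑ i, α i) ≤ M) {R' : ℝ} (hR' : R' < R) :
    ContinuousOn (ev a) (Metric.closedBall 0 R') := by
  by_cases h0 : 0 ≤ R'
  · have hx : R' / R < 1 := by rwa [div_lt_one hR]
    unfold ev
    apply continuousOn_tsum _ ((geo_summable n (by positivity) hx).mul_left M)
    · intro α z hz
      rw [mem_closedBall_zero_iff] at hz
      rw [norm_mul, div_pow]
      calc _ ≤ ‖a α‖ * ‖z‖ ^ (∑ i, α i) := by gcongr; exact mon_norm_le z α
        _ ≤ ‖a α‖ * R' ^ (∑ i, α i) := by gcongr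
        _ = (‖a α‖ * R ^ (∑ i, α i)) * (R' ^ (∑ i, α i) / R ^ (∑ i, α i)) := by field_simp
        _ ≤ _ := by gcongr; exact ha α
    · intro α
      unfold mon
      fun_prop
  · rw [Metric.closedBall_eq_empty.mpr (by linarith)]
    exact continuousOn_empty _

/-- series converging in the weight sense are continuous near zero -/
lemma CV.continuousOn {s : ℕ} {a : (Fin n → ℕ) → ℂ} (ha : CV s a) : ContinuousOn (ev a) (PD s) := by
  unfold ev
  apply continuousOn_tsum _ ha
  · intro α z hz
    rw [norm_mul]
    gcongr
    exact mon_le hz α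
  · intro α
    unfold mon
    fun_prop

lemma CV.bound {s : ℕ} {a : (Fin n → ℕ) → ℂ} (ha : CV s a) : ∃ C, ∀ z ∈ PD s, ‖ev a z‖ ≤ C := by
  refine ⟨∑' α, ‖a α‖ * om s α, fun z hz => ?_⟩
  apply tsum_of_norm_bounded ha.hasSum
  intro α
  rw [norm_mul]
  gcongr
  exact mon_le hz α
end SOC

namespace SOC
variable {n : ℕ}

/-- the squared Euclidean norm -/
noncomputable def qq (z : Fin n → ℂ) : ℝ := ∑ i, Complex.normSq (z i)

lemma qq_contDiff {m : WithTop ℕ∞} : ContDiff ℝ m (qq (n := n)) := by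
  unfold qq
  simp only [Complex.normSq_apply]
  apply ContDiff.sum
  intro i _
  have h1 : ContDiff ℝ m fun z : Fin n → ℂ => (z i).re :=
    Complex.reCLM.contDiff.comp (contDiff_apply ℝ ℂ i)
  have h2 : ContDiff ℝ m fun z : Fin n → ℂ => (z i).im :=
    Complex.imCLM.contDiff.comp (contDiff_apply ℝ ℂ i)
  exact (h1.mul h1).add (h2.mul h2)

lemma qq_continuous : Continuous (qq (n := n)) := (qq_contDiff (m := 0)).continuous

lemma qq_nonneg (z : Fin n → ℂ) : 0 ≤ qq z := Finset.sum_nonneg fun i _ => Complex.normSq_nonneg _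

lemma qq_smul (c : ℂ) (z : Fin n → ℂ) : qq (c • z) = ‖c‖ ^ 2 * qq z := by
  simp [qq, Finset.mul_sum, Complex.normSq_eq_norm_sq, mul_pow]

lemma sq_norm_le_qq (z : Fin n → ℂ) : ‖z‖ ^ 2 ≤ qq z := by
  have : ‖z‖ ≤ Real.sqrt (qq z) := by
    rw [pi_norm_le_iff_of_nonneg (Real.sqrt_nonneg _)]
    intro i
    apply Real.le_sqrt_of_sq_le
    rw [← Complex.normSq_eq_norm_sq]
    exact Finset.single_le_sum (f := fun i => Complex.normSq (z i))
      (fun i _ => Complex.normSq_nonneg _) (Finset.mem_univ i)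
  calc ‖z‖ ^ 2 ≤ Real.sqrt (qq z) ^ 2 := by gcongr
    _ = _ := Real.sq_sqrt (qq_nonneg z)

lemma qq_le (z : Fin n → ℂ) : qq z ≤ n * ‖z‖ ^ 2 := by
  unfold qq
  calc _ ≤ ∑ i : Fin n, ‖z‖ ^ 2 := by
        apply Finset.sum_le_sum
        intro i _
        rw [Complex.normSq_eq_norm_sq]
        gcongr
        exact norm_le_pi_norm z i
    _ = _ := by simp

/-- unnormalized kernel -/
noncomputable def ker0 (ε : ℝ) (z : Fin n → ℂ) : ℝ := Real.smoothTransition (1 - qq z / ε ^ 2)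

/-- normalized smooth rotation invariant kernel supported in the ball of radius `ε` -/
noncomputable def kap (ε : ℝ) (z : Fin n → ℂ) : ℝ := (∫ y : Fin n → ℂ, ker0 ε y)⁻¹ * ker0 ε z

lemma ker0_contDiff (ε : ℝ) {m : ℕ∞} : ContDiff ℝ m (ker0 (n := n) ε) :=
  Real.smoothTransition.contDiff.comp (contDiff_const.sub (qq_contDiff.div_const _))

lemma ker0_zero {ε : ℝ} (hε : 0 < ε) {z : Fin n → ℂ} (hz : ε ≤ ‖z‖) : ker0 ε z = 0 := by
  apply Real.smoothTransition.zero_of_nonpos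
  rw [sub_nonpos, one_le_div (by positivity)]
  calc ε ^ 2 ≤ ‖z‖ ^ 2 := by gcongr
    _ ≤ _ := sq_norm_le_qq z

lemma ker0_compact {ε : ℝ} (hε : 0 < ε) : HasCompactSupport (ker0 (n := n) ε) := by
  apply HasCompactSupport.intro (isCompact_closedBall 0 ε)
  intro z hz
  apply ker0_zero hε
  simp at hz; exact hz.le

lemma ker0_int_pos {ε : ℝ} (hε : 0 < ε) : 0 < ∫ y : Fin n → ℂ, ker0 ε y := by
  have hc : Continuous (ker0 (n := n) ε) := (ker0_contDiff ε (m := 0)).continuous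
  apply hc.integral_pos_of_hasCompactSupport_nonneg_nonzero (ker0_compact hε)
    (x := 0)
  · intro z; exact Real.smoothTransition.nonneg _
  · simp [ker0, qq]

lemma kap_contDiff (ε : ℝ) {m : ℕ∞} : ContDiff ℝ m (kap (n := n) ε) :=
  contDiff_const.mul (ker0_contDiff ε)

lemma kap_continuous (ε : ℝ) : Continuous (kap (n := n) ε) := (kap_contDiff ε (m := 0)).continuous

lemma kap_zero {ε : ℝ} (hε : 0 < ε) {z : Fin n → ℂ} (hz : ε ≤ ‖z‖) : kap ε z = 0 := by
  rw [kap, ker0_zero hε hz, mul_zero]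

lemma kap_compact {ε : ℝ} (hε : 0 < ε) : HasCompactSupport (kap (n := n) ε) := by
  apply HasCompactSupport.intro (isCompact_closedBall 0 ε)
  intro z hz
  apply kap_zero hε
  simp at hz; exact hz.le

lemma kap_nonneg {ε : ℝ} (hε : 0 < ε) (z : Fin n → ℂ) : 0 ≤ kap ε z :=
  mul_nonneg (inv_nonneg.mpr (ker0_int_pos hε).le) (Real.smoothTransition.nonneg _)

lemma kap_integral {ε : ℝ} (hε : 0 < ε) : ∫ z : Fin n → ℂ, kap ε z = 1 := by
  unfold kap
  rw [integral_const_mul, inv_mul_cancel₀ (ker0_int_pos hε).ne']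

lemma kap_integrable {ε : ℝ} (hε : 0 < ε) : Integrable (kap (n := n) ε) :=
  (kap_continuous ε).integrable_of_hasCompactSupport (kap_compact hε)

lemma kap_rot (ε : ℝ) {c : ℂ} (hc : ‖c‖ = 1) (z : Fin n → ℂ) : kap ε (c • z) = kap ε z := by
  simp [kap, ker0, qq_smul, hc]

lemma kap_neg (ε : ℝ) (z : Fin n → ℂ) : kap ε (-z) = kap ε z := by
  have := kap_rot ε (c := -1) (by simp) z
  simpa using this

section moll
variable {E : Type*} [NormedAddCommGroup E] [NormedSpace ℝ E]

/-- mollification -/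
noncomputable def moll (ε : ℝ) (f : (Fin n → ℂ) → E) (x : Fin n → ℂ) : E :=
  ∫ t, kap ε (x - t) • f t

lemma moll_eq (ε : ℝ) (f : (Fin n → ℂ) → E) (x : Fin n → ℂ) :
    moll ε f x = ∫ t, kap ε t • f (x - t) := by
  unfold moll
  rw [← integral_sub_left_eq_self _ volume x]
  simp

lemma moll_conv (ε : ℝ) (f : (Fin n → ℂ) → E) :
    moll ε f = convolution f (kap ε) (ContinuousLinearMap.lsmul ℝ ℝ : ℝ →L[ℝ] E →L[ℝ] E).flip volume := by
  ext x
  simp [moll, convolution]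

lemma moll_contDiff [CompleteSpace E] {ε : ℝ} (hε : 0 < ε) {f : (Fin n → ℂ) → E} (hf : LocallyIntegrable f volume)
    {m : ℕ∞} : ContDiff ℝ m (moll ε f) := by
  rw [moll_conv]
  exact (kap_compact hε).contDiff_convolution_right _ hf (kap_contDiff ε)

lemma fderiv_moll [CompleteSpace E] {ε : ℝ} (hε : 0 < ε) {f : (Fin n → ℂ) → E} (hf : LocallyIntegrable f volume)
    (x v : Fin n → ℂ) : fderiv ℝ (moll ε f) x v = ∫ t, fderiv ℝ (kap ε) (x - t) v • f t := by
  rw [moll_conv]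
  have h1 : ContDiff ℝ 1 (kap (n := n) ε) := kap_contDiff ε
  rw [((kap_compact hε).hasFDerivAt_convolution_right _ hf h1 x).fderiv]
  rw [convolution_precompR_apply _ hf ((kap_compact hε).fderiv ℝ) (h1.continuous_fderiv (by norm_num))]
  simp [convolution]

lemma kap_smul_integrable {ε : ℝ} (hε : 0 < ε) {f : (Fin n → ℂ) → E}
    (hf : LocallyIntegrable f volume) (x : Fin n → ℂ) : Integrable fun t => kap ε (x - t) • f t := by
  apply hf.integrable_smul_left_of_hasCompactSupport
  · exact (kap_continuous ε).comp (by fun_prop)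
  · have := (kap_compact (n := n) hε).comp_homeomorph ((Homeomorph.subLeft x))
    exact this

lemma kap_smul_integrable' {ε : ℝ} (hε : 0 < ε) {f : (Fin n → ℂ) → E}
    (hf : LocallyIntegrable f volume) (x : Fin n → ℂ) : Integrable fun t => kap ε t • f (x - t) := by
  have := (kap_smul_integrable hε hf x).comp_sub_left x
  simpa using this

lemma moll_congr {ε : ℝ} (hε : 0 < ε) {f g : (Fin n → ℂ) → E} (x : Fin n → ℂ)
    (h : ∀ᵐ t, t ∈ Metric.ball x ε → f t = g t) : moll ε f x = moll ε g x := by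
  unfold moll
  apply integral_congr_ae
  filter_upwards [h] with t ht
  by_cases hm : t ∈ Metric.ball x ε
  · rw [ht hm]
  · rw [kap_zero hε, zero_smul, zero_smul]
    rw [mem_ball_iff_norm, norm_sub_rev] at hm
    exact not_lt.mp hm

lemma moll_compact {ε : ℝ} (hε : 0 < ε) {f : (Fin n → ℂ) → E} (hf : HasCompactSupport f) :
    HasCompactSupport (moll ε f) := by
  rw [moll_conv]
  exact HasCompactSupport.convolution _ hf (kap_compact hε)
end moll
end SOC

namespace SOC
variable {n : ℕ}

lemma translate_tendsto {f : (Fin n → ℂ) → ℂ} (hf : MemLp f 2 volume) :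
    Tendsto (fun t : Fin n → ℂ => eLpNorm (fun x => f (x - t) - f x) 2 volume) (nhds 0) (nhds 0) := by
  let g : (Fin n → ℂ) → C(Fin n → ℂ, Fin n → ℂ) := fun t => ⟨fun x => x - t, by fun_prop⟩
  have hgm : ∀ t, MeasurePreserving (g t) (volume : Measure (Fin n → ℂ)) volume :=
    fun t => measurePreserving_sub_right volume t
  have hg : Continuous g := by
    apply ContinuousMap.continuous_of_continuous_uncurry
    change Continuous fun p : (Fin n → ℂ) × (Fin n → ℂ) => p.2 - p.1
    fun_prop
  have hc : Continuous fun t => Lp.compMeasurePreserving (g t) (hgm t) (hf.toLp f) :=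
    Continuous.compMeasurePreservingLp continuous_const hg hgm (by simp)
  have h1 := (hc.sub (continuous_const (y := hf.toLp f))).enorm.tendsto 0
  have h2 : ∀ t, ‖Lp.compMeasurePreserving (g t) (hgm t) (hf.toLp f) - hf.toLp f‖ₑ =
      eLpNorm (fun x => f (x - t) - f x) 2 volume := by
    intro t
    have : Lp.compMeasurePreserving (g t) (hgm t) (hf.toLp f) - hf.toLp f =
        ((hf.comp_measurePreserving (hgm t)).sub hf).toLp _ := by
      rw [MemLp.toLp_sub (hf.comp_measurePreserving (hgm t)) hf]
      rfl
    rw [this, Lp.enorm_def]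
    rw [eLpNorm_congr_ae (MemLp.coeFn_toLp _)]
    rfl
  have h3 : Tendsto (fun t => ‖Lp.compMeasurePreserving (g t) (hgm t) (hf.toLp f) - hf.toLp f‖ₑ) (nhds 0)
      (nhds ‖Lp.compMeasurePreserving (g 0) (hgm 0) (hf.toLp f) - hf.toLp f‖ₑ) := h1
  simp_rw [h2] at h3
  simpa using h3

/-- squared L2 seminorm as a lower integral -/
lemma eLpNorm_two_sq {X : Type*} [MeasurableSpace X] {μ : Measure X} {E : Type*}
    [NormedAddCommGroup E] (f : X → E) :
    eLpNorm f 2 μ ^ 2 = ∫⁻ x, ‖f x‖ₑ ^ 2 ∂μ := by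
  rw [eLpNorm_eq_lintegral_rpow_enorm_toReal (by simp) (by simp)]
  simp only [ENNReal.toReal_ofNat, one_div]
  rw [← ENNReal.rpow_natCast, ← ENNReal.rpow_mul]
  simp

lemma jensen_kap {ε : ℝ} (hε : 0 < ε) (g : (Fin n → ℂ) → ℂ)
    (hg : AEStronglyMeasurable g volume) :
    ‖∫ t, kap ε t • g t‖ₑ ^ 2 ≤ ∫⁻ t, ENNReal.ofReal (kap ε t) * ‖g t‖ₑ ^ 2 := by
  let μ : Measure (Fin n → ℂ) := volume.withDensity fun t => ENNReal.ofReal (kap ε t)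
  have hmeas : Measurable fun t : Fin n → ℂ => ENNReal.ofReal (kap ε t) :=
    ENNReal.measurable_ofReal.comp (kap_continuous ε).measurable
  have hprob : IsProbabilityMeasure μ := by
    constructor
    rw [withDensity_apply _ MeasurableSet.univ, Measure.restrict_univ,
      ← ofReal_integral_eq_lintegral_ofReal (kap_integrable hε)
        (Filter.Eventually.of_forall (kap_nonneg hε)), kap_integral hε]
    simp
  have hgμ : AEStronglyMeasurable g μ := hg.mono_ac (withDensity_absolutelyContinuous _ _)
  have h1 : ‖∫ t, kap ε t • g t‖ₑ ≤ ∫⁻ t, ‖g t‖ₑ ∂μ := by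
    refine (enorm_integral_le_lintegral_enorm _).trans (le_of_eq ?_)
    rw [lintegral_withDensity_eq_lintegral_mul₀ hmeas.aemeasurable hg.enorm]
    apply lintegral_congr
    intro t
    rw [enorm_smul, Real.enorm_eq_ofReal (kap_nonneg hε t)]
    rfl
  have h2 : ∫⁻ t, ‖g t‖ₑ ∂μ ≤ eLpNorm g 2 μ := by
    rw [← eLpNorm_one_eq_lintegral_enorm]
    exact eLpNorm_le_eLpNorm_of_exponent_le (by norm_num) hgμ
  calc _ ≤ (eLpNorm g 2 μ) ^ 2 := by gcongr; exact h1.trans h2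
    _ = ∫⁻ t, ‖g t‖ₑ ^ 2 ∂μ := eLpNorm_two_sq _
    _ = _ := by
      rw [lintegral_withDensity_eq_lintegral_mul₀ hmeas.aemeasurable (hg.enorm.pow_const 2)]
      rfl

lemma moll_sub_sq_le {ε : ℝ} (hε : 0 < ε) {f : (Fin n → ℂ) → ℂ} (hf : MemLp f 2 volume) :
    eLpNorm (fun x => moll ε f x - f x) 2 volume ^ 2 ≤
      ∫⁻ t, ENNReal.ofReal (kap ε t) * eLpNorm (fun x => f (x - t) - f x) 2 volume ^ 2 := by
  have hloc : LocallyIntegrable f volume := hf.locallyIntegrable (by norm_num)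
  have hfm := hf.aestronglyMeasurable
  have hjoint : AEStronglyMeasurable (fun p : (Fin n → ℂ) × (Fin n → ℂ) => f (p.1 - p.2) - f p.1)
      (volume.prod volume) := by
    apply AEStronglyMeasurable.sub
    · exact hfm.comp_quasiMeasurePreserving (quasiMeasurePreserving_sub_of_right_invariant _ _)
    · exact hfm.comp_fst
  have hk : Measurable fun p : (Fin n → ℂ) × (Fin n → ℂ) => ENNReal.ofReal (kap ε p.2) :=
    ENNReal.measurable_ofReal.comp ((kap_continuous ε).comp continuous_snd).measurable
  rw [eLpNorm_two_sq]
  calc ∫⁻ x, ‖moll ε f x - f x‖ₑ ^ 2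
      ≤ ∫⁻ x, ∫⁻ t, ENNReal.ofReal (kap ε t) * ‖f (x - t) - f x‖ₑ ^ 2 := by
        apply lintegral_mono
        intro x
        have h1 : moll ε f x - f x = ∫ t, kap ε t • (f (x - t) - f x) := by
          simp_rw [smul_sub]
          rw [integral_sub (kap_smul_integrable' hε hloc x) ((kap_integrable hε).smul_const _),
            integral_smul_const, kap_integral hε, moll_eq, one_smul]
        simp only
        rw [h1]
        apply jensen_kap hε
        apply AEStronglyMeasurable.sub _ aestronglyMeasurable_const
        exact hfm.comp_quasiMeasurePreserving (quasiMeasurePreserving_sub_left _ x)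
    _ = ∫⁻ t, ∫⁻ x, ENNReal.ofReal (kap ε t) * ‖f (x - t) - f x‖ₑ ^ 2 := by
        apply lintegral_lintegral_swap
        exact hk.aemeasurable.mul (hjoint.enorm.pow_const 2)
    _ = _ := by
        apply lintegral_congr
        intro t
        rw [lintegral_const_mul' _ _ ENNReal.ofReal_ne_top, eLpNorm_two_sq]

lemma moll_tendsto {f : (Fin n → ℂ) → ℂ} (hf : MemLp f 2 volume) {e : ℕ → ℝ} (he : ∀ j, 0 < e j)
    (he0 : Tendsto e atTop (nhds 0)) :
    Tendsto (fun j => eLpNorm (fun x => moll (e j) f x - f x) 2 volume) atTop (nhds 0) := by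
  rw [ENNReal.tendsto_nhds_zero]
  intro δ hδ
  have h1 := (ENNReal.tendsto_nhds_zero.mp (translate_tendsto hf)) δ hδ
  rw [Metric.eventually_nhds_iff] at h1
  obtain ⟨r, hr, h1⟩ := h1
  filter_upwards [he0.eventually (gt_mem_nhds hr)] with j hj
  have h2 := moll_sub_sq_le (he j) hf
  have h3 : ∫⁻ t : Fin n → ℂ, ENNReal.ofReal (kap (e j) t) *
      eLpNorm (fun x => f (x - t) - f x) 2 volume ^ 2 ≤
      ∫⁻ t : Fin n → ℂ, ENNReal.ofReal (kap (e j) t) * δ ^ 2 := by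
    apply lintegral_mono
    intro t
    by_cases ht : e j ≤ ‖t‖
    · simp [kap_zero (he j) ht]
    · simp only
      gcongr
      apply h1
      rw [dist_zero_right]; linarith
  have h4 : ∫⁻ t : Fin n → ℂ, ENNReal.ofReal (kap (e j) t) * δ ^ 2 = δ ^ 2 := by
    have hm : Measurable fun t : Fin n → ℂ => ENNReal.ofReal (kap (e j) t) :=
      ENNReal.measurable_ofReal.comp (kap_continuous _).measurable
    rw [lintegral_mul_const _ hm,
      ← ofReal_integral_eq_lintegral_ofReal (kap_integrable (he j))
        (Filter.Eventually.of_forall (kap_nonneg (he j))), kap_integral (he j)]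
    simp
  have h5 := h2.trans (h3.trans h4.le)
  exact (ENNReal.pow_le_pow_left_iff (by norm_num)).mp h5
end SOC

namespace SOC
variable {n : ℕ}

lemma rot_mp {c : ℂ} (hc : ‖c‖ = 1) :
    MeasurePreserving (fun z : Fin n → ℂ => c • z) volume volume := by
  have h1 : MeasurePreserving (fun z : ℂ => c * z) volume volume := by
    let a : Circle := ⟨c, by simp [Submonoid.unitSphere, hc]⟩
    exact (rotation a).measurePreserving
  exact volume_preserving_pi (fun _ : Fin n => h1)

section avg
variable {E : Type*} [NormedAddCommGroup E] [NormedSpace ℝ E]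

lemma moll_rot {c : ℂ} (hc : ‖c‖ = 1) (δ : ℝ) (f : (Fin n → ℂ) → E) (z : Fin n → ℂ) :
    moll δ f z = ∫ t, kap δ t • f (z + c • t) := by
  rw [moll_eq]
  have hc0 : c ≠ 0 := by rintro rfl; simp at hc
  have he : MeasurableEmbedding (fun z : Fin n → ℂ => (-c) • z) :=
    (Homeomorph.smulOfNeZero (-c) (neg_ne_zero.mpr hc0)).measurableEmbedding
  rw [← (rot_mp (n := n) (c := -c) (by simpa using hc)).integral_comp he]
  apply integral_congr_ae
  refine Filter.Eventually.of_forall fun t => ?_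
  simp only
  rw [kap_rot _ (by simpa using hc)]
  simp

lemma moll_avg [CompleteSpace E] {δ C : ℝ} (hδ : 0 < δ) {f : (Fin n → ℂ) → E} (hf : StronglyMeasurable f)
    (z : Fin n → ℂ) (hb : ∀ t ∈ Metric.ball z δ, ‖f t‖ ≤ C) :
    moll δ f z = ∫ t, kap δ t •
      ((2 * Real.pi)⁻¹ • ∫ θ in (0 : ℝ)..(2 * Real.pi), f (z + Complex.exp (θ * I) • t)) := by
  have h1 : moll δ f z = (2 * Real.pi)⁻¹ • ∫ θ in (0 : ℝ)..(2 * Real.pi),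
      ∫ t, kap δ t • f (z + Complex.exp (θ * I) • t) := by
    have : ∀ θ : ℝ, ∫ t, kap δ t • f (z + Complex.exp (θ * I) • t) = moll δ f z := by
      intro θ
      rw [moll_rot (Complex.norm_exp_ofReal_mul_I θ)]
    simp_rw [this]
    rw [intervalIntegral.integral_const, sub_zero, smul_smul, inv_mul_cancel₀ (by positivity), one_smul]
  rw [h1, intervalIntegral.integral_of_le (by positivity), integral_integral_swap]
  · rw [← integral_smul]
    congr 1
    ext t
    rw [intervalIntegral.integral_of_le (by positivity), integral_smul, smul_comm]
  · have hm : Continuous fun p : ℝ × (Fin n → ℂ) => z + Complex.exp (p.1 * I) • p.2 := by fun_prop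
    have hk : Continuous fun p : ℝ × (Fin n → ℂ) => kap δ p.2 := (kap_continuous δ).comp continuous_snd
    have hI : Integrable (fun p : ℝ × (Fin n → ℂ) => C * kap δ p.2)
        ((volume.restrict (Ioc 0 (2 * Real.pi))).prod volume) := by
      have := (integrable_const (μ := volume.restrict (Ioc 0 (2 * Real.pi))) C).mul_prod
        (kap_integrable (n := n) hδ)
      exact this
    refine hI.mono' (hk.aestronglyMeasurable.smul (hf.comp_measurable hm.measurable).aestronglyMeasurable) ?_
    refine Filter.Eventually.of_forall fun p => ?_
    simp only [Function.uncurry]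
    by_cases h : δ ≤ ‖p.2‖
    · simp [kap_zero hδ h]
    · rw [norm_smul, Real.norm_of_nonneg (kap_nonneg hδ _), mul_comm]
      gcongr
      · exact kap_nonneg hδ _
      · apply hb
        rw [Metric.mem_ball, dist_eq_norm, add_sub_cancel_left, norm_smul, Complex.norm_exp_ofReal_mul_I, one_mul]
        exact not_le.mp h
end avg

lemma moll_mean {δ r : ℝ} (hδ : 0 < δ) (hr : δ < r) {f : (Fin n → ℂ) → ℂ} (hf : Continuous f)
    {z : Fin n → ℂ} (hd : DifferentiableOn ℂ f (Metric.ball z r)) : moll δ f z = f z := by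
  obtain ⟨C, hC⟩ := (isCompact_closedBall z δ).exists_bound_of_continuousOn hf.continuousOn
  rw [moll_avg hδ hf.stronglyMeasurable z (fun t ht => hC t (Metric.ball_subset_closedBall ht))]
  have : ∀ t, kap δ t • ((2 * Real.pi)⁻¹ • ∫ θ in (0 : ℝ)..(2 * Real.pi), f (z + Complex.exp (θ * I) • t))
      = kap δ t • f z := by
    intro t
    by_cases h : δ ≤ ‖t‖
    · simp [kap_zero hδ h]
    congr 1
    have h2 : ∀ s : ℂ, s ∈ Metric.closedBall (0:ℂ) |1| → DifferentiableAt ℂ (fun s : ℂ => f (z + s • t)) s := by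
      intro s hs
      have hmem : z + s • t ∈ Metric.ball z r := by
        rw [Metric.mem_ball, dist_eq_norm, add_sub_cancel_left, norm_smul]
        have : ‖s‖ ≤ 1 := by simpa using hs
        nlinarith [norm_nonneg t, norm_nonneg s]
      have h3 := hd.differentiableAt (Metric.isOpen_ball.mem_nhds hmem)
      exact DifferentiableAt.comp (g := f) s h3 (by fun_prop)
    have h3 := circleAverage_of_differentiable_on_off_countable (c := 0) (R := 1)
      (f := fun s : ℂ => f (z + s • t)) Set.countable_empty
      (fun s hs => (h2 s hs).continuousAt.continuousWithinAt)
      (fun s hs => h2 s (Metric.ball_subset_closedBall hs.1))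
    simpa [Real.circleAverage, circleMap] using h3
  simp_rw [this]
  rw [integral_smul_const, kap_integral hδ, one_smul]
end SOC

namespace SOC
variable {n : ℕ}

noncomputable def dbar (j : Fin n) (f : (Fin n → ℂ) → ℂ) (z : Fin n → ℂ) : ℂ :=
  (1 / 2) * (fderiv ℝ f z (Pi.single j 1) + I * fderiv ℝ f z (Pi.single j I))

noncomputable def dd (j : Fin n) (f : (Fin n → ℂ) → ℂ) (z : Fin n → ℂ) : ℂ :=
  (1 / 2) * (fderiv ℝ f z (Pi.single j 1) - I * fderiv ℝ f z (Pi.single j I))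

lemma holo_of_dbar {f : (Fin n → ℂ) → ℂ} {z : Fin n → ℂ} (hf : DifferentiableAt ℝ f z)
    (h : ∀ j, dbar j f z = 0) : DifferentiableAt ℂ f z := by
  rw [differentiableAt_iff_restrictScalars ℝ hf]
  have hI : ∀ j, fderiv ℝ f z (Pi.single j I) = I * fderiv ℝ f z (Pi.single j 1) := by
    intro j
    have := h j
    unfold dbar at this
    have h2 : fderiv ℝ f z (Pi.single j 1) + I * fderiv ℝ f z (Pi.single j I) = 0 := by simpa using this
    linear_combination (-I) * h2 + fderiv ℝ f z (Pi.single j I) * Complex.I_mul_I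
  have hsingle : ∀ j (c : ℂ), fderiv ℝ f z (Pi.single j c) = c * fderiv ℝ f z (Pi.single j 1) := by
    intro j c
    have : (Pi.single j c : Fin n → ℂ) = c.re • (Pi.single j 1 : Fin n → ℂ) + c.im • (Pi.single j I : Fin n → ℂ) := by
      rw [← Pi.single_smul, ← Pi.single_smul, ← Pi.single_add]
      congr 1
      simp [Complex.re_add_im]
    rw [this, map_add, map_smul, map_smul, hI]
    simp only [Complex.real_smul]
    conv_rhs => rw [← Complex.re_add_im c]
    ring
  have hall : ∀ v, fderiv ℝ f z v = ∑ j, v j * fderiv ℝ f z (Pi.single j 1) := by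
    intro v
    conv_lhs => rw [← Finset.univ_sum_single v, map_sum]
    exact Finset.sum_congr rfl fun j _ => hsingle j (v j)
  refine ⟨∑ j, (fderiv ℝ f z (Pi.single j 1)) • (ContinuousLinearMap.proj (R := ℂ) (φ := fun _ : Fin n => ℂ) j), ?_⟩
  ext v
  rw [hall]
  simp [mul_comm]

lemma dbar_of_holo {f : (Fin n → ℂ) → ℂ} {z : Fin n → ℂ} (hf : DifferentiableAt ℂ f z) (j : Fin n) :
    dbar j f z = 0 := by
  unfold dbar
  rw [hf.fderiv_restrictScalars ℝ]
  have : (Pi.single j I : Fin n → ℂ) = I • Pi.single j 1 := by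
    rw [← Pi.single_smul]; simp
  rw [this]
  simp only [ContinuousLinearMap.coe_restrictScalars', map_smul, smul_eq_mul]
  rw [← mul_assoc, Complex.I_mul_I]; ring

/-- the test-function of Weyl's lemma -/
lemma dbar_moll {ε : ℝ} (hε : 0 < ε) {f : (Fin n → ℂ) → ℂ} (hf : LocallyIntegrable f volume)
    (x : Fin n → ℂ) (j : Fin n) :
    dbar j (moll ε f) x = - ∫ t, f t * dbar j (fun s => (kap ε (x - s) : ℂ)) t := by
  have hk : Differentiable ℝ (kap (n := n) ε) := (kap_contDiff ε (m := 1)).differentiable (by norm_num)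
  have h1 : ∀ t v, fderiv ℝ (fun s => (kap ε (x - s) : ℂ)) t v = -(fderiv ℝ (kap ε) (x - t) v : ℂ) := by
    intro t v
    have h2 : HasFDerivAt (fun s => (kap ε (x - s) : ℂ))
        (Complex.ofRealCLM.comp ((fderiv ℝ (kap ε) (x - t)).comp (-ContinuousLinearMap.id ℝ (Fin n → ℂ)))) t := by
      apply Complex.ofRealCLM.hasFDerivAt.comp
      apply HasFDerivAt.comp (g := kap ε) t (hk (x - t)).hasFDerivAt
      exact (hasFDerivAt_id t).const_sub x
    rw [h2.fderiv]
    simp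
  have hint : ∀ v, Integrable fun t => f t * (fderiv ℝ (kap ε) (x - t) v : ℂ) := by
    intro v
    have h3 : Integrable fun t => fderiv ℝ (kap ε) (x - t) v • f t := by
      apply hf.integrable_smul_left_of_hasCompactSupport
      · have : Continuous (fderiv ℝ (kap (n := n) ε)) := (kap_contDiff ε (m := 1)).continuous_fderiv (by norm_num)
        fun_prop
      · exact (((kap_compact (n := n) hε).fderiv_apply ℝ v).comp_homeomorph (Homeomorph.subLeft x))
    simpa [Complex.real_smul, mul_comm] using h3
  unfold dbar
  simp_rw [fderiv_moll hε hf, h1]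
  have h4 : ∀ v, ∫ t, fderiv ℝ (kap ε) (x - t) v • f t = ∫ t, f t * (fderiv ℝ (kap ε) (x - t) v : ℂ) := by
    intro v
    congr 1; ext t; rw [Complex.real_smul, mul_comm]
  rw [h4, h4, ← integral_const_mul, ← integral_add (hint _) ((hint _).const_mul I), ← integral_const_mul,
    ← integral_neg]
  congr 1; ext t; ring

lemma moll_jensen_bound {δ : ℝ} (hδ : 0 < δ) : ∃ C : ℝ, 0 < C ∧ ∀ (f : (Fin n → ℂ) → ℂ),
    AEStronglyMeasurable f volume → ∀ x,
    ‖moll δ f x‖ₑ ^ 2 ≤ ENNReal.ofReal C * ∫⁻ t in Metric.ball x δ, ‖f t‖ₑ ^ 2 := by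
  obtain ⟨C, hC⟩ := (kap_compact (n := n) hδ).exists_bound_of_continuous (kap_continuous δ)
  refine ⟨max C 1, by positivity, fun f hf x => ?_⟩
  rw [moll_eq]
  have hf' : AEStronglyMeasurable (fun t => f (x - t)) volume :=
    hf.comp_quasiMeasurePreserving (quasiMeasurePreserving_sub_left _ x)
  refine (jensen_kap hδ _ hf').trans ?_
  have hmp : MeasurePreserving (fun t => x - t) (volume : Measure (Fin n → ℂ)) volume :=
    Measure.measurePreserving_sub_left volume x
  rw [← lintegral_indicator measurableSet_ball, 
    ← lintegral_const_mul' _ _ ENNReal.ofReal_ne_top,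
    ← hmp.lintegral_comp_emb (Homeomorph.subLeft x).measurableEmbedding]
  apply lintegral_mono
  intro t
  simp only [Set.indicator, Metric.mem_ball, dist_eq_norm]
  by_cases h : δ ≤ ‖x - t‖
  · simp [kap_zero hδ h]
  · have : ‖t - x‖ < δ := by rw [norm_sub_rev]; simpa using h
    rw [if_pos this, _root_.sub_sub_cancel]
    gcongr
    exact (le_abs_self _).trans ((hC _).trans (le_max_left _ _))

end SOC

namespace SOC
variable {n : ℕ}

lemma locInt_of_ball {f : (Fin n → ℂ) → ℂ}
    (hf : ∀ R : ℝ, MemLp ((Metric.ball 0 R).indicator f) 2 volume) : LocallyIntegrable f volume := by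
  rw [locallyIntegrable_iff]
  intro K hK
  obtain ⟨R, hR⟩ := hK.isBounded.subset_ball (0 : Fin n → ℂ)
  have h1 := ((hf R).locallyIntegrable (by norm_num)).integrableOn_isCompact hK
  refine h1.congr_fun_ae ?_
  filter_upwards [ae_restrict_mem hK.measurableSet] with x hx
  simp [Set.indicator, hR hx]

lemma weyl {f : (Fin n → ℂ) → ℂ}
    (hf : ∀ R : ℝ, MemLp ((Metric.ball 0 R).indicator f) 2 volume)
    (hw : ∀ (j : Fin n) (η : (Fin n → ℂ) → ℂ), ContDiff ℝ 2 η → HasCompactSupport η →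
      ∫ t, f t * dbar j η t = 0) :
    ∃ g : (Fin n → ℂ) → ℂ, Differentiable ℂ g ∧ f =ᵐ[volume] g := by
  have hloc := locInt_of_ball hf
  have hent : ∀ ε > 0, Differentiable ℂ (moll ε f) := by
    intro ε hε x
    apply holo_of_dbar
    · exact (moll_contDiff hε hloc (m := 1)).differentiable (by norm_num) x
    · intro j
      rw [dbar_moll hε hloc, hw, neg_zero]
      · apply Complex.ofRealCLM.contDiff.comp
        exact (kap_contDiff ε (m := 2)).comp (contDiff_const.sub contDiff_id)
      · have := (kap_compact (n := n) hε).comp_homeomorph ((Homeomorph.subLeft x))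
        exact this.comp_left (g := fun x : ℝ => (x : ℂ)) (by simp)
  refine ⟨moll 1 f, hent 1 one_pos, ?_⟩
  -- local statement
  suffices H : ∀ R : ℕ, ∀ᵐ x, x ∈ Metric.ball (0 : Fin n → ℂ) R → f x = moll 1 f x by
    rw [← ae_all_iff] at H
    filter_upwards [H] with x hx
    obtain ⟨R, hR⟩ := exists_nat_gt ‖x‖
    exact hx R (by simpa using hR)
  intro R
  set h := (Metric.ball (0 : Fin n → ℂ) (R + 2)).indicator f with hh
  have hL := hf (R + 2)
  rw [← hh] at hL
  have hlh : LocallyIntegrable h volume := hL.locallyIntegrable (by norm_num)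
  let e : ℕ → ℝ := fun j => 1 / ((j : ℝ) + 1)
  have he : ∀ j, 0 < e j := fun j => by positivity
  have he1 : ∀ j, e j ≤ 1 := fun j => by
    simp only [e]; rw [div_le_one (by positivity)]; linarith [(Nat.cast_nonneg j : (0:ℝ) ≤ j)]
  have he0 : Tendsto e atTop (nhds 0) := tendsto_one_div_add_atTop_nhds_zero_nat
  have hcong : ∀ ε, 0 < ε → ε ≤ 1 → ∀ x ∈ Metric.ball (0 : Fin n → ℂ) (R + 1), moll ε h x = moll ε f x := by
    intro ε hε hε1 x hx
    apply moll_congr hε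
    refine Filter.Eventually.of_forall fun t ht => ?_
    rw [hh, Set.indicator_of_mem]
    rw [Metric.mem_ball] at ht hx ⊢
    linarith [dist_triangle t x 0]
  have hT := moll_tendsto hL he he0
  have hcont : ∀ j, Continuous (moll (e j) h) := fun j => (moll_contDiff (he j) hlh (m := 0)).continuous
  -- pointwise convergence
  obtain ⟨C, hC, hCb⟩ := moll_jensen_bound (n := n) (δ := 1) one_pos
  have hpt : ∀ x ∈ Metric.ball (0 : Fin n → ℂ) R, Tendsto (fun j => moll (e j) h x) atTop (nhds (moll 1 h x)) := by
    intro x hx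
    have hx1 : x ∈ Metric.ball (0 : Fin n → ℂ) (R + 1) := Metric.ball_subset_ball (by linarith) hx
    rw [tendsto_iff_edist_tendsto_0]
    have hb : ∀ j, edist (moll (e j) h x) (moll 1 h x) ^ 2 ≤
        ENNReal.ofReal C * eLpNorm (fun x => moll (e j) h x - h x) 2 volume ^ 2 := by
      intro j
      have e1 : moll (e j) h x = moll 1 (moll (e j) h) x := by
        rw [hcong _ (he j) (he1 j) x hx1]
        rw [← moll_mean (δ := 1) (r := 2) one_pos (by norm_num) (hent _ (he j)).continuous (hent _ (he j)).differentiableOn]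
        apply moll_congr one_pos
        refine Filter.Eventually.of_forall fun t ht => ?_
        rw [hcong _ (he j) (he1 j)]
        rw [Metric.mem_ball] at ht hx ⊢
        linarith [dist_triangle t x 0]
      have e2 : moll (e j) h x - moll 1 h x = moll 1 (fun x => moll (e j) h x - h x) x := by
        conv_lhs => rw [e1]
        unfold moll
        rw [← integral_sub]
        · congr 1; ext t; rw [smul_sub]
        · exact kap_smul_integrable one_pos (hcont j).locallyIntegrable x
        · exact kap_smul_integrable one_pos hlh x
      rw [edist_eq_enorm_sub, e2]
      refine (hCb _ ((hcont j).aestronglyMeasurable.sub hL.aestronglyMeasurable) x).trans ?_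
      rw [eLpNorm_two_sq]
      gcongr
      · exact Measure.restrict_le_self
      · exact le_rfl
    have hlim : Tendsto (fun j => ENNReal.ofReal C * eLpNorm (fun x => moll (e j) h x - h x) 2 volume ^ 2)
        atTop (nhds 0) := by
      have := ENNReal.Tendsto.const_mul (a := ENNReal.ofReal C) ((ENNReal.continuous_pow 2).tendsto 0 |>.comp hT)
        (Or.inr ENNReal.ofReal_ne_top)
      simpa using this
    have h2 : Tendsto (fun j => edist (moll (e j) h x) (moll 1 h x) ^ 2) atTop (nhds 0) :=
      tendsto_of_tendsto_of_tendsto_of_le_of_le tendsto_const_nhds hlim (fun _ => zero_le) hb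
    have h3 := (ENNReal.continuous_rpow_const (y := 1/2)).tendsto 0 |>.comp h2
    have h4 : ∀ a : ℝ≥0∞, (a ^ 2) ^ (2⁻¹ : ℝ) = a := by
      intro a
      rw [← ENNReal.rpow_natCast, ← ENNReal.rpow_mul]; norm_num
    simpa [Function.comp_def, h4] using h3
  have hmeas := tendstoInMeasure_of_tendsto_eLpNorm (p := 2) (by norm_num) (f := fun j => moll (e j) h) (g := h)
    (fun j => (hcont j).aestronglyMeasurable) hL.aestronglyMeasurable hT
  obtain ⟨ns, hns, hae⟩ := hmeas.exists_seq_tendsto_ae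
  filter_upwards [hae] with x hx hxR
  have h1 := tendsto_nhds_unique hx ((hpt x hxR).comp hns.tendsto_atTop)
  rw [hcong 1 one_pos le_rfl x (Metric.ball_subset_ball (by linarith) hxR)] at h1
  rw [← h1, hh, Set.indicator_of_mem]
  exact Metric.ball_subset_ball (by linarith) hxR

lemma holo_sup {δ : ℝ} (hδ : 0 < δ) : ∃ C : ℝ, 0 < C ∧ ∀ (f : (Fin n → ℂ) → ℂ), Differentiable ℂ f → ∀ x,
    ‖f x‖ₑ ^ 2 ≤ ENNReal.ofReal C * ∫⁻ t in Metric.ball x δ, ‖f t‖ₑ ^ 2 := by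
  obtain ⟨C, hC, h⟩ := moll_jensen_bound (n := n) hδ
  refine ⟨C, hC, fun f hf x => ?_⟩
  have := h f hf.continuous.aestronglyMeasurable x
  rwa [moll_mean hδ (lt_add_one δ) hf.continuous hf.differentiableOn] at this

lemma smooth_ext {F : (Fin n → ℂ) → ℂ} (hF : DifferentiableOn ℂ F (Metric.ball 0 1)) :
    ∃ F₀ : (Fin n → ℂ) → ℂ, ContDiff ℝ 2 F₀ ∧ ∀ z ∈ Metric.ball (0 : Fin n → ℂ) (3/4), F₀ z = F z := by
  let c : (Fin n → ℂ) → ℝ := fun z => max 0 (min 1 (19 - 20 * ‖z‖))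
  have hc : Continuous c := by fun_prop
  let f : (Fin n → ℂ) → ℂ := fun z => (c z : ℂ) * F z
  have hf : Continuous f := by
    rw [continuous_iff_continuousAt]
    intro z
    by_cases hz : ‖z‖ < 1
    · have := hF.continuousOn.continuousAt (Metric.isOpen_ball.mem_nhds (x := z) (by simpa using hz))
      exact (Complex.continuous_ofReal.comp hc).continuousAt.mul this
    · have : f =ᶠ[nhds z] fun _ => 0 := by
        have : ∀ᶠ y in nhds z, (19/20 : ℝ) < ‖y‖ :=
          continuous_norm.continuousAt.eventually (lt_mem_nhds (by linarith))
        filter_upwards [this] with y hy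
        have : c y = 0 := by
          simp only [c]
          rw [max_eq_left]
          exact (min_le_right _ _).trans (by linarith)
        simp [f, this]
      exact (continuousAt_const).congr this.symm
  refine ⟨moll (1/16) f, moll_contDiff (by norm_num) hf.locallyIntegrable, fun z hz => ?_⟩
  have hfF : ∀ y ∈ Metric.ball z (1/8), f y = F y := by
    intro y hy
    have : c y = 1 := by
      rw [Metric.mem_ball] at hy hz
      have h1 := dist_triangle y z 0
      rw [dist_zero_right] at h1
      simp only [c]
      rw [min_eq_left (by linarith), max_eq_right zero_le_one]
    simp [f, this]
  rw [moll_mean (r := 1/8) (by norm_num) (by norm_num) hf, hfF z (by simp)]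
  refine (hF.mono ?_).congr hfF
  intro y hy
  rw [Metric.mem_ball] at hy hz ⊢
  linarith [dist_triangle y z 0]
end SOC

namespace SOC
variable {n : ℕ}

local notation "cj" => starRingEnd ℂ

lemma contDiff_fderiv_apply {m : WithTop ℕ∞} {f : (Fin n → ℂ) → ℂ} (hf : ContDiff ℝ (m + 1) f) (v : Fin n → ℂ) :
    ContDiff ℝ m fun z => fderiv ℝ f z v :=
  (hf.fderiv_right le_rfl).clm_apply contDiff_const

lemma dd_contDiff {m : WithTop ℕ∞} {f : (Fin n → ℂ) → ℂ} (hf : ContDiff ℝ (m + 1) f) (j : Fin n) :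
    ContDiff ℝ m (dd j f) :=
  contDiff_const.mul ((contDiff_fderiv_apply hf _).sub (contDiff_const.mul (contDiff_fderiv_apply hf _)))

lemma dbar_contDiff {m : WithTop ℕ∞} {f : (Fin n → ℂ) → ℂ} (hf : ContDiff ℝ (m + 1) f) (j : Fin n) :
    ContDiff ℝ m (dbar j f) :=
  contDiff_const.mul ((contDiff_fderiv_apply hf _).add (contDiff_const.mul (contDiff_fderiv_apply hf _)))

lemma dd_continuous {f : (Fin n → ℂ) → ℂ} (hf : ContDiff ℝ 1 f) (j : Fin n) : Continuous (dd j f) :=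
  (dd_contDiff (m := 0) (by simpa using hf) j).continuous

lemma dbar_continuous {f : (Fin n → ℂ) → ℂ} (hf : ContDiff ℝ 1 f) (j : Fin n) : Continuous (dbar j f) :=
  (dbar_contDiff (m := 0) (by simpa using hf) j).continuous

lemma dd_c1 {f : (Fin n → ℂ) → ℂ} (hf : ContDiff ℝ 2 f) (j : Fin n) : ContDiff ℝ 1 (dd j f) :=
  dd_contDiff (m := 1) (by norm_num; exact hf) j

lemma dbar_c1 {f : (Fin n → ℂ) → ℂ} (hf : ContDiff ℝ 2 f) (j : Fin n) : ContDiff ℝ 1 (dbar j f) :=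
  dbar_contDiff (m := 1) (by norm_num; exact hf) j

lemma dd_compact {f : (Fin n → ℂ) → ℂ} (hf : HasCompactSupport f) (j : Fin n) : HasCompactSupport (dd j f) := by
  have h1 := hf.fderiv_apply ℝ (Pi.single j 1)
  have h2 := hf.fderiv_apply ℝ (Pi.single j I)
  have : HasCompactSupport fun z => fderiv ℝ f z (Pi.single j 1) - I * fderiv ℝ f z (Pi.single j I) :=
    h1.sub (h2.mul_left (f := fun _ => I))
  exact this.mul_left (f := fun _ => (1/2 : ℂ))

lemma dbar_compact {f : (Fin n → ℂ) → ℂ} (hf : HasCompactSupport f) (j : Fin n) :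
    HasCompactSupport (dbar j f) := by
  have h1 := hf.fderiv_apply ℝ (Pi.single j 1)
  have h2 := hf.fderiv_apply ℝ (Pi.single j I)
  have : HasCompactSupport fun z => fderiv ℝ f z (Pi.single j 1) + I * fderiv ℝ f z (Pi.single j I) :=
    h1.add (h2.mul_left (f := fun _ => I))
  exact this.mul_left (f := fun _ => (1/2 : ℂ))

section alg
variable {f g : (Fin n → ℂ) → ℂ} {z : Fin n → ℂ}

lemma dd_add (hf : DifferentiableAt ℝ f z) (hg : DifferentiableAt ℝ g z) (j : Fin n) :
    dd j (fun x => f x + g x) z = dd j f z + dd j g z := by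
  simp only [dd, fderiv_fun_add hf hg, add_apply]; ring

lemma dbar_add (hf : DifferentiableAt ℝ f z) (hg : DifferentiableAt ℝ g z) (j : Fin n) :
    dbar j (fun x => f x + g x) z = dbar j f z + dbar j g z := by
  simp only [dbar, fderiv_fun_add hf hg, add_apply]; ring

lemma dd_sub (hf : DifferentiableAt ℝ f z) (hg : DifferentiableAt ℝ g z) (j : Fin n) :
    dd j (fun x => f x - g x) z = dd j f z - dd j g z := by
  simp only [dd, fderiv_fun_sub hf hg, sub_apply]; ring

lemma dbar_sub (hf : DifferentiableAt ℝ f z) (hg : DifferentiableAt ℝ g z) (j : Fin n) :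
    dbar j (fun x => f x - g x) z = dbar j f z - dbar j g z := by
  simp only [dbar, fderiv_fun_sub hf hg, sub_apply]; ring

lemma dd_mul (hf : DifferentiableAt ℝ f z) (hg : DifferentiableAt ℝ g z) (j : Fin n) :
    dd j (fun x => f x * g x) z = f z * dd j g z + dd j f z * g z := by
  simp only [dd, fderiv_fun_mul hf hg, add_apply, smul_apply, smul_eq_mul]; ring

lemma dbar_mul (hf : DifferentiableAt ℝ f z) (hg : DifferentiableAt ℝ g z) (j : Fin n) :
    dbar j (fun x => f x * g x) z = f z * dbar j g z + dbar j f z * g z := by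
  simp only [dbar, fderiv_fun_mul hf hg, add_apply, smul_apply, smul_eq_mul]; ring

lemma fderiv_cj (hf : DifferentiableAt ℝ f z) (v : Fin n → ℂ) :
    fderiv ℝ (fun x => cj (f x)) z v = cj (fderiv ℝ f z v) := by
  have : HasFDerivAt (fun x => cj (f x)) ((Complex.conjCLE : ℂ →L[ℝ] ℂ).comp (fderiv ℝ f z)) z :=
    (Complex.conjCLE : ℂ →L[ℝ] ℂ).hasFDerivAt.comp z hf.hasFDerivAt
  rw [this.fderiv]; simp

lemma dd_cj (hf : DifferentiableAt ℝ f z) (j : Fin n) : dd j (fun x => cj (f x)) z = cj (dbar j f z) := by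
  simp only [dd, dbar, fderiv_cj hf]
  simp [Complex.conj_ofNat]; ring

lemma dbar_cj (hf : DifferentiableAt ℝ f z) (j : Fin n) : dbar j (fun x => cj (f x)) z = cj (dd j f z) := by
  simp only [dd, dbar, fderiv_cj hf]
  simp [Complex.conj_ofNat]
end alg

lemma cj_contDiff {m : WithTop ℕ∞} {f : (Fin n → ℂ) → ℂ} (hf : ContDiff ℝ m f) :
    ContDiff ℝ m fun z => cj (f z) := (Complex.conjCLE : ℂ →L[ℝ] ℂ).contDiff.comp hf

lemma cj_compact {f : (Fin n → ℂ) → ℂ} (hf : HasCompactSupport f) : HasCompactSupport fun z => cj (f z) :=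
  hf.comp_left (g := cj) (by simp)

lemma fderiv_fderiv_apply {f : (Fin n → ℂ) → ℂ} (hf : ContDiff ℝ 2 f) (z v w : Fin n → ℂ) :
    fderiv ℝ (fun x => fderiv ℝ f x v) z w = fderiv ℝ (fderiv ℝ f) z w v := by
  have h1 : DifferentiableAt ℝ (fderiv ℝ f) z :=
    (hf.fderiv_right (m := 1) (by norm_num)).differentiable (by norm_num) z
  have := (h1.hasFDerivAt.clm_apply (hasFDerivAt_const v z)).fderiv
  rw [this]; simp

lemma snd_symm {f : (Fin n → ℂ) → ℂ} (hf : ContDiff ℝ 2 f) (z v w : Fin n → ℂ) :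
    fderiv ℝ (fderiv ℝ f) z w v = fderiv ℝ (fderiv ℝ f) z v w :=
  (hf.contDiffAt.isSymmSndFDerivAt (by simp)).eq w v

lemma fderiv_dd {f : (Fin n → ℂ) → ℂ} (hf : ContDiff ℝ 2 f) (z v : Fin n → ℂ) (j : Fin n) :
    fderiv ℝ (dd j f) z v = (1/2) * (fderiv ℝ (fderiv ℝ f) z v (Pi.single j 1) -
      I * fderiv ℝ (fderiv ℝ f) z v (Pi.single j I)) := by
  have hd : ∀ w, DifferentiableAt ℝ (fun x => fderiv ℝ f x w) z := fun w =>
    (contDiff_fderiv_apply (m := 1) (by norm_num; exact hf) w).differentiable (by norm_num) z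
  unfold dd
  rw [fderiv_const_mul ((hd _).fun_sub ((hd _).const_mul _)), fderiv_fun_sub (hd _) ((hd _).const_mul _),
    fderiv_const_mul (hd _)]
  simp only [smul_apply, sub_apply, smul_eq_mul, fderiv_fderiv_apply hf]

lemma fderiv_dbar {f : (Fin n → ℂ) → ℂ} (hf : ContDiff ℝ 2 f) (z v : Fin n → ℂ) (j : Fin n) :
    fderiv ℝ (dbar j f) z v = (1/2) * (fderiv ℝ (fderiv ℝ f) z v (Pi.single j 1) +
      I * fderiv ℝ (fderiv ℝ f) z v (Pi.single j I)) := by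
  have hd : ∀ w, DifferentiableAt ℝ (fun x => fderiv ℝ f x w) z := fun w =>
    (contDiff_fderiv_apply (m := 1) (by norm_num; exact hf) w).differentiable (by norm_num) z
  unfold dbar
  rw [fderiv_const_mul ((hd _).fun_add ((hd _).const_mul _)), fderiv_fun_add (hd _) ((hd _).const_mul _),
    fderiv_const_mul (hd _)]
  simp only [smul_apply, add_apply, smul_eq_mul, fderiv_fderiv_apply hf]

lemma dd_dbar_comm {f : (Fin n → ℂ) → ℂ} (hf : ContDiff ℝ 2 f) (z : Fin n → ℂ) (j k : Fin n) :
    dd j (dbar k f) z = dbar k (dd j f) z := by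
  rw [dd, dbar, fderiv_dbar hf, fderiv_dbar hf, fderiv_dd hf, fderiv_dd hf,
    snd_symm hf z (Pi.single k 1) (Pi.single j 1), snd_symm hf z (Pi.single k 1) (Pi.single j I),
    snd_symm hf z (Pi.single k I) (Pi.single j 1), snd_symm hf z (Pi.single k I) (Pi.single j I)]
  ring

lemma dd_dd_comm {f : (Fin n → ℂ) → ℂ} (hf : ContDiff ℝ 2 f) (z : Fin n → ℂ) (j k : Fin n) :
    dd j (dd k f) z = dd k (dd j f) z := by
  rw [dd, dd, fderiv_dd hf, fderiv_dd hf, fderiv_dd hf, fderiv_dd hf,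
    snd_symm hf z (Pi.single k 1) (Pi.single j 1), snd_symm hf z (Pi.single k 1) (Pi.single j I),
    snd_symm hf z (Pi.single k I) (Pi.single j 1), snd_symm hf z (Pi.single k I) (Pi.single j I)]
  ring

lemma ci {f : (Fin n → ℂ) → ℂ} (hf : Continuous f) (hc : HasCompactSupport f) : Integrable f volume :=
  hf.integrable_of_hasCompactSupport hc

lemma ibp_fderiv {f g : (Fin n → ℂ) → ℂ} (hf : ContDiff ℝ 1 f) (hg : ContDiff ℝ 1 g)
    (hc : HasCompactSupport f) (v : Fin n → ℂ) :
    ∫ z, fderiv ℝ f z v * g z = - ∫ z, f z * fderiv ℝ g z v := by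
  have hf' : Continuous fun z => fderiv ℝ f z v :=
    (contDiff_fderiv_apply (m := 0) (by simpa using hf) v).continuous
  have hg' : Continuous fun z => fderiv ℝ g z v :=
    (contDiff_fderiv_apply (m := 0) (by simpa using hg) v).continuous
  have := integral_mul_fderiv_eq_neg_fderiv_mul_of_integrable (μ := volume) (f := f) (g := g) (v := v)
    (ci (hf'.mul hg.continuous) ((hc.fderiv_apply ℝ v).mul_right))
    (ci (hf.continuous.mul hg') hc.mul_right)
    (ci (hf.continuous.mul hg.continuous) hc.mul_right)
    (fun x _ => hf.differentiable (by norm_num) x) (fun x _ => hg.differentiable (by norm_num) x)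
  rw [this, neg_neg]

lemma ibp_dd {f g : (Fin n → ℂ) → ℂ} (hf : ContDiff ℝ 1 f) (hg : ContDiff ℝ 1 g)
    (hc : HasCompactSupport f) (j : Fin n) :
    ∫ z, dd j f z * g z = - ∫ z, f z * dd j g z := by
  have hf' : ∀ v, Continuous fun z => fderiv ℝ f z v := fun v =>
    (contDiff_fderiv_apply (m := 0) (by simpa using hf) v).continuous
  have hg' : ∀ v, Continuous fun z => fderiv ℝ g z v := fun v =>
    (contDiff_fderiv_apply (m := 0) (by simpa using hg) v).continuous
  have i1 : ∀ v, Integrable fun z => fderiv ℝ f z v * g z := fun v =>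
    ci ((hf' v).mul hg.continuous) ((hc.fderiv_apply ℝ v).mul_right)
  have i2 : ∀ v, Integrable fun z => f z * fderiv ℝ g z v := fun v =>
    ci (hf.continuous.mul (hg' v)) hc.mul_right
  have e1 : ∀ z, dd j f z * g z = (1/2) * (fderiv ℝ f z (Pi.single j 1) * g z -
      I * (fderiv ℝ f z (Pi.single j I) * g z)) := by intro z; rw [dd]; ring
  have e2 : ∀ z, f z * dd j g z = (1/2) * (f z * fderiv ℝ g z (Pi.single j 1) -
      I * (f z * fderiv ℝ g z (Pi.single j I))) := by intro z; rw [dd]; ring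
  simp_rw [e1, e2]
  rw [integral_const_mul, integral_const_mul, integral_sub (i1 _) ((i1 _).const_mul _),
    integral_sub (i2 _) ((i2 _).const_mul _), integral_const_mul, integral_const_mul,
    ibp_fderiv hf hg hc, ibp_fderiv hf hg hc]
  ring

end SOC

namespace SOC
variable {n : ℕ}

local notation "cj" => starRingEnd ℂ

noncomputable def Dp (p : Fin n → (Fin n → ℂ) → ℂ) (j : Fin n) (f : (Fin n → ℂ) → ℂ) (z : Fin n → ℂ) : ℂ :=
  dd j f z - p j z * f z
noncomputable def Db (p : Fin n → (Fin n → ℂ) → ℂ) (j : Fin n) (f : (Fin n → ℂ) → ℂ) (z : Fin n → ℂ) : ℂ :=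
  dbar j f z + cj (p j z) * f z
/-- the Levi matrix of the connection -/
noncomputable def Lev (p : Fin n → (Fin n → ℂ) → ℂ) (j k : Fin n) (z : Fin n → ℂ) : ℂ :=
  dbar k (p j) z + dd j (fun x => cj (p k x)) z

variable {p : Fin n → (Fin n → ℂ) → ℂ}

lemma c1_of_c2 {f : (Fin n → ℂ) → ℂ} (hf : ContDiff ℝ 2 f) : ContDiff ℝ 1 f := hf.of_le (by norm_num)

lemma Dp_c1 (hp : ∀ j, ContDiff ℝ 1 (p j)) {f : (Fin n → ℂ) → ℂ} (hf : ContDiff ℝ 2 f) (j : Fin n) :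
    ContDiff ℝ 1 (Dp p j f) := (dd_c1 hf j).sub ((hp j).mul (c1_of_c2 hf))
lemma Db_c1 (hp : ∀ j, ContDiff ℝ 1 (p j)) {f : (Fin n → ℂ) → ℂ} (hf : ContDiff ℝ 2 f) (j : Fin n) :
    ContDiff ℝ 1 (Db p j f) := (dbar_c1 hf j).add ((cj_contDiff (hp j)).mul (c1_of_c2 hf))
lemma Dp_cont (hp : ∀ j, Continuous (p j)) {f : (Fin n → ℂ) → ℂ} (hf : ContDiff ℝ 1 f) (j : Fin n) :
    Continuous (Dp p j f) := (dd_continuous hf j).sub ((hp j).mul hf.continuous)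
lemma Db_cont (hp : ∀ j, Continuous (p j)) {f : (Fin n → ℂ) → ℂ} (hf : ContDiff ℝ 1 f) (j : Fin n) :
    Continuous (Db p j f) := (dbar_continuous hf j).add ((Complex.continuous_conj.comp (hp j)).mul hf.continuous)
lemma Dp_compact {f : (Fin n → ℂ) → ℂ} (hf : HasCompactSupport f) (j : Fin n) :
    HasCompactSupport (Dp p j f) := (dd_compact hf j).sub (hf.mul_left)
lemma Db_compact {f : (Fin n → ℂ) → ℂ} (hf : HasCompactSupport f) (j : Fin n) :
    HasCompactSupport (Db p j f) := (dbar_compact hf j).add (hf.mul_left (f := fun z => cj (p j z)))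

lemma ibp_D (hp : ∀ j, Continuous (p j)) {f g : (Fin n → ℂ) → ℂ} (hf : ContDiff ℝ 1 f) (hg : ContDiff ℝ 1 g)
    (hc : HasCompactSupport f) (j : Fin n) :
    ∫ z, Dp p j f z * cj (g z) = - ∫ z, f z * cj (Db p j g z) := by
  have hg' := cj_contDiff hg
  have i1 : Integrable fun z => dd j f z * cj (g z) :=
    ci ((dd_continuous hf j).mul hg'.continuous) (dd_compact hc j).mul_right
  have i2 : Integrable fun z => f z * (p j z * cj (g z)) :=
    ci (hf.continuous.mul ((hp j).mul hg'.continuous)) hc.mul_right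
  have i3 : Integrable fun z => f z * dd j (fun x => cj (g x)) z :=
    ci (hf.continuous.mul (dd_continuous hg' j)) hc.mul_right
  have e1 : ∀ z, Dp p j f z * cj (g z) = dd j f z * cj (g z) - f z * (p j z * cj (g z)) := by
    intro z; rw [Dp]; ring
  have e2 : ∀ z, f z * cj (Db p j g z) = f z * dd j (fun x => cj (g x)) z + f z * (p j z * cj (g z)) := by
    intro z; rw [Db, dd_cj (hg.differentiable (by norm_num) z)]; simp; ring
  simp_rw [e1, e2]
  rw [integral_sub i1 i2, integral_add i3 i2, ibp_dd hf hg' hc]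
  ring

lemma ibp_D' (hp : ∀ j, Continuous (p j)) {f g : (Fin n → ℂ) → ℂ} (hf : ContDiff ℝ 1 f) (hg : ContDiff ℝ 1 g)
    (hc : HasCompactSupport f) (j : Fin n) :
    ∫ z, g z * cj (Dp p j f z) = - ∫ z, Db p j g z * cj (f z) := by
  have := congrArg cj (ibp_D hp hf hg hc j)
  rw [map_neg, ← integral_conj, ← integral_conj] at this
  simpa [mul_comm] using this

lemma D_comm (hp : ∀ j, ContDiff ℝ 1 (p j)) {f : (Fin n → ℂ) → ℂ} (hf : ContDiff ℝ 2 f) (j k : Fin n)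
    (z : Fin n → ℂ) : Db p k (Dp p j f) z = Dp p j (Db p k f) z - Lev p j k z * f z := by
  have h1 : ∀ {g : (Fin n → ℂ) → ℂ}, ContDiff ℝ 1 g → DifferentiableAt ℝ g z :=
    fun hg => hg.differentiable (by norm_num) z
  have hfd := h1 (c1_of_c2 hf)
  have e1 : dbar k (Dp p j f) z = dbar k (dd j f) z - (p j z * dbar k f z + dbar k (p j) z * f z) := by
    unfold Dp
    rw [dbar_sub (h1 (dd_c1 hf j)) (h1 ((hp j).mul (c1_of_c2 hf))), dbar_mul (h1 (hp j)) hfd]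
  have e2 : dd j (Db p k f) z = dd j (dbar k f) z + (cj (p k z) * dd j f z + dd j (fun x => cj (p k x)) z * f z) := by
    unfold Db
    rw [dd_add (h1 (dbar_c1 hf k)) (h1 ((cj_contDiff (hp k)).mul (c1_of_c2 hf))),
      dd_mul (h1 (cj_contDiff (hp k))) hfd]
  rw [Db, Dp, e1, Dp, e2, dd_dbar_comm hf, Lev, Db]
  ring

lemma Lev_cont (hp : ∀ j, ContDiff ℝ 1 (p j)) (j k : Fin n) : Continuous (Lev p j k) :=
  (dbar_continuous (hp j) k).add (dd_continuous (cj_contDiff (hp k)) j)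

lemma A_jk (hp : ∀ j, ContDiff ℝ 1 (p j)) {f g : (Fin n → ℂ) → ℂ} (hf : ContDiff ℝ 2 f) (hg : ContDiff ℝ 2 g)
    (hfc : HasCompactSupport f) (hgc : HasCompactSupport g) (j k : Fin n) :
    ∫ z, Dp p j f z * cj (Dp p k g z) =
      ∫ z, Db p k f z * cj (Db p j g z) + Lev p j k z * f z * cj (g z) := by
  have hp0 : ∀ j, Continuous (p j) := fun j => (hp j).continuous
  rw [ibp_D' hp0 (c1_of_c2 hg) (Dp_c1 hp hf j) hgc]
  have i1 : Integrable fun z => Dp p j (Db p k f) z * cj (g z) :=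
    ci ((Dp_cont hp0 (Db_c1 hp hf k) j).mul (cj_contDiff hg).continuous) (cj_compact hgc).mul_left
  have i2 : Integrable fun z => Lev p j k z * f z * cj (g z) :=
    ci (((Lev_cont hp j k).mul hf.continuous).mul (cj_contDiff hg).continuous) (cj_compact hgc).mul_left
  have i3 : Integrable fun z => Db p k f z * cj (Db p j g z) :=
    ci ((Db_c1 hp hf k).continuous.mul (cj_contDiff (Db_c1 hp hg j)).continuous)
      (Db_compact hfc k).mul_right
  simp_rw [D_comm hp hf, sub_mul]
  rw [integral_sub i1 i2, integral_add i3 i2,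
    ibp_D hp0 (Db_c1 hp hf k) (c1_of_c2 hg) (Db_compact hfc k)]
  ring

lemma ci_sq {f : (Fin n → ℂ) → ℂ} (hf : Continuous f) (hc : HasCompactSupport f) :
    Integrable (fun z => ‖f z‖ ^ 2) volume := by
  have h1 : Continuous fun z => ‖f z‖ ^ 2 := hf.norm.pow 2
  refine h1.integrable_of_hasCompactSupport ?_
  have h2 : HasCompactSupport ((fun w : ℂ => ‖w‖ ^ 2) ∘ f) := hc.comp_left (by simp)
  exact h2

lemma compact_sum {f : Fin n → (Fin n → ℂ) → ℂ} (hc : ∀ j, HasCompactSupport (f j)) :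
    HasCompactSupport fun z => ∑ j, f j z := by
  have : (fun z => ∑ j, f j z) = ∑ j, f j := by ext z; simp
  rw [this]
  exact HasCompactSupport.finset_sum fun j _ => hc j

lemma basic_ineq (hp : ∀ j, ContDiff ℝ 1 (p j)) {β : Fin n → (Fin n → ℂ) → ℂ} (hβ : ∀ j, ContDiff ℝ 2 (β j))
    (hβc : ∀ j, HasCompactSupport (β j)) :
    ∫ z, (∑ j, ∑ k, Lev p j k z * β j z * cj (β k z)).re ≤
      ∫ z, ‖∑ j, Dp p j (β j) z‖ ^ 2 +
        ∑ j, ∑ k, (1/2 : ℝ) * ‖Db p k (β j) z - Db p j (β k) z‖ ^ 2 := by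
  have hp0 : ∀ j, Continuous (p j) := fun j => (hp j).continuous
  have hS : ∀ z, ((‖∑ j, Dp p j (β j) z‖ ^ 2 : ℝ) : ℂ) = ∑ j, ∑ k, Dp p j (β j) z * cj (Dp p k (β k) z) := by
    intro z
    push_cast
    rw [← Complex.mul_conj', map_sum, Finset.sum_mul_sum]
  have iA : ∀ j k, Integrable fun z => Dp p j (β j) z * cj (Dp p k (β k) z) := fun j k =>
    ci ((Dp_c1 hp (hβ j) j).continuous.mul (cj_contDiff (Dp_c1 hp (hβ k) k)).continuous)
      (Dp_compact (hβc j) j).mul_right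
  have iL : ∀ j k, Integrable fun z => Lev p j k z * β j z * cj (β k z) := fun j k =>
    ci (((Lev_cont hp j k).mul (hβ j).continuous).mul (cj_contDiff (hβ k)).continuous) (cj_compact (hβc k)).mul_left
  have iB : ∀ j k, Integrable fun z => Db p k (β j) z * cj (Db p j (β k) z) := fun j k =>
    ci ((Db_c1 hp (hβ j) k).continuous.mul (cj_contDiff (Db_c1 hp (hβ k) j)).continuous)
      (Db_compact (hβc j) k).mul_right
  have iC : ∀ j k, Integrable fun z => ‖Db p k (β j) z - Db p j (β k) z‖ ^ 2 := by
    intro j k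
    have hcs : HasCompactSupport fun z => Db p k (β j) z - Db p j (β k) z :=
      (Db_compact (hβc j) k).sub (Db_compact (hβc k) j)
    have hcc : Continuous fun z => Db p k (β j) z - Db p j (β k) z :=
      (Db_c1 hp (hβ j) k).continuous.sub (Db_c1 hp (hβ k) j).continuous
    exact ci_sq hcc hcs
  have iAA : Integrable fun z => ∑ j, ∑ k, Dp p j (β j) z * cj (Dp p k (β k) z) :=
    integrable_finset_sum _ fun j _ => integrable_finset_sum _ fun k _ => iA j k
  have iBB : Integrable fun z => ∑ j, ∑ k, Db p k (β j) z * cj (Db p j (β k) z) :=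
    integrable_finset_sum _ fun j _ => integrable_finset_sum _ fun k _ => iB j k
  have iLL : Integrable fun z => ∑ j, ∑ k, Lev p j k z * β j z * cj (β k z) :=
    integrable_finset_sum _ fun j _ => integrable_finset_sum _ fun k _ => iL j k
  have iS : Integrable fun z => ‖∑ j, Dp p j (β j) z‖ ^ 2 := by
    have hcs : HasCompactSupport fun z => ∑ j, Dp p j (β j) z := by
      exact compact_sum fun j => Dp_compact (hβc j) j
    have hcc : Continuous fun z => ∑ j, Dp p j (β j) z :=
      continuous_finset_sum _ fun j _ => (Dp_c1 hp (hβ j) j).continuous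
    exact ci_sq hcc hcs
  have iCC : Integrable fun z => ∑ j, ∑ k, (1/2 : ℝ) * ‖Db p k (β j) z - Db p j (β k) z‖ ^ 2 :=
    integrable_finset_sum _ fun j _ => integrable_finset_sum _ fun k _ => (iC j k).const_mul _
  have iBL : ∀ j k, Integrable fun z => Db p k (β j) z * cj (Db p j (β k) z) + Lev p j k z * β j z * cj (β k z) :=
    fun j k => (iB j k).add (iL j k)
  have iBBL : Integrable fun z => (∑ j, ∑ k, Db p k (β j) z * cj (Db p j (β k) z)) +
      ∑ j, ∑ k, Lev p j k z * β j z * cj (β k z) := iBB.add iLL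
  have key : ∫ z, ∑ j, ∑ k, Dp p j (β j) z * cj (Dp p k (β k) z) =
      ∫ z, (∑ j, ∑ k, Db p k (β j) z * cj (Db p j (β k) z)) + ∑ j, ∑ k, Lev p j k z * β j z * cj (β k z) := by
    simp_rw [← Finset.sum_add_distrib]
    rw [integral_finset_sum _ fun j _ => integrable_finset_sum _ fun k _ => iA j k,
      integral_finset_sum _ fun j _ => integrable_finset_sum _ fun k _ => iBL j k]
    refine Finset.sum_congr rfl fun j _ => ?_
    rw [integral_finset_sum _ fun k _ => iA j k, integral_finset_sum _ fun k _ => iBL j k]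
    exact Finset.sum_congr rfl fun k _ => A_jk hp (hβ j) (hβ k) (hβc j) (hβc k) j k
  have key2 : ∫ z, ‖∑ j, Dp p j (β j) z‖ ^ 2 =
      ∫ z, ((∑ j, ∑ k, Db p k (β j) z * cj (Db p j (β k) z)).re + (∑ j, ∑ k, Lev p j k z * β j z * cj (β k z)).re) := by
    have h := congrArg Complex.re key
    rw [← Complex.reCLM_apply, ← Complex.reCLM_apply, ← ContinuousLinearMap.integral_comp_comm _ iAA,
      ← ContinuousLinearMap.integral_comp_comm _ iBBL] at h
    simp only [Complex.reCLM_apply, Complex.add_re] at h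
    rw [← h]
    congr 1; ext z
    rw [← hS, Complex.ofReal_re]
  rw [integral_add iS iCC, key2, ← integral_add]
  · refine integral_mono iLL.re ?_ ?_
    · exact (iBB.re.add iLL.re).add iCC
    · intro z
      simp only
      have : 0 ≤ (∑ j, ∑ k, Db p k (β j) z * cj (Db p j (β k) z)).re +
          ∑ j, ∑ k, (1/2 : ℝ) * ‖Db p k (β j) z - Db p j (β k) z‖ ^ 2 := by
        rw [Complex.re_sum]
        simp_rw [Complex.re_sum]
        rw [← Finset.sum_add_distrib]
        refine Finset.sum_nonneg fun j _ => ?_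
        rw [← Finset.sum_add_distrib]
        refine Finset.sum_nonneg fun k _ => ?_
        rw [← Complex.normSq_eq_norm_sq, Complex.normSq_sub]
        nlinarith [Complex.normSq_nonneg (Db p k (β j) z), Complex.normSq_nonneg (Db p j (β k) z)]
      linarith
  · exact iBB.re.add iLL.re
  · exact iCC
end SOC

namespace SOC
variable {n : ℕ}

local notation "cj" => starRingEnd ℂ

lemma dd_moll {ε : ℝ} (hε : 0 < ε) {f : (Fin n → ℂ) → ℂ} (hf : LocallyIntegrable f volume)
    (x : Fin n → ℂ) (j : Fin n) :
    dd j (moll ε f) x = - ∫ t, f t * dd j (fun s => (kap ε (x - s) : ℂ)) t := by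
  have hk : ContDiff ℝ 1 fun s => (kap ε (x - s) : ℂ) := by
    apply Complex.ofRealCLM.contDiff.comp
    exact (kap_contDiff ε (m := 1)).comp (contDiff_const.sub contDiff_id)
  have hf' : LocallyIntegrable (fun z => cj (f z)) volume := by
    intro z
    obtain ⟨U, hU, h⟩ := hf z
    exact ⟨U, hU, ((Complex.conjCLE : ℂ →L[ℝ] ℂ).integrable_comp h)⟩
  have e1 : moll ε f = fun x => cj (moll ε (fun z => cj (f z)) x) := by
    ext x
    unfold moll
    rw [← integral_conj]
    congr 1; ext t; simp
  rw [e1, dd_cj ((moll_contDiff hε hf' (m := 1)).differentiable (by norm_num) x), dbar_moll hε hf',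
    map_neg, ← integral_conj]
  congr 2; ext t
  rw [map_mul, Complex.conj_conj, ← dd_cj (hk.differentiable (by norm_num) t)]
  simp

structure L2T (u : ℕ → (Fin n → ℂ) → ℂ) (f : (Fin n → ℂ) → ℂ) : Prop where
  mem : ∀ j, MemLp (u j) 2 volume
  lim : MemLp f 2 volume
  tend : Tendsto (fun j => eLpNorm (fun x => u j x - f x) 2 volume) atTop (nhds 0)

namespace L2T
variable {u v : ℕ → (Fin n → ℂ) → ℂ} {f g : (Fin n → ℂ) → ℂ}

lemma congr (h : L2T u f) {u' : ℕ → (Fin n → ℂ) → ℂ} {f' : (Fin n → ℂ) → ℂ} (h1 : ∀ j x, u j x = u' j x)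
    (h2 : ∀ x, f x = f' x) : L2T u' f' := by
  obtain rfl : u = u' := by ext j x; exact h1 j x
  obtain rfl : f = f' := by ext x; exact h2 x
  exact h

lemma add (hu : L2T u f) (hv : L2T v g) : L2T (fun j x => u j x + v j x) (fun x => f x + g x) := by
  refine ⟨fun j => (hu.mem j).add (hv.mem j), hu.lim.add hv.lim, ?_⟩
  have := hu.tend.add hv.tend
  rw [add_zero] at this
  refine tendsto_of_tendsto_of_tendsto_of_le_of_le tendsto_const_nhds this (fun _ => zero_le) fun j => ?_
  refine le_trans (le_of_eq ?_) (eLpNorm_add_le ((hu.mem j).sub hu.lim).1 ((hv.mem j).sub hv.lim).1 (by norm_num))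
  congr 1; ext x; simp; ring

lemma neg (hu : L2T u f) : L2T (fun j x => - u j x) (fun x => - f x) := by
  refine ⟨fun j => (hu.mem j).neg, hu.lim.neg, ?_⟩
  refine hu.tend.congr fun j => ?_
  rw [← eLpNorm_neg]
  congr 1; ext x; simp; ring

lemma sub (hu : L2T u f) (hv : L2T v g) : L2T (fun j x => u j x - v j x) (fun x => f x - g x) :=
  (hu.add hv.neg).congr (fun j x => (sub_eq_add_neg _ _).symm) (fun x => (sub_eq_add_neg _ _).symm)

lemma zero : L2T (fun (_ : ℕ) (_ : Fin n → ℂ) => 0) (fun _ => 0) :=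
  ⟨fun _ => MemLp.zero', MemLp.zero', by simp⟩

lemma sum {ι : Type*} (s : Finset ι) {u : ι → ℕ → (Fin n → ℂ) → ℂ} {f : ι → (Fin n → ℂ) → ℂ}
    (h : ∀ i, L2T (u i) (f i)) : L2T (fun j x => ∑ i ∈ s, u i j x) (fun x => ∑ i ∈ s, f i x) := by
  classical
  induction s using Finset.induction_on with
  | empty => simpa using zero
  | insert a s ha ih =>
    exact ((h a).add ih).congr (fun j x => (Finset.sum_insert (f := fun i => u i j x) ha).symm)
      (fun x => (Finset.sum_insert (f := fun i => f i x) ha).symm)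

lemma inner (hu : L2T u f) (hv : L2T v g) :
    Tendsto (fun j => ∫ x, u j x * cj (v j x)) atTop (nhds (∫ x, f x * cj (g x))) := by
  have key : ∀ {a b : (Fin n → ℂ) → ℂ} (ha : MemLp a 2 volume) (hb : MemLp b 2 volume),
      ∫ x, a x * cj (b x) = Inner.inner ℂ (hb.toLp b) (ha.toLp a) := by
    intro a b ha hb
    rw [L2.inner_def]
    apply integral_congr_ae
    filter_upwards [ha.coeFn_toLp, hb.coeFn_toLp] with x h1 h2
    rw [h1, h2]; rfl
  have t1 := (Lp.tendsto_Lp_iff_tendsto_eLpNorm'' _ hu.mem _ hu.lim).mpr hu.tend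
  have t2 := (Lp.tendsto_Lp_iff_tendsto_eLpNorm'' _ hv.mem _ hv.lim).mpr hv.tend
  rw [key hu.lim hv.lim]
  refine (Filter.Tendsto.inner t2 t1).congr fun j => ?_
  rw [key (hu.mem j) (hv.mem j)]

lemma sq (hu : L2T u f) : Tendsto (fun j => ∫ x, ‖u j x‖ ^ 2) atTop (nhds (∫ x, ‖f x‖ ^ 2)) := by
  have h := hu.inner hu
  have e : ∀ a : (Fin n → ℂ) → ℂ, ∫ x, a x * cj (a x) = ((∫ x, ‖a x‖ ^ 2 : ℝ) : ℂ) := by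
    intro a
    rw [← integral_complex_ofReal]
    congr 1; ext x; rw [Complex.mul_conj']; push_cast; rfl
  simp_rw [e] at h
  have := (Complex.continuous_re.tendsto _).comp h
  simpa [Function.comp_def] using this

lemma mul_bdd (hu : L2T u f) {p : (Fin n → ℂ) → ℂ} (hp : Continuous p) {K : Set (Fin n → ℂ)} (hK : IsCompact K)
    (hu0 : ∀ j, ∀ x ∉ K, u j x = 0) (hf0 : ∀ x ∉ K, f x = 0) :
    L2T (fun j x => p x * u j x) (fun x => p x * f x) := by
  obtain ⟨C, hC⟩ := hK.exists_bound_of_continuousOn hp.continuousOn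
  have hb : ∀ (g : (Fin n → ℂ) → ℂ), (∀ x ∉ K, g x = 0) → ∀ x, ‖p x * g x‖ ≤ C * ‖g x‖ := by
    intro g hg x
    rw [norm_mul]
    by_cases hx : x ∈ K
    · gcongr; exact hC x hx
    · simp [hg x hx]
  refine ⟨fun j => ?_, ?_, ?_⟩
  · exact (hu.mem j).of_le_mul (hp.aestronglyMeasurable.mul (hu.mem j).1)
      (Filter.Eventually.of_forall (hb _ (hu0 j)))
  · exact hu.lim.of_le_mul (hp.aestronglyMeasurable.mul hu.lim.1)
      (Filter.Eventually.of_forall (hb _ hf0))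
  · have := ENNReal.Tendsto.const_mul (a := ENNReal.ofReal C) hu.tend (Or.inr ENNReal.ofReal_ne_top)
    rw [mul_zero] at this
    refine tendsto_of_tendsto_of_tendsto_of_le_of_le tendsto_const_nhds this (fun _ => zero_le) fun j => ?_
    refine le_trans (le_of_eq ?_) (eLpNorm_le_mul_eLpNorm_of_ae_le_mul
      (f := fun x => p x * (u j x - f x)) (Filter.Eventually.of_forall (hb _ ?_)) 2)
    · congr 1; ext x; ring
    · intro x hx; simp [hu0 j x hx, hf0 x hx]

lemma dom (hf : MemLp f 2 volume) {c : ℕ → (Fin n → ℂ) → ℂ} {c₀ : ℂ} (hc : ∀ j, Continuous (c j))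
    {C : ℝ} (hC : ∀ j x, ‖c j x - c₀‖ ≤ C) (ht : ∀ x, Tendsto (fun j => c j x) atTop (nhds c₀)) :
    L2T (fun j x => f x * c j x) (fun x => f x * c₀) := by
  have hm : ∀ j, MemLp (fun x => f x * (c j x - c₀)) 2 volume := fun j =>
    hf.of_le_mul (hf.1.mul ((hc j).sub continuous_const).aestronglyMeasurable)
      (Filter.Eventually.of_forall fun x => by
        rw [norm_mul, mul_comm]; gcongr; exact hC j x)
  have h0 : MemLp (fun x => f x * c₀) 2 volume := by simpa [mul_comm] using hf.const_mul c₀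
  refine ⟨fun j => ?_, h0, ?_⟩
  · have := (hm j).add h0
    refine this.congr_norm ?_ ?_
    · exact hf.1.mul (hc j).aestronglyMeasurable
    · refine Filter.Eventually.of_forall fun x => ?_
      congr 1; simp; ring
  have h2 : Tendsto (fun j => eLpNorm (fun x => f x * c j x - f x * c₀) 2 volume ^ 2) atTop (nhds 0) := by
    simp_rw [eLpNorm_two_sq]
    have : (0 : ℝ≥0∞) = ∫⁻ x : Fin n → ℂ, 0 := by simp
    rw [this]
    refine tendsto_lintegral_of_dominated_convergence' (fun x => ‖f x‖ₑ ^ 2 * ENNReal.ofReal C ^ 2) ?_ ?_ ?_ ?_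
    · intro j
      exact ((hf.1.mul (hc j).aestronglyMeasurable).sub (hf.1.mul aestronglyMeasurable_const)).enorm.pow_const 2
    · intro j
      refine Filter.Eventually.of_forall fun x => ?_
      beta_reduce
      rw [← mul_sub, enorm_mul, mul_pow]
      gcongr
      rw [← ofReal_norm_eq_enorm]
      exact ENNReal.ofReal_le_ofReal (hC j x)
    · rw [lintegral_mul_const'' _ (hf.1.enorm.pow_const 2), ← eLpNorm_two_sq]
      exact ENNReal.mul_ne_top (ENNReal.pow_ne_top hf.2.ne) (ENNReal.pow_ne_top ENNReal.ofReal_ne_top)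
    · refine Filter.Eventually.of_forall fun x => ?_
      have h3 : Tendsto (fun j => f x * c j x - f x * c₀) atTop (nhds 0) := by
        have := ((ht x).const_mul (f x)).sub_const (f x * c₀)
        simpa using this
      have h4 := ((ENNReal.continuous_pow 2).tendsto _).comp h3.enorm
      simpa [Function.comp_def] using h4
  have h3 := (ENNReal.continuous_rpow_const (y := 1/2)).tendsto 0 |>.comp h2
  have h4 : ∀ a : ℝ≥0∞, (a ^ 2) ^ (2⁻¹ : ℝ) = a := by
    intro a
    rw [← ENNReal.rpow_natCast, ← ENNReal.rpow_mul]; norm_num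
  simpa [Function.comp_def, h4] using h3

lemma const (hf : MemLp f 2 volume) : L2T (fun _ => f) f :=
  ⟨fun _ => hf, hf, by simp⟩
end L2T

noncomputable def ee (j : ℕ) : ℝ := 1 / ((j : ℝ) + 1)
lemma ee_pos (j : ℕ) : 0 < ee j := by unfold ee; positivity
lemma ee_le (j : ℕ) : ee j ≤ 1 := by
  unfold ee; rw [div_le_one (by positivity)]; linarith [(Nat.cast_nonneg j : (0:ℝ) ≤ j)]
lemma ee_tendsto : Tendsto ee atTop (nhds 0) := tendsto_one_div_add_atTop_nhds_zero_nat

lemma L2T.moll {f : (Fin n → ℂ) → ℂ} (hf : MemLp f 2 volume) (hc : HasCompactSupport f) :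
    L2T (fun j => moll (ee j) f) f :=
  ⟨fun j => ((moll_contDiff (ee_pos j) (hf.locallyIntegrable (by norm_num)) (m := 0)).continuous).memLp_of_hasCompactSupport
    (moll_compact (ee_pos j) hc), hf, moll_tendsto hf ee_pos ee_tendsto⟩

lemma moll_supp {ε R : ℝ} (hε : 0 < ε) (hε1 : ε ≤ 1) {f : (Fin n → ℂ) → ℂ} (hf : ∀ x ∉ Metric.closedBall (0 : Fin n → ℂ) R, f x = 0)
    (x : Fin n → ℂ) (hx : x ∉ Metric.closedBall (0 : Fin n → ℂ) (R + 1)) : moll ε f x = 0 := by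
  have : SOC.moll ε f x = SOC.moll ε (fun _ => (0:ℂ)) x := by
    apply moll_congr hε
    refine Filter.Eventually.of_forall fun t ht => hf t ?_
    intro h
    apply hx
    rw [Metric.mem_ball] at ht
    rw [Metric.mem_closedBall] at h ⊢
    have := dist_triangle x t 0
    rw [dist_comm x t] at this
    linarith
  rw [this]; simp [SOC.moll]

end SOC

namespace SOC
variable {n : ℕ}

local notation "cj" => starRingEnd ℂ

lemma quad_bound {A B I : ℝ} (hB : 0 ≤ B) (hI : 0 ≤ I) (hA : 0 ≤ A)
    (h : ∀ t : ℝ, 0 < t → 2 * I * t ≤ A * (t * t) + B) : I ^ 2 ≤ A * B := by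
  have := discrim_le_zero (a := A) (b := -(2 * I)) (c := B) (fun t => by
    rcases lt_or_ge 0 t with ht | ht
    · have := h t ht; linarith
    · nlinarith [mul_nonneg hI (neg_nonneg.mpr ht), mul_nonneg hA (mul_self_nonneg t)])
  rw [discrim] at this
  nlinarith

variable {p : Fin n → (Fin n → ℂ) → ℂ}

lemma energy_int (hp : ∀ j, ContDiff ℝ 1 (p j)) {u : Fin n → (Fin n → ℂ) → ℂ} (hu : ∀ j, ContDiff ℝ 2 (u j))
    (huc : ∀ j, HasCompactSupport (u j)) :
    ∫ z, ‖∑ j, Dp p j (u j) z‖ ^ 2 + ∑ j, ∑ k, (1/2 : ℝ) * ‖Db p k (u j) z - Db p j (u k) z‖ ^ 2 =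
    (∫ z, ‖∑ j, Dp p j (u j) z‖ ^ 2) + ∑ j, ∑ k, (1/2 : ℝ) * ∫ z, ‖Db p k (u j) z - Db p j (u k) z‖ ^ 2 := by
  have i1 : Integrable fun z => ‖∑ j, Dp p j (u j) z‖ ^ 2 := by
    apply ci_sq
    · exact continuous_finsetSum _ fun j _ => (Dp_c1 hp (hu j) j).continuous
    · exact compact_sum fun j => Dp_compact (huc j) j
  have i2 : ∀ j k, Integrable fun z => (1/2 : ℝ) * ‖Db p k (u j) z - Db p j (u k) z‖ ^ 2 := fun j k =>
    (ci_sq ((Db_c1 hp (hu j) k).continuous.sub (Db_c1 hp (hu k) j).continuous)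
      ((Db_compact (huc j) k).sub (Db_compact (huc k) j))).const_mul _
  rw [integral_add i1 (integrable_finsetSum _ fun j _ => integrable_finsetSum _ fun k _ => i2 j k)]
  congr 1
  rw [integral_finsetSum _ fun j _ => integrable_finsetSum _ fun k _ => i2 j k]
  congr 1; ext j
  rw [integral_finsetSum _ fun k _ => i2 j k]
  congr 1; ext k
  rw [integral_const_mul]

lemma est_test (hp : ∀ j, ContDiff ℝ 1 (p j)) {u : Fin n → (Fin n → ℂ) → ℂ} (hu : ∀ j, ContDiff ℝ 2 (u j))
    (huc : ∀ j, HasCompactSupport (u j)) {γ : Fin n → (Fin n → ℂ) → ℂ} (hγ : ∀ j, Continuous (γ j))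
    {G : (Fin n → ℂ) → ℝ} (hG : Continuous G) (hGc : HasCompactSupport G) (hG0 : ∀ z, 0 ≤ G z)
    (hL : ∀ z (b : Fin n → ℂ), 0 ≤ (∑ j, ∑ k, Lev p j k z * b j * cj (b k)).re)
    (hGL : ∀ z (b : Fin n → ℂ), ‖∑ j, γ j z * cj (b j)‖ ^ 2 ≤ G z * (∑ j, ∑ k, Lev p j k z * b j * cj (b k)).re) :
    ‖∫ z, ∑ j, γ j z * cj (u j z)‖ ^ 2 ≤ (∫ z, G z) *
      ((∫ z, ‖∑ j, Dp p j (u j) z‖ ^ 2) + ∑ j, ∑ k, (1/2 : ℝ) * ∫ z, ‖Db p k (u j) z - Db p j (u k) z‖ ^ 2) := by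
  rw [← energy_int hp hu huc]
  set L : (Fin n → ℂ) → ℝ := fun z => (∑ j, ∑ k, Lev p j k z * u j z * cj (u k z)).re with hLdef
  have hb := basic_ineq hp hu huc
  have hucont : ∀ j, Continuous (u j) := fun j => (hu j).continuous
  have hLc : Continuous L := by
    apply Complex.continuous_re.comp
    refine continuous_finsetSum _ fun j _ => continuous_finsetSum _ fun k _ => ?_
    exact ((Lev_cont hp j k).mul (hucont j)).mul (Complex.continuous_conj.comp (hucont k))
  have hLi : Integrable L := by
    have : Integrable fun z => ∑ j, ∑ k, Lev p j k z * u j z * cj (u k z) := by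
      refine integrable_finsetSum _ fun j _ => integrable_finsetSum _ fun k _ => ?_
      refine ci (((Lev_cont hp j k).mul (hucont j)).mul (Complex.continuous_conj.comp (hucont k))) ?_
      exact HasCompactSupport.mul_left (f' := fun z => cj (u k z)) (cj_compact (huc k))
    exact this.re
  have hGi : Integrable G := hG.integrable_of_hasCompactSupport hGc
  have hA : 0 ≤ ∫ z, G z := integral_nonneg hG0
  have hB : 0 ≤ ∫ z, L z := integral_nonneg fun z => hL z _
  have key : ‖∫ z, ∑ j, γ j z * cj (u j z)‖ ^ 2 ≤ (∫ z, G z) * ∫ z, L z := by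
    apply quad_bound hB (norm_nonneg _) hA
    intro t ht
    have h1 : ‖∫ z, ∑ j, γ j z * cj (u j z)‖ ≤ ∫ z, ((t / 2) * G z + (1 / (2 * t)) * L z) := by
      apply norm_integral_le_of_norm_le ((hGi.const_mul _).add (hLi.const_mul _))
      refine Filter.Eventually.of_forall fun z => ?_
      have h2 := hGL z (fun j => u j z)
      have h3 := hL z (fun j => u j z)
      change _ ≤ G z * L z at h2
      change 0 ≤ L z at h3
      set a := ‖∑ j, γ j z * cj (u j z)‖
      have h4 : a ^ 2 ≤ ((t / 2) * G z + (1 / (2 * t)) * L z) ^ 2 := by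
        refine h2.trans ?_
        have e : ((t / 2) * G z + (1 / (2 * t)) * L z) ^ 2 - G z * L z = ((t / 2) * G z - (1 / (2 * t)) * L z) ^ 2 := by
          field_simp; ring
        nlinarith [sq_nonneg ((t / 2) * G z - (1 / (2 * t)) * L z)]
      have := hG0 z
      exact abs_le_of_sq_le_sq' h4 (by positivity) |>.2
    rw [integral_add (hGi.const_mul _) (hLi.const_mul _), integral_const_mul, integral_const_mul] at h1
    have h5 := mul_le_mul_of_nonneg_left h1 (by positivity : 0 ≤ 2 * t)
    have e : 2 * t * ((t / 2) * (∫ z, G z) + (1 / (2 * t)) * ∫ z, L z) = (∫ z, G z) * (t * t) + ∫ z, L z := by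
      field_simp
    linarith
  exact key.trans (mul_le_mul_of_nonneg_left hb hA)

lemma memLp_mul_c {f c : (Fin n → ℂ) → ℂ} (hf : MemLp f 2 volume) (hc : Continuous c) (hcc : HasCompactSupport c) :
    MemLp (fun x => c x * f x) 2 volume := by
  obtain ⟨C, hC⟩ := hcc.exists_bound_of_continuous hc
  refine hf.of_le_mul (c := C) (hc.aestronglyMeasurable.mul hf.1) (Filter.Eventually.of_forall fun x => ?_)
  rw [norm_mul]; gcongr; exact hC x

lemma int_mul_c {f c : (Fin n → ℂ) → ℂ} (hf : MemLp f 2 volume) (hc : Continuous c) (hcc : HasCompactSupport c) :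
    Integrable (fun x => c x * f x) volume :=
  (hf.locallyIntegrable (by norm_num)).integrable_smul_left_of_hasCompactSupport hc hcc

/-- weak curl-free -/
def WCurl (p : Fin n → (Fin n → ℂ) → ℂ) (β : Fin n → (Fin n → ℂ) → ℂ) : Prop :=
  ∀ j k, ∀ η : (Fin n → ℂ) → ℂ, ContDiff ℝ 2 η → HasCompactSupport η →
    ∫ z, ((dbar j η z - cj (p j z) * η z) * β k z - (dbar k η z - cj (p k z) * η z) * β j z) = 0

/-- weak divergence -/
def WDiv (p : Fin n → (Fin n → ℂ) → ℂ) (β : Fin n → (Fin n → ℂ) → ℂ) (s : (Fin n → ℂ) → ℂ) : Prop :=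
  ∀ η : (Fin n → ℂ) → ℂ, ContDiff ℝ 2 η → HasCompactSupport η →
    ∫ z, (∑ j, (dd j η z + p j z * η z) * β j z) = - ∫ z, η z * s z

lemma kapx_contDiff (ε : ℝ) (x : Fin n → ℂ) : ContDiff ℝ 2 fun s : Fin n → ℂ => (kap ε (x - s) : ℂ) := by
  apply Complex.ofRealCLM.contDiff.comp
  exact (kap_contDiff ε (m := 2)).comp (contDiff_const.sub contDiff_id)

lemma kapx_compact {ε : ℝ} (hε : 0 < ε) (x : Fin n → ℂ) : HasCompactSupport fun s : Fin n → ℂ => (kap ε (x - s) : ℂ) := by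
  have := (kap_compact (n := n) hε).comp_homeomorph ((Homeomorph.subLeft x))
  exact this.comp_left (g := fun r : ℝ => (r : ℂ)) (by simp)

lemma moll_mul (ε : ℝ) (f : (Fin n → ℂ) → ℂ) (x : Fin n → ℂ) : moll ε f x = ∫ t, (kap ε (x - t) : ℂ) * f t := by
  unfold moll; simp

lemma div_moll (hp : ∀ j, Continuous (p j)) {β : Fin n → (Fin n → ℂ) → ℂ} (hβ : ∀ j, MemLp (β j) 2 volume)
    {s : (Fin n → ℂ) → ℂ} (hs : MemLp s 2 volume) (hd : WDiv p β s) {χ : (Fin n → ℂ) → ℂ} (hχ : ContDiff ℝ 2 χ)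
    (hχc : HasCompactSupport χ) {ε : ℝ} (hε : 0 < ε) (x : Fin n → ℂ) :
    ∑ j, dd j (moll ε (fun t => χ t * β j t)) x =
      moll ε (fun t => χ t * s t + ∑ j, dd j χ t * β j t + ∑ j, χ t * p j t * β j t) x := by
  set K : (Fin n → ℂ) → ℂ := fun t => (kap ε (x - t) : ℂ) with hK
  have hKc : ContDiff ℝ 2 K := kapx_contDiff ε x
  have hKs : HasCompactSupport K := kapx_compact hε x
  have hχ1 := c1_of_c2 hχ
  have hK1 := c1_of_c2 hKc
  have a1 : ∀ j, Integrable fun t => (dd j K t * χ t) * β j t := fun j =>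
    int_mul_c (hβ j) ((dd_continuous hK1 j).mul hχ.continuous) hχc.mul_left
  have a2 : ∀ j, Integrable fun t => (K t * dd j χ t) * β j t := fun j =>
    int_mul_c (hβ j) (hK1.continuous.mul (dd_continuous hχ1 j)) hKs.mul_right
  have a3 : ∀ j, Integrable fun t => (p j t * (K t * χ t)) * β j t := fun j =>
    int_mul_c (hβ j) ((hp j).mul (hK1.continuous.mul hχ.continuous)) (hχc.mul_left.mul_left)
  have a4 : Integrable fun t => (K t * χ t) * s t :=
    int_mul_c hs (hK1.continuous.mul hχ.continuous) hχc.mul_left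
  have hη := hd (fun t => K t * χ t) (hKc.mul hχ) hχc.mul_left
  have e1 : ∀ t, (∑ j, (dd j (fun t => K t * χ t) t + p j t * (K t * χ t)) * β j t) =
      ∑ j, (dd j K t * χ t) * β j t + (∑ j, (K t * dd j χ t) * β j t + ∑ j, (p j t * (K t * χ t)) * β j t) := by
    intro t
    rw [← Finset.sum_add_distrib, ← Finset.sum_add_distrib]
    congr 1; ext j
    rw [dd_mul (hK1.differentiable (by norm_num) t) (hχ1.differentiable (by norm_num) t)]
    ring
  simp_rw [e1] at hη
  have a5 : Integrable fun t => ∑ j, (K t * dd j χ t) * β j t + ∑ j, (p j t * (K t * χ t)) * β j t :=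
    (integrable_finsetSum _ fun j _ => a2 j).add (integrable_finsetSum _ fun j _ => a3 j)
  rw [integral_add (integrable_finsetSum _ fun j _ => a1 j) a5, integral_finsetSum _ fun j _ => a1 j] at hη
  have e2 : ∀ j, dd j (moll ε (fun t => χ t * β j t)) x = - ∫ t, (dd j K t * χ t) * β j t := by
    intro j
    rw [dd_moll hε ((memLp_mul_c (hβ j) hχ.continuous hχc).locallyIntegrable (by norm_num))]
    congr 2; ext t; ring
  simp_rw [e2]
  rw [Finset.sum_neg_distrib, moll_mul]
  have e3 : ∀ t, K t * (χ t * s t + ∑ j, dd j χ t * β j t + ∑ j, χ t * p j t * β j t) =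
     (K t * χ t) * s t + (∑ j, (K t * dd j χ t) * β j t + ∑ j, (p j t * (K t * χ t)) * β j t) := by
    intro t
    rw [mul_add, mul_add, Finset.mul_sum, Finset.mul_sum, add_assoc, mul_assoc]
    congr 2
    · congr 1; ext j; ring
    · congr 1; ext j; ring
  change _ = ∫ t, K t * (χ t * s t + ∑ j, dd j χ t * β j t + ∑ j, χ t * p j t * β j t)
  simp_rw [e3]
  rw [integral_add a4 a5]
  linear_combination -hη

lemma curl_moll (hp : ∀ j, Continuous (p j)) {β : Fin n → (Fin n → ℂ) → ℂ} (hβ : ∀ j, MemLp (β j) 2 volume)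
    (hd : WCurl p β) {χ : (Fin n → ℂ) → ℂ} (hχ : ContDiff ℝ 2 χ)
    (hχc : HasCompactSupport χ) {ε : ℝ} (hε : 0 < ε) (x : Fin n → ℂ) (j k : Fin n) :
    dbar k (moll ε (fun t => χ t * β j t)) x - dbar j (moll ε (fun t => χ t * β k t)) x =
      moll ε (fun t => (dbar k χ t * β j t - dbar j χ t * β k t) +
        ((cj (p j t) * χ t) * β k t - (cj (p k t) * χ t) * β j t)) x := by
  set K : (Fin n → ℂ) → ℂ := fun t => (kap ε (x - t) : ℂ) with hK
  have hKc : ContDiff ℝ 2 K := kapx_contDiff ε x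
  have hKs : HasCompactSupport K := kapx_compact hε x
  have hχ1 := c1_of_c2 hχ
  have hK1 := c1_of_c2 hKc
  have a1 : ∀ j k, Integrable fun t => (dbar j K t * χ t) * β k t := fun j k =>
    int_mul_c (hβ k) ((dbar_continuous hK1 j).mul hχ.continuous) hχc.mul_left
  have a2 : ∀ j k, Integrable fun t => (K t * dbar j χ t) * β k t := fun j k =>
    int_mul_c (hβ k) (hK1.continuous.mul (dbar_continuous hχ1 j)) hKs.mul_right
  have a3 : ∀ j k, Integrable fun t => (cj (p j t) * (K t * χ t)) * β k t := fun j k =>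
    int_mul_c (hβ k) ((Complex.continuous_conj.comp (hp j)).mul (hK1.continuous.mul hχ.continuous)) (hχc.mul_left.mul_left)
  have hη := hd j k (fun t => K t * χ t) (hKc.mul hχ) hχc.mul_left
  have e0 : ∀ j t, dbar j (fun t => K t * χ t) t = K t * dbar j χ t + dbar j K t * χ t := fun j t =>
    dbar_mul (hK1.differentiable (by norm_num) t) (hχ1.differentiable (by norm_num) t) j
  have b : Integrable fun t => (dbar j K t * χ t) * β k t - (dbar k K t * χ t) * β j t := (a1 j k).sub (a1 k j)
  have c : Integrable fun t => K t * ((dbar k χ t * β j t - dbar j χ t * β k t) +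
        ((cj (p j t) * χ t) * β k t - (cj (p k t) * χ t) * β j t)) := by
    refine (((a2 k j).sub (a2 j k)).add ((a3 j k).sub (a3 k j))).congr (Filter.Eventually.of_forall fun t => ?_)
    simp only [Pi.add_apply, Pi.sub_apply]; ring
  have e1 : ∀ t, ((dbar j (fun t => K t * χ t) t - cj (p j t) * (K t * χ t)) * β k t -
      (dbar k (fun t => K t * χ t) t - cj (p k t) * (K t * χ t)) * β j t) =
      ((dbar j K t * χ t) * β k t - (dbar k K t * χ t) * β j t) - K t * ((dbar k χ t * β j t - dbar j χ t * β k t) +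
        ((cj (p j t) * χ t) * β k t - (cj (p k t) * χ t) * β j t)) := by
    intro t
    rw [e0, e0]; ring
  simp_rw [e1] at hη
  rw [integral_sub b c, integral_sub (a1 j k) (a1 k j)] at hη
  have e2 : ∀ j k, dbar k (moll ε (fun t => χ t * β j t)) x = - ∫ t, (dbar k K t * χ t) * β j t := by
    intro j k
    rw [dbar_moll hε ((memLp_mul_c (hβ j) hχ.continuous hχc).locallyIntegrable (by norm_num))]
    congr 2; ext t; ring
  rw [e2, e2, moll_mul]
  linear_combination hη
end SOC

namespace SOC
variable {n : ℕ}

local notation "cj" => starRingEnd ℂ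
variable {p : Fin n → (Fin n → ℂ) → ℂ}

lemma int_sum_cj {γ u : Fin n → (Fin n → ℂ) → ℂ} (hγ : ∀ j, Continuous (γ j)) (hγc : ∀ j, HasCompactSupport (γ j))
    (hu : ∀ j, MemLp (u j) 2 volume) :
    ∫ z, ∑ j, γ j z * cj (u j z) = ∑ j, ∫ z, γ j z * cj (u j z) := by
  rw [integral_finsetSum]
  intro j _
  have : MemLp (fun z => cj (u j z)) 2 volume :=
    (hu j).congr_norm (Complex.continuous_conj.comp_aestronglyMeasurable (hu j).1)
      (Filter.Eventually.of_forall fun z => by simp)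
  exact int_mul_c this (hγ j) (hγc j)

lemma est_cut (hp : ∀ j, ContDiff ℝ 1 (p j)) {γ : Fin n → (Fin n → ℂ) → ℂ} (hγ : ∀ j, Continuous (γ j))
    (hγc : ∀ j, HasCompactSupport (γ j))
    {G : (Fin n → ℂ) → ℝ} (hG : Continuous G) (hGc : HasCompactSupport G) (hG0 : ∀ z, 0 ≤ G z)
    (hL : ∀ z (b : Fin n → ℂ), 0 ≤ (∑ j, ∑ k, Lev p j k z * b j * cj (b k)).re)
    (hGL : ∀ z (b : Fin n → ℂ), ‖∑ j, γ j z * cj (b j)‖ ^ 2 ≤ G z * (∑ j, ∑ k, Lev p j k z * b j * cj (b k)).re)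
    {β : Fin n → (Fin n → ℂ) → ℂ} (hβ : ∀ j, MemLp (β j) 2 volume)
    {s : (Fin n → ℂ) → ℂ} (hs : MemLp s 2 volume) (hd : WDiv p β s) (hcu : WCurl p β)
    {χ : (Fin n → ℂ) → ℂ} (hχ : ContDiff ℝ 2 χ) {R : ℝ} (hχR : ∀ x ∉ Metric.closedBall (0 : Fin n → ℂ) R, χ x = 0) :
    ‖∑ j, ∫ z, γ j z * cj (χ z * β j z)‖ ^ 2 ≤ (∫ z, G z) *
      ((∫ z, ‖χ z * s z + ∑ j, dd j χ z * β j z‖ ^ 2) +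
        ∑ j, ∑ k, (1/2 : ℝ) * ∫ z, ‖dbar k χ z * β j z - dbar j χ z * β k z‖ ^ 2) := by
  have hp0 : ∀ j, Continuous (p j) := fun j => (hp j).continuous
  have hχc : HasCompactSupport χ := HasCompactSupport.intro (isCompact_closedBall 0 R) hχR
  have hχ1 := c1_of_c2 hχ
  have mb : ∀ j, MemLp (fun t => χ t * β j t) 2 volume := fun j => memLp_mul_c (hβ j) hχ.continuous hχc
  have cb : ∀ j, HasCompactSupport (fun t => χ t * β j t) := fun j => hχc.mul_right
  set u : ℕ → Fin n → (Fin n → ℂ) → ℂ := fun i j => moll (ee i) (fun t => χ t * β j t) with hu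
  have uL : ∀ j, L2T (fun i => u i j) (fun t => χ t * β j t) := fun j => L2T.moll (mb j) (cb j)
  have u2 : ∀ i j, ContDiff ℝ 2 (u i j) := fun i j =>
    moll_contDiff (m := 2) (ee_pos i) ((mb j).locallyIntegrable (by norm_num))
  have uc : ∀ i j, HasCompactSupport (u i j) := fun i j => moll_compact (ee_pos i) (cb j)
  have us : ∀ j i, ∀ x ∉ Metric.closedBall (0 : Fin n → ℂ) (R+1), u i j x = 0 := fun j i x hx =>
    moll_supp (ee_pos i) (ee_le i) (fun y hy => by rw [hχR y hy, zero_mul]) x hx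
  have hχR1 : ∀ x ∉ Metric.closedBall (0 : Fin n → ℂ) (R+1), χ x = 0 := fun x hx => hχR x fun h =>
    hx (Metric.closedBall_subset_closedBall (by linarith) h)
  have pL : ∀ j, L2T (fun i x => p j x * u i j x) (fun x => p j x * (χ x * β j x)) := fun j =>
    (uL j).mul_bdd (hp0 j) (isCompact_closedBall 0 (R+1)) (us j) (fun x hx => by rw [hχR1 x hx, zero_mul])
  have pL' : ∀ k j, L2T (fun i x => cj (p k x) * u i j x) (fun x => cj (p k x) * (χ x * β j x)) := fun k j =>
    (uL j).mul_bdd (Complex.continuous_conj.comp (hp0 k)) (isCompact_closedBall 0 (R+1)) (us j)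
      (fun x hx => by rw [hχR1 x hx, zero_mul])
  -- divergence
  have mh : MemLp (fun t => χ t * s t + ∑ j, dd j χ t * β j t + ∑ j, χ t * p j t * β j t) 2 volume := by
    refine ((memLp_mul_c hs hχ.continuous hχc).add (memLp_finset_sum _ fun j _ => ?_)).add
      (memLp_finset_sum _ fun j _ => ?_)
    · exact memLp_mul_c (hβ j) (dd_continuous hχ1 j) (dd_compact hχc j)
    · exact memLp_mul_c (hβ j) (hχ.continuous.mul (hp0 j)) hχc.mul_right
  have ch : HasCompactSupport (fun t => χ t * s t + ∑ j, dd j χ t * β j t + ∑ j, χ t * p j t * β j t) := by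
    refine (HasCompactSupport.add hχc.mul_right (compact_sum fun j => ?_)).add (compact_sum fun j => ?_)
    · exact (dd_compact hχc j).mul_right
    · exact (hχc.mul_right).mul_right
  have dL : L2T (fun i x => ∑ j, Dp p j (u i j) x) (fun z => χ z * s z + ∑ j, dd j χ z * β j z) := by
    refine ((L2T.moll mh ch).sub (L2T.sum Finset.univ pL)).congr (fun i x => ?_) (fun x => ?_)
    · rw [← div_moll hp0 hβ hs hd hχ hχc (ee_pos i), ← Finset.sum_sub_distrib]; rfl
    · have : ∑ j, χ x * p j x * β j x = ∑ j, p j x * (χ x * β j x) := by congr 1; ext j; ring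
      rw [this]; ring
  have cL : ∀ j k, L2T (fun i x => Db p k (u i j) x - Db p j (u i k) x)
      (fun z => dbar k χ z * β j z - dbar j χ z * β k z) := by
    intro j k
    have m1 : MemLp (fun t => (dbar k χ t * β j t - dbar j χ t * β k t) +
        ((cj (p j t) * χ t) * β k t - (cj (p k t) * χ t) * β j t)) 2 volume :=
      ((memLp_mul_c (hβ j) (dbar_continuous hχ1 k) (dbar_compact hχc k)).sub
        (memLp_mul_c (hβ k) (dbar_continuous hχ1 j) (dbar_compact hχc j))).add
      ((memLp_mul_c (hβ k) ((Complex.continuous_conj.comp (hp0 j)).mul hχ.continuous) hχc.mul_left).sub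
       (memLp_mul_c (hβ j) ((Complex.continuous_conj.comp (hp0 k)).mul hχ.continuous) hχc.mul_left))
    have c1 : HasCompactSupport (fun t => (dbar k χ t * β j t - dbar j χ t * β k t) +
        ((cj (p j t) * χ t) * β k t - (cj (p k t) * χ t) * β j t)) := by
      apply HasCompactSupport.intro (isCompact_closedBall 0 R)
      intro x hx
      have h1 : ∀ k, dbar k χ x = 0 := by
        intro k
        have : χ =ᶠ[nhds x] fun _ => 0 := by
          filter_upwards [Metric.isClosed_closedBall.isOpen_compl.mem_nhds hx] with y hy
          exact hχR y hy
        simp [dbar, this.fderiv_eq]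
      rw [h1, h1, hχR x hx]; simp
    refine ((L2T.moll m1 c1).add ((pL' k j).sub (pL' j k))).congr (fun i x => ?_) (fun x => ?_)
    · rw [← curl_moll hp0 hβ hcu hχ hχc (ee_pos i)]; simp only [Db, hu]; ring
    · ring
  have gm : ∀ j, MemLp (γ j) 2 volume := fun j => (hγ j).memLp_of_hasCompactSupport (hγc j)
  have t1 : Tendsto (fun i => ‖∑ j, ∫ z, γ j z * cj (u i j z)‖ ^ 2) atTop
      (nhds (‖∑ j, ∫ z, γ j z * cj (χ z * β j z)‖ ^ 2)) := by
    refine ((tendsto_finset_sum _ fun j _ => ?_).norm).pow 2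
    exact (L2T.const (gm j)).inner (uL j)
  have t2 := (dL.sq).add (tendsto_finset_sum Finset.univ fun j _ => tendsto_finset_sum Finset.univ fun k _ =>
    ((cL j k).sq).const_mul (1/2 : ℝ))
  refine le_of_tendsto_of_tendsto' t1 (t2.const_mul (∫ z, G z)) fun i => ?_
  rw [← int_sum_cj hγ hγc fun j => (uL j).mem i]
  exact est_test hp (u2 i) (uc i) hγ hG hGc hG0 hL hGL

/-- cutoff -/
noncomputable def cut (z : Fin n → ℂ) : ℂ := (Real.smoothTransition (2 - qq z) : ℂ)
lemma cut_contDiff {m : ℕ∞} : ContDiff ℝ m (cut (n := n)) := by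
  apply Complex.ofRealCLM.contDiff.comp
  exact Real.smoothTransition.contDiff.comp (contDiff_const.sub (qq_contDiff))
lemma cut_zero {z : Fin n → ℂ} (hz : 2 ≤ ‖z‖) : cut z = 0 := by
  have := sq_norm_le_qq z
  rw [cut, Real.smoothTransition.zero_of_nonpos (by nlinarith)]; simp
lemma cut_one {z : Fin n → ℂ} (hz : qq z ≤ 1) : cut z = 1 := by
  rw [cut, Real.smoothTransition.one_of_one_le (by linarith)]; simp
lemma cut_norm (z : Fin n → ℂ) : ‖cut z‖ ≤ 1 := by
  rw [cut, Complex.norm_real, Real.norm_eq_abs, abs_of_nonneg (Real.smoothTransition.nonneg _)]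
  exact Real.smoothTransition.le_one _

noncomputable def cutn (i : ℕ) (z : Fin n → ℂ) : ℂ := cut (ee i • z)
lemma cutn_contDiff {m : ℕ∞} (i : ℕ) : ContDiff ℝ m (cutn (n := n) i) :=
  cut_contDiff.comp (contDiff_id.const_smul (ee i))
lemma fderiv_cutn (i : ℕ) (z v : Fin n → ℂ) : fderiv ℝ (cutn i) z v = ee i * fderiv ℝ cut (ee i • z) v := by
  have h : HasFDerivAt (fun z : Fin n → ℂ => ee i • z) (ee i • ContinuousLinearMap.id ℝ (Fin n → ℂ)) z :=
    (hasFDerivAt_id z).const_smul (ee i)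
  have h2 := ((cut_contDiff (n := n) (m := 1)).differentiable (by norm_num) (ee i • z)).hasFDerivAt.comp z h
  have h3 : fderiv ℝ (cutn i) z = _ := h2.fderiv
  rw [h3]; simp

lemma cut_compact : HasCompactSupport (cut (n := n)) := by
  apply HasCompactSupport.intro (isCompact_closedBall 0 2)
  intro z hz
  apply cut_zero
  simp at hz; exact hz.le

lemma dd_cutn (i : ℕ) (z : Fin n → ℂ) (j : Fin n) : dd j (cutn i) z = ee i * dd j cut (ee i • z) := by
  simp only [dd, fderiv_cutn]; ring
lemma dbar_cutn (i : ℕ) (z : Fin n → ℂ) (j : Fin n) : dbar j (cutn i) z = ee i * dbar j cut (ee i • z) := by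
  simp only [dbar, fderiv_cutn]; ring

lemma cutn_L2 {f : (Fin n → ℂ) → ℂ} (hf : MemLp f 2 volume) : L2T (fun i x => cutn i x * f x) f := by
  refine (L2T.dom hf (c := cutn) (c₀ := 1) (fun j => (cutn_contDiff (m := 0) j).continuous) (C := 2) ?_ ?_).congr
    (fun j x => mul_comm _ _) (fun x => mul_one _)
  · intro j x
    refine (norm_sub_le _ _).trans ?_
    have := cut_norm (ee j • x)
    simp [cutn]; linarith
  · intro x
    have h1 : Tendsto (fun j => qq (ee j • x)) atTop (nhds (qq ((0:ℝ) • x))) :=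
      (qq_continuous.tendsto _).comp (ee_tendsto.smul_const x)
    have h2 : qq ((0:ℝ) • x) < 1 := by simp [qq]
    refine tendsto_const_nhds.congr' ?_
    filter_upwards [h1.eventually (gt_mem_nhds h2)] with j hj
    exact (cut_one hj.le).symm

lemma cutd_L2 {f c : (Fin n → ℂ) → ℂ} (hf : MemLp f 2 volume) (hc : Continuous c) (hcc : HasCompactSupport c) :
    L2T (fun i x => (ee i * c (ee i • x)) * f x) (fun _ => 0) := by
  obtain ⟨C, hC⟩ := hcc.exists_bound_of_continuous hc
  have hb : ∀ j x, ‖(ee j : ℂ) * c (ee j • x)‖ ≤ ee j * C := by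
    intro j x
    rw [norm_mul, Complex.norm_real, Real.norm_eq_abs, abs_of_pos (ee_pos j)]
    have := (ee_pos j).le
    gcongr
    exact hC _
  refine (L2T.dom hf (c := fun i x => (ee i * c (ee i • x))) (c₀ := 0) (fun j => ?_) (C := C) ?_ ?_).congr
    (fun j x => mul_comm _ _) (fun x => mul_zero _)
  · exact continuous_const.mul (hc.comp (continuous_const_smul (ee j)))
  · intro j x
    have hC0 : 0 ≤ C := (norm_nonneg _).trans (hC x)
    rw [sub_zero]
    exact (hb j x).trans (mul_le_of_le_one_left hC0 (ee_le j))
  · intro x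
    apply squeeze_zero_norm (fun j => hb j x)
    simpa using ee_tendsto.mul_const C

theorem core_est (hp : ∀ j, ContDiff ℝ 1 (p j)) {γ : Fin n → (Fin n → ℂ) → ℂ} (hγ : ∀ j, Continuous (γ j))
    (hγc : ∀ j, HasCompactSupport (γ j))
    {G : (Fin n → ℂ) → ℝ} (hG : Continuous G) (hGc : HasCompactSupport G) (hG0 : ∀ z, 0 ≤ G z)
    (hL : ∀ z (b : Fin n → ℂ), 0 ≤ (∑ j, ∑ k, Lev p j k z * b j * cj (b k)).re)
    (hGL : ∀ z (b : Fin n → ℂ), ‖∑ j, γ j z * cj (b j)‖ ^ 2 ≤ G z * (∑ j, ∑ k, Lev p j k z * b j * cj (b k)).re)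
    {β : Fin n → (Fin n → ℂ) → ℂ} (hβ : ∀ j, MemLp (β j) 2 volume)
    {s : (Fin n → ℂ) → ℂ} (hs : MemLp s 2 volume) (hd : WDiv p β s) (hcu : WCurl p β) :
    ‖∑ j, ∫ z, γ j z * cj (β j z)‖ ^ 2 ≤ (∫ z, G z) * ∫ z, ‖s z‖ ^ 2 := by
  have gm : ∀ j, MemLp (γ j) 2 volume := fun j => (hγ j).memLp_of_hasCompactSupport (hγc j)
  have hc1 : ContDiff ℝ 1 (cut (n := n)) := cut_contDiff
  have t1 : Tendsto (fun i => ‖∑ j, ∫ z, γ j z * cj (cutn i z * β j z)‖ ^ 2) atTop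
      (nhds (‖∑ j, ∫ z, γ j z * cj (β j z)‖ ^ 2)) := by
    refine ((tendsto_finset_sum _ fun j _ => ?_).norm).pow 2
    exact (L2T.const (gm j)).inner (cutn_L2 (hβ j))
  have a1 : ∀ j k, L2T (fun i z => dd j (cutn i) z * β k z) (fun _ => 0) := fun j k =>
    (cutd_L2 (hβ k) (dd_continuous hc1 j) (dd_compact cut_compact j)).congr
      (fun i x => by rw [dd_cutn]) (fun _ => rfl)
  have a2 : ∀ j k, L2T (fun i z => dbar j (cutn i) z * β k z) (fun _ => 0) := fun j k =>
    (cutd_L2 (hβ k) (dbar_continuous hc1 j) (dbar_compact cut_compact j)).congr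
      (fun i x => by rw [dbar_cutn]) (fun _ => rfl)
  have dL : L2T (fun i z => cutn i z * s z + ∑ j, dd j (cutn i) z * β j z) s :=
    ((cutn_L2 hs).add (L2T.sum Finset.univ fun j => a1 j j)).congr (fun _ _ => rfl) (fun x => by simp)
  have cL : ∀ j k, L2T (fun i z => dbar k (cutn i) z * β j z - dbar j (cutn i) z * β k z) (fun _ => 0) := fun j k =>
    ((a2 k j).sub (a2 j k)).congr (fun _ _ => rfl) (fun x => by simp)
  have t2 := (dL.sq).add (tendsto_finset_sum Finset.univ fun j _ => tendsto_finset_sum Finset.univ fun k _ =>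
    ((cL j k).sq).const_mul (1/2 : ℝ))
  have t3 := t2.const_mul (∫ z, G z)
  have t4 : (∫ z, G z) * ((∫ x, ‖s x‖ ^ 2) + ∑ j : Fin n, ∑ k : Fin n, (1/2 : ℝ) * ∫ x : Fin n → ℂ, ‖(0:ℂ)‖ ^ 2) =
    (∫ z, G z) * ∫ x, ‖s x‖ ^ 2 := by simp
  rw [t4] at t3
  refine le_of_tendsto_of_tendsto' t1 t3 fun i => ?_
  refine est_cut hp hγ hγc hG hGc hG0 hL hGL hβ hs hd hcu (cutn_contDiff (m := 2) i) (R := 2 / ee i) ?_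
  intro x hx
  apply cut_zero
  rw [norm_smul, Real.norm_eq_abs, abs_of_pos (ee_pos i)]
  simp only [Metric.mem_closedBall, dist_zero_right, not_le] at hx
  rw [div_lt_iff₀ (ee_pos i)] at hx
  linarith
end SOC

namespace SOC
variable {n : ℕ}

local notation "cj" => starRingEnd ℂ

lemma proj_abs {H : Type*} [NormedAddCommGroup H] [InnerProductSpace ℂ H] [CompleteSpace H]
    (R : Submodule ℂ H) (w : H) {K : ℝ} (hK0 : 0 ≤ K) (hK : ∀ s ∈ R, ‖inner ℂ w s‖ ≤ K * ‖s‖) :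
    ∃ f : H, (∀ s ∈ R, inner ℂ s f = 0) ∧ ‖w - f‖ ≤ K ∧ ‖f‖ ≤ ‖w‖ := by
  set Rc := R.topologicalClosure with hRc
  have : CompleteSpace Rc := R.isClosed_topologicalClosure.completeSpace_coe
  set u := Rc.starProjection w with hu
  have huR : u ∈ Rc := by rw [hu, Submodule.starProjection_apply]; exact Subtype.coe_prop _
  have horth : ∀ s ∈ Rc, inner ℂ s (w - u) = 0 := fun s hs =>
    (Submodule.mem_orthogonal _ _).mp (Submodule.sub_starProjection_mem_orthogonal w) s hs
  have hK' : ∀ s ∈ Rc, ‖inner ℂ w s‖ ≤ K * ‖s‖ := by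
    have hcl : IsClosed {s : H | ‖inner ℂ w s‖ ≤ K * ‖s‖} :=
      isClosed_le (by fun_prop) (by fun_prop)
    intro s hs
    exact (closure_minimal (fun s hs => hK s hs) hcl) hs
  refine ⟨w - u, fun s hs => horth s (R.le_topologicalClosure hs), ?_, ?_⟩
  · rw [_root_.sub_sub_cancel]
    have h1 := hK' u huR
    have h2 : inner ℂ w u = inner ℂ u u := by
      have h3 := horth u huR
      rw [inner_sub_right, sub_eq_zero] at h3
      rw [← inner_conj_symm, h3, inner_conj_symm]
    rw [h2, inner_self_eq_norm_sq_to_K, norm_pow] at h1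
    simp only [RCLike.norm_ofReal, abs_norm] at h1
    by_contra hlt
    push Not at hlt
    nlinarith
  · have h1 := Submodule.norm_sq_eq_add_norm_sq_starProjection w Rc
    have h2 : Rcᗮ.starProjection w = w - u := by
      rw [Submodule.starProjection_orthogonal]; rfl
    rw [h2] at h1
    apply abs_le_of_sq_le_sq' _ (norm_nonneg _) |>.2
    nlinarith [sq_nonneg ‖Rc.starProjection w‖]

lemma proj_W {H : Type*} [NormedAddCommGroup H] [InnerProductSpace ℂ H] [CompleteSpace H]
    (V : Submodule ℂ H) (b : H) : ∃ b1 ∈ Vᗮ, ∀ x ∈ Vᗮ, inner ℂ x b1 = inner ℂ x b := by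
  have : CompleteSpace Vᗮ := (Submodule.isClosed_orthogonal V).completeSpace_coe
  refine ⟨Vᗮ.starProjection b, ?_, ?_⟩
  · rw [Submodule.starProjection_apply]; exact Subtype.coe_prop _
  · intro x hx
    rw [← Submodule.inner_starProjection_left_eq_right, Submodule.starProjection_eq_self_iff.mpr hx]

noncomputable abbrev H1 (n : ℕ) := Lp ℂ 2 (volume : Measure (Fin n → ℂ))
noncomputable abbrev H2 (n : ℕ) := PiLp 2 (fun _ : Fin n => H1 n)

lemma inner_tl {f : (Fin n → ℂ) → ℂ} (hf : MemLp f 2 volume) (x : H1 n) :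
    inner ℂ (hf.toLp f) x = ∫ z, x z * cj (f z) := by
  rw [L2.inner_def]
  apply integral_congr_ae
  filter_upwards [hf.coeFn_toLp] with z h1
  rw [h1]; rfl

lemma inner_tl2 {f g : (Fin n → ℂ) → ℂ} (hf : MemLp f 2 volume) (hg : MemLp g 2 volume) :
    inner ℂ (hf.toLp f) (hg.toLp g) = ∫ z, g z * cj (f z) := by
  rw [inner_tl]
  apply integral_congr_ae
  filter_upwards [hg.coeFn_toLp] with z h1
  rw [h1]

lemma norm_sq_lp (x : H1 n) : ‖x‖ ^ 2 = ∫ z, ‖x z‖ ^ 2 := by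
  have h := inner_self_eq_norm_sq_to_K (𝕜 := ℂ) x
  rw [L2.inner_def] at h
  have e : ∀ z, inner ℂ (x z) (x z) = ((‖x z‖ ^ 2 : ℝ) : ℂ) := by
    intro z; rw [inner_self_eq_norm_sq_to_K]; simp
  simp_rw [e] at h
  rw [integral_complex_ofReal] at h
  have h' : ((‖x‖ ^ 2 : ℝ) : ℂ) = ((∫ z, ‖x z‖ ^ 2 : ℝ) : ℂ) := by rw [h]; simp
  exact_mod_cast h'

lemma sum_single (k : Fin n) (a : H1 n) (x : Fin n → H1 n) :
    ∑ i, inner ℂ ((Pi.single k a : Fin n → H1 n) i) (x i) = inner ℂ a (x k) := by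
  rw [Finset.sum_eq_single k]
  · simp
  · intro b _ hb; simp [Pi.single_eq_of_ne hb]
  · simp

lemma dbar_dbar_comm {f : (Fin n → ℂ) → ℂ} (hf : ContDiff ℝ 2 f) (z : Fin n → ℂ) (j k : Fin n) :
    dbar j (dbar k f) z = dbar k (dbar j f) z := by
  rw [dbar, dbar, fderiv_dbar hf, fderiv_dbar hf, fderiv_dbar hf, fderiv_dbar hf,
    snd_symm hf z (Pi.single k 1) (Pi.single j 1), snd_symm hf z (Pi.single k 1) (Pi.single j I),
    snd_symm hf z (Pi.single k I) (Pi.single j 1), snd_symm hf z (Pi.single k I) (Pi.single j I)]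
  ring

variable {p : Fin n → (Fin n → ℂ) → ℂ}

lemma Db_comm (hp : ∀ j, ContDiff ℝ 1 (p j)) (hsym : ∀ j k z, dd j (p k) z = dd k (p j) z)
    {f : (Fin n → ℂ) → ℂ} (hf : ContDiff ℝ 2 f) (j k : Fin n)
    (z : Fin n → ℂ) : Db p k (Db p j f) z = Db p j (Db p k f) z := by
  have h1 : ∀ {g : (Fin n → ℂ) → ℂ}, ContDiff ℝ 1 g → DifferentiableAt ℝ g z :=
    fun hg => hg.differentiable (by norm_num) z
  have hfd := h1 (c1_of_c2 hf)
  have e2 : ∀ j k, dbar j (Db p k f) z = dbar j (dbar k f) z + (cj (p k z) * dbar j f z + cj (dd j (p k) z) * f z) := by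
    intro j k
    unfold Db
    rw [dbar_add (h1 (dbar_c1 hf k)) (h1 ((cj_contDiff (hp k)).mul (c1_of_c2 hf))),
      dbar_mul (h1 (cj_contDiff (hp k))) hfd, dbar_cj (h1 (hp k))]
  rw [Db, e2, Db, Db, e2, Db, dbar_dbar_comm hf, hsym j k]
  ring

/-- test functions -/
def Tst (f : (Fin n → ℂ) → ℂ) : Prop := ContDiff ℝ 2 f ∧ HasCompactSupport f

lemma Tst.dp (hp : ∀ j, ContDiff ℝ 1 (p j)) {f : (Fin n → ℂ) → ℂ} (hf : Tst f) (j : Fin n) :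
    MemLp (Dp p j f) 2 volume :=
  (Dp_c1 hp hf.1 j).continuous.memLp_of_hasCompactSupport (Dp_compact hf.2 j)
lemma Tst.db (hp : ∀ j, ContDiff ℝ 1 (p j)) {f : (Fin n → ℂ) → ℂ} (hf : Tst f) (j : Fin n) :
    MemLp (Db p j f) 2 volume :=
  (Db_c1 hp hf.1 j).continuous.memLp_of_hasCompactSupport (Db_compact hf.2 j)
lemma Tst.mem {f : (Fin n → ℂ) → ℂ} (hf : Tst f) : MemLp f 2 volume :=
  hf.1.continuous.memLp_of_hasCompactSupport hf.2
lemma Tst.cj' {f : (Fin n → ℂ) → ℂ} (hf : Tst f) : Tst fun z => cj (f z) := ⟨cj_contDiff hf.1, cj_compact hf.2⟩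

lemma cj_Dp {f : (Fin n → ℂ) → ℂ} (hf : Tst f) (j : Fin n) (z : Fin n → ℂ) :
    cj (Dp p j (fun z => cj (f z)) z) = dbar j f z - cj (p j z) * f z := by
  rw [Dp, dd_cj (hf.1.differentiable (by norm_num) z)]; simp
lemma cj_Db {f : (Fin n → ℂ) → ℂ} (hf : Tst f) (j : Fin n) (z : Fin n → ℂ) :
    cj (Db p j (fun z => cj (f z)) z) = dd j f z + p j z * f z := by
  rw [Db, dbar_cj (hf.1.differentiable (by norm_num) z)]; simp

def Cset (hp : ∀ j, ContDiff ℝ 1 (p j)) : Set (H2 n) :=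
  {x | ∃ (j k : Fin n) (η : (Fin n → ℂ) → ℂ) (hη : Tst η),
    x = WithLp.toLp 2 (Pi.single k ((hη.dp hp j).toLp _) - Pi.single j ((hη.dp hp k).toLp _))}

lemma inner_cset (hp : ∀ j, ContDiff ℝ 1 (p j)) (j k : Fin n) {η : (Fin n → ℂ) → ℂ} (hη : Tst η) (x : H2 n) :
    inner ℂ (WithLp.toLp 2 (Pi.single k ((hη.dp hp j).toLp _) - Pi.single j ((hη.dp hp k).toLp _)) : H2 n) x =
      (∫ z, x k z * cj (Dp p j η z)) - ∫ z, x j z * cj (Dp p k η z) := by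
  rw [PiLp.inner_apply]
  simp only [Pi.sub_apply, inner_sub_left, Finset.sum_sub_distrib]
  rw [sum_single, sum_single, inner_tl, inner_tl]

lemma mem_W (hp : ∀ j, ContDiff ℝ 1 (p j)) (x : H2 n) :
    x ∈ (Submodule.span ℂ (Cset hp))ᗮ ↔ ∀ c ∈ Cset hp, inner ℂ c x = 0 := by
  rw [Submodule.mem_orthogonal]
  constructor
  · intro h c hc; exact h c (Submodule.subset_span hc)
  · intro h u hu
    induction hu using Submodule.span_induction with
    | mem x hx => exact h x hx
    | zero => simp
    | add x y _ _ hx hy => rw [inner_add_left, hx, hy, add_zero]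
    | smul a x _ hx => rw [inner_smul_left, hx, mul_zero]

lemma mem_W' (hp : ∀ j, ContDiff ℝ 1 (p j)) (x : H2 n) :
    x ∈ (Submodule.span ℂ (Cset hp))ᗮ ↔ ∀ j k, ∀ η : (Fin n → ℂ) → ℂ, Tst η →
      (∫ z, x k z * cj (Dp p j η z)) - ∫ z, x j z * cj (Dp p k η z) = 0 := by
  rw [mem_W]
  constructor
  · intro h j k η hη
    rw [← inner_cset hp j k hη]
    exact h _ ⟨j, k, η, hη, rfl⟩
  · rintro h c ⟨j, k, η, hη, rfl⟩
    rw [inner_cset hp j k hη]; exact h j k η hη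

lemma wcurl_of_W (hp : ∀ j, ContDiff ℝ 1 (p j)) (x : H2 n)
    (hx : x ∈ (Submodule.span ℂ (Cset hp))ᗮ) : WCurl p (fun j z => x j z) := by
  rw [mem_W'] at hx
  intro j k η h1 h2
  have hη : Tst η := ⟨h1, h2⟩
  have := hx j k _ hη.cj'
  have i1 : ∀ j k, Integrable fun z => (dbar j η z - cj (p j z) * η z) * x k z := fun j k =>
    int_mul_c (Lp.memLp (x k)) ((dbar_continuous (c1_of_c2 h1) j).sub
      ((Complex.continuous_conj.comp (hp j).continuous).mul h1.continuous))
      ((dbar_compact h2 j).sub (h2.mul_left (f := fun z => cj (p j z))))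
  rw [integral_sub (i1 j k) (i1 k j), ← this]
  simp_rw [cj_Dp hη, mul_comm]

lemma db_mem_W (hp : ∀ j, ContDiff ℝ 1 (p j)) (hsym : ∀ j k z, dd j (p k) z = dd k (p j) z)
    {f : (Fin n → ℂ) → ℂ} (hf : Tst f) :
    (WithLp.toLp 2 (fun j => (hf.db hp j).toLp _) : H2 n) ∈ (Submodule.span ℂ (Cset hp))ᗮ := by
  rw [mem_W']
  intro j k η hη
  have e : ∀ j k, ∫ z, ((hf.db hp k).toLp _ : H1 n) z * cj (Dp p j η z) = - ∫ z, Db p j (Db p k f) z * cj (η z) := by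
    intro j k
    rw [← ibp_D' (fun j => (hp j).continuous) (c1_of_c2 hη.1) (Db_c1 hp hf.1 k) hη.2]
    apply integral_congr_ae
    filter_upwards [(hf.db hp k).coeFn_toLp] with z h1
    rw [h1]
  change (∫ z, ((hf.db hp k).toLp _ : H1 n) z * cj (Dp p j η z)) -
    (∫ z, ((hf.db hp j).toLp _ : H1 n) z * cj (Dp p k η z)) = 0
  rw [e, e]
  simp_rw [Db_comm hp hsym hf.1 k j]
  ring

def Rsub (hp : ∀ j, ContDiff ℝ 1 (p j)) : Submodule ℂ (H1 n) where
  carrier := {x | ∃ β : Fin n → (Fin n → ℂ) → ℂ, ∃ hβ : ∀ j, Tst (β j), x = ∑ j, ((hβ j).dp hp j).toLp _}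
  zero_mem' := by
    have h0 : ∀ j : Fin n, Tst ((fun _ _ => 0 : Fin n → (Fin n → ℂ) → ℂ) j) := fun j =>
      ⟨contDiff_const, HasCompactSupport.zero⟩
    refine ⟨fun _ _ => 0, h0, ?_⟩
    symm
    apply Finset.sum_eq_zero
    intro j _
    rw [← MemLp.toLp_zero (MemLp.zero' (p := 2) (μ := (volume : Measure (Fin n → ℂ))) (ε := ℂ))]
    congr 1; ext z; simp [Dp, dd]
  add_mem' := by
    rintro x y ⟨β, hβ, rfl⟩ ⟨β', hβ', rfl⟩
    refine ⟨fun j z => β j z + β' j z, fun j => ⟨(hβ j).1.add (hβ' j).1, (hβ j).2.add (hβ' j).2⟩, ?_⟩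
    rw [← Finset.sum_add_distrib]
    congr 1; ext1 j
    rw [← MemLp.toLp_add]
    congr 1; ext z
    simp only [Dp, Pi.add_apply]
    rw [dd_add ((hβ j).1.differentiable (by norm_num) z) ((hβ' j).1.differentiable (by norm_num) z)]; ring
  smul_mem' := by
    rintro c x ⟨β, hβ, rfl⟩
    refine ⟨fun j z => c * β j z, fun j => ⟨contDiff_const.mul (hβ j).1, (hβ j).2.mul_left⟩, ?_⟩
    rw [Finset.smul_sum]
    congr 1; ext1 j
    rw [← MemLp.toLp_const_smul]
    congr 1; ext z
    simp only [Dp, Pi.smul_apply, smul_eq_mul]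
    rw [dd_mul (differentiableAt_const c) ((hβ j).1.differentiable (by norm_num) z)]
    simp [dd]; ring

theorem horm (hp : ∀ j, ContDiff ℝ 1 (p j)) (hsym : ∀ j k z, dd j (p k) z = dd k (p j) z)
    {w : (Fin n → ℂ) → ℂ} (hw : Tst w)
    {G : (Fin n → ℂ) → ℝ} (hG : Continuous G) (hGc : HasCompactSupport G) (hG0 : ∀ z, 0 ≤ G z)
    (hL : ∀ z (b : Fin n → ℂ), 0 ≤ (∑ j, ∑ k, Lev p j k z * b j * cj (b k)).re)
    (hGL : ∀ z (b : Fin n → ℂ), ‖∑ j, Db p j w z * cj (b j)‖ ^ 2 ≤ G z * (∑ j, ∑ k, Lev p j k z * b j * cj (b k)).re) :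
    ∃ f : (Fin n → ℂ) → ℂ, MemLp f 2 volume ∧ (∀ j, ∀ η : (Fin n → ℂ) → ℂ, Tst η → ∫ z, f z * cj (Dp p j η z) = 0) ∧
      ∫ z, ‖w z - f z‖ ^ 2 ≤ ∫ z, G z ∧ ∫ z, ‖f z‖ ^ 2 ≤ ∫ z, ‖w z‖ ^ 2 := by
  have hp0 : ∀ j, Continuous (p j) := fun j => (hp j).continuous
  set W := (Submodule.span ℂ (Cset hp))ᗮ with hW
  have hGi : 0 ≤ ∫ z, G z := integral_nonneg hG0
  set w' : H1 n := hw.mem.toLp w with hw'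
  have key : ∀ s ∈ Rsub hp, ‖inner ℂ w' s‖ ≤ Real.sqrt (∫ z, G z) * ‖s‖ := by
    rintro s ⟨β, hβ, hs⟩
    set b : H2 n := WithLp.toLp 2 (fun j => (hβ j).mem.toLp (β j)) with hb
    set g : H2 n := WithLp.toLp 2 (fun j => (hw.db hp j).toLp _) with hg
    have hgW : g ∈ W := db_mem_W hp hsym hw
    obtain ⟨b1, hb1W, hib⟩ := proj_W (Submodule.span ℂ (Cset hp)) b
    -- general pairing
    have pair : ∀ {f : (Fin n → ℂ) → ℂ} (hf : Tst f), inner ℂ (hf.mem.toLp f) s =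
        - inner ℂ (WithLp.toLp 2 (fun j => (hf.db hp j).toLp _) : H2 n) b := by
      intro f hf
      rw [hs, inner_sum, PiLp.inner_apply, ← Finset.sum_neg_distrib]
      congr 1; ext1 j
      rw [inner_tl2]
      change _ = - inner ℂ ((hf.db hp j).toLp _) ((hβ j).mem.toLp (β j))
      rw [inner_tl2, ibp_D hp0 (c1_of_c2 (hβ j).1) (c1_of_c2 hf.1) (hβ j).2]
    have hcurl := wcurl_of_W hp b1 hb1W
    have hdiv : WDiv p (fun j z => b1 j z) (fun z => s z) := by
      intro η h1 h2
      have hη : Tst η := ⟨h1, h2⟩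
      have e1 := pair hη.cj'
      rw [← hib _ (db_mem_W hp hsym hη.cj'), inner_tl, PiLp.inner_apply] at e1
      simp only [inner_tl, cj_Db hη, Complex.conj_conj] at e1
      rw [integral_finsetSum]
      · simp_rw [mul_comm (η _)]
        rw [e1, neg_neg]
        congr 1; ext1 j; congr 1; ext1 z; ring
      · intro j _
        exact int_mul_c (Lp.memLp (b1 j)) ((dd_continuous (c1_of_c2 h1) j).add ((hp0 j).mul h1.continuous))
          ((dd_compact h2 j).add h2.mul_left)
    have est := core_est hp (γ := fun j => Db p j w) (fun j => (Db_c1 hp hw.1 j).continuous)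
      (fun j => Db_compact hw.2 j) hG hGc hG0 hL hGL (fun j => Lp.memLp (b1 j)) (Lp.memLp s) hdiv hcurl
    have e2 : ‖inner ℂ w' s‖ = ‖∑ j, ∫ z, Db p j w z * cj (b1 j z)‖ := by
      rw [hw', pair hw, ← hib _ hgW, norm_neg, PiLp.inner_apply, ← Complex.norm_conj, map_sum]
      congr 1; congr 1; ext1 j
      rw [inner_tl, ← integral_conj]
      congr 1; ext1 z; simp [mul_comm]
    rw [← e2, ← norm_sq_lp] at est
    apply abs_le_of_sq_le_sq' _ (by positivity) |>.2
    rw [mul_pow, Real.sq_sqrt hGi]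
    exact est
  obtain ⟨f, hf1, hf2, hf3⟩ := proj_abs (Rsub hp) w' (Real.sqrt_nonneg _) key
  refine ⟨f, Lp.memLp f, ?_, ?_, ?_⟩
  · intro j η hη
    rw [← inner_tl (hη.dp hp j)]
    apply hf1
    have h0 : ∀ i, Tst ((Pi.single j η : Fin n → (Fin n → ℂ) → ℂ) i) := by
      intro i
      by_cases h : i = j
      · subst h; simpa using hη
      · rw [Pi.single_eq_of_ne h]; exact ⟨contDiff_const, HasCompactSupport.zero⟩
    refine ⟨Pi.single j η, h0, ?_⟩
    symm
    rw [Finset.sum_eq_single j]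
    · congr 1; simp
    · intro i _ hi
      rw [← MemLp.toLp_zero (MemLp.zero' (p := 2) (μ := (volume : Measure (Fin n → ℂ))) (ε := ℂ))]
      congr 1; ext z
      rw [Pi.single_eq_of_ne hi]
      simp [Dp, dd]
    · simp
  · have h1 : ‖w' - f‖ ^ 2 ≤ ∫ z, G z := by
      have := pow_le_pow_left₀ (norm_nonneg _) hf2 2
      rwa [Real.sq_sqrt hGi] at this
    rw [norm_sq_lp] at h1
    refine le_trans (le_of_eq ?_) h1
    apply integral_congr_ae
    filter_upwards [hw.mem.coeFn_toLp, Lp.coeFn_sub w' f] with z e1 e2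
    rw [e2, Pi.sub_apply, e1]
  · have h1 := pow_le_pow_left₀ (norm_nonneg _) hf3 2
    rw [norm_sq_lp, norm_sq_lp] at h1
    refine h1.trans (le_of_eq ?_)
    apply integral_congr_ae
    filter_upwards [hw.mem.coeFn_toLp] with z e1
    rw [e1]
end SOC

namespace SOC
variable {n : ℕ}

local notation "cj" => starRingEnd ℂ

/-- complexification of a real function -/
def rc (Φ : (Fin n → ℂ) → ℝ) (z : Fin n → ℂ) : ℂ := (Φ z : ℂ)

lemma rc_contDiff {m : WithTop ℕ∞} {Φ : (Fin n → ℂ) → ℝ} (h : ContDiff ℝ m Φ) : ContDiff ℝ m (rc Φ) :=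
  Complex.ofRealCLM.contDiff.comp h

lemma fderiv_rc {Φ : (Fin n → ℂ) → ℝ} {z : Fin n → ℂ} (h : DifferentiableAt ℝ Φ z) (v : Fin n → ℂ) :
    fderiv ℝ (rc Φ) z v = (fderiv ℝ Φ z v : ℂ) := by
  have h2 := (Complex.ofRealCLM.hasFDerivAt (x := Φ z)).comp z h.hasFDerivAt
  have h3 : fderiv ℝ (rc Φ) z = _ := h2.fderiv
  rw [h3]; simp

lemma fderiv_comp1 {Φ : (Fin n → ℂ) → ℝ} {z : Fin n → ℂ} (h : DifferentiableAt ℝ Φ z) {g : ℝ → ℝ} {g' : ℝ}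
    (hg : HasDerivAt g g' (Φ z)) (v : Fin n → ℂ) :
    fderiv ℝ (rc fun x => g (Φ x)) z v = (g' : ℂ) * fderiv ℝ (rc Φ) z v := by
  have h1 := hg.comp_hasFDerivAt z h.hasFDerivAt
  have h1' : HasFDerivAt (fun x => g (Φ x)) (g' • fderiv ℝ Φ z) z := h1
  rw [fderiv_rc h1'.differentiableAt, fderiv_rc h, h1'.fderiv]
  simp

lemma dd_comp1 {Φ : (Fin n → ℂ) → ℝ} {z : Fin n → ℂ} (h : DifferentiableAt ℝ Φ z) {g : ℝ → ℝ} {g' : ℝ}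
    (hg : HasDerivAt g g' (Φ z)) (j : Fin n) :
    dd j (rc fun x => g (Φ x)) z = (g' : ℂ) * dd j (rc Φ) z := by
  rw [dd, fderiv_comp1 h hg, fderiv_comp1 h hg, dd]; ring

lemma dbar_comp1 {Φ : (Fin n → ℂ) → ℝ} {z : Fin n → ℂ} (h : DifferentiableAt ℝ Φ z) {g : ℝ → ℝ} {g' : ℝ}
    (hg : HasDerivAt g g' (Φ z)) (j : Fin n) :
    dbar j (rc fun x => g (Φ x)) z = (g' : ℂ) * dbar j (rc Φ) z := by
  rw [dbar, fderiv_comp1 h hg, fderiv_comp1 h hg, dbar]; ring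

lemma cj_dd_rc {Φ : (Fin n → ℂ) → ℝ} {z : Fin n → ℂ} (h : DifferentiableAt ℝ Φ z) (j : Fin n) :
    cj (dd j (rc Φ) z) = dbar j (rc Φ) z := by
  rw [dd, dbar, fderiv_rc h, fderiv_rc h]; simp [map_ofNat]

/-- Levi form -/
noncomputable def lev (Φ : (Fin n → ℂ) → ℝ) (z b : Fin n → ℂ) : ℝ :=
  (∑ j, ∑ k, dd j (dbar k (rc Φ)) z * b j * cj (b k)).re

lemma lev_comp {Φ : (Fin n → ℂ) → ℝ} (hΦ : ContDiff ℝ 2 Φ) {g g1 g2 : ℝ → ℝ} (hg : ∀ s, HasDerivAt g (g1 s) s)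
    (hg1 : ∀ s, HasDerivAt g1 (g2 s) s) (z b : Fin n → ℂ) :
    lev (fun x => g (Φ x)) z b = g1 (Φ z) * lev Φ z b + g2 (Φ z) * ‖∑ j, dd j (rc Φ) z * b j‖ ^ 2 := by
  have hd : Differentiable ℝ Φ := hΦ.differentiable (by norm_num)
  have hr := rc_contDiff hΦ
  have e1 : ∀ k, dbar k (rc fun x => g (Φ x)) = fun x => rc (fun x => g1 (Φ x)) x * dbar k (rc Φ) x := by
    intro k; ext x
    exact dbar_comp1 (hd x) (hg _) k
  have hd1 : DifferentiableAt ℝ (rc fun x => g1 (Φ x)) z := by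
    have h1 := (hg1 (Φ z)).comp_hasFDerivAt z (hd z).hasFDerivAt
    exact ((Complex.ofRealCLM.hasFDerivAt (x := g1 (Φ z))).comp z h1).differentiableAt
  have e2 : ∀ j k, dd j (dbar k (rc fun x => g (Φ x))) z =
      (g1 (Φ z) : ℂ) * dd j (dbar k (rc Φ)) z + (g2 (Φ z) : ℂ) * (dd j (rc Φ) z * cj (dd k (rc Φ) z)) := by
    intro j k
    rw [e1, dd_mul hd1 ((dbar_c1 hr k).differentiable (by norm_num) z), dd_comp1 (hd z) (hg1 _), cj_dd_rc (hd z)]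
    simp only [rc]; ring
  have e3 : ((‖∑ j, dd j (rc Φ) z * b j‖ ^ 2 : ℝ) : ℂ) =
      ∑ j, ∑ k, (dd j (rc Φ) z * b j) * cj (dd k (rc Φ) z * b k) := by
    push_cast
    rw [← Complex.mul_conj', map_sum, Finset.sum_mul_sum]
  have e4 : ∑ j, ∑ k, dd j (dbar k (rc fun x => g (Φ x))) z * b j * cj (b k) =
      (g1 (Φ z) : ℂ) * (∑ j, ∑ k, dd j (dbar k (rc Φ)) z * b j * cj (b k)) +
        (g2 (Φ z) : ℂ) * ((‖∑ j, dd j (rc Φ) z * b j‖ ^ 2 : ℝ) : ℂ) := by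
    rw [e3, Finset.mul_sum, Finset.mul_sum, ← Finset.sum_add_distrib]
    congr 1; ext1 j
    rw [Finset.mul_sum, Finset.mul_sum, ← Finset.sum_add_distrib]
    congr 1; ext1 k
    rw [e2, map_mul]; ring
  rw [lev, e4, lev, Complex.add_re, Complex.re_ofReal_mul, Complex.re_ofReal_mul, Complex.ofReal_re]

lemma exp_hasDeriv (c s : ℝ) : HasDerivAt (fun s => Real.exp (c * s)) (c * Real.exp (c * s)) s := by
  have := ((hasDerivAt_id s).const_mul c).exp
  simpa [mul_comm] using this

lemma dbar_expmul {Ψ : (Fin n → ℂ) → ℝ} {z : Fin n → ℂ} (hΨ : DifferentiableAt ℝ Ψ z) (c : ℝ) {w : (Fin n → ℂ) → ℂ}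
    (hw : DifferentiableAt ℝ w z) (j : Fin n) :
    dbar j (fun z => rc (fun x => Real.exp (c * Ψ x)) z * w z) z =
      rc (fun x => Real.exp (c * Ψ x)) z * (dbar j w z + c * dbar j (rc Ψ) z * w z) := by
  have hd1 : DifferentiableAt ℝ (rc fun x => Real.exp (c * Ψ x)) z := by
    have h1 := (exp_hasDeriv c (Ψ z)).comp_hasFDerivAt z hΨ.hasFDerivAt
    exact ((Complex.ofRealCLM.hasFDerivAt (x := Real.exp (c * Ψ z))).comp z h1).differentiableAt
  rw [dbar_mul hd1 hw, dbar_comp1 hΨ (exp_hasDeriv c (Ψ z))]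
  simp only [rc]; push_cast; ring

lemma exp_rc_contDiff {Ψ : (Fin n → ℂ) → ℝ} (hΨ : ContDiff ℝ 2 Ψ) (c : ℝ) :
    ContDiff ℝ 2 (rc fun x => Real.exp (c * Ψ x)) :=
  rc_contDiff (Real.contDiff_exp.comp (contDiff_const.mul hΨ))

lemma memLp_to_lint {f : (Fin n → ℂ) → ℂ} (hf : MemLp f 2 volume) :
    ∫⁻ z, ‖f z‖ₑ ^ 2 = ENNReal.ofReal (∫ z, ‖f z‖ ^ 2) := by
  rw [ofReal_integral_eq_lintegral_ofReal ((memLp_two_iff_integrable_sq_norm hf.1).mp hf) (Filter.Eventually.of_forall fun z => by positivity)]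
  congr 1; ext z
  rw [← ofReal_norm_eq_enorm, ENNReal.ofReal_pow (norm_nonneg _)]

theorem horm_wt {Ψ : (Fin n → ℂ) → ℝ} (hΨ : ContDiff ℝ 2 Ψ) (hL : ∀ z b, 0 ≤ lev Ψ z b)
    {w : (Fin n → ℂ) → ℂ} (hw : Tst w)
    {G : (Fin n → ℂ) → ℝ} (hG : Continuous G) (hGc : HasCompactSupport G) (hG0 : ∀ z, 0 ≤ G z)
    (hGL : ∀ z (b : Fin n → ℂ), ‖∑ j, dbar j w z * cj (b j)‖ ^ 2 ≤ G z * lev Ψ z b) :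
    ∃ F : (Fin n → ℂ) → ℂ, Differentiable ℂ F ∧
      ∫⁻ z, ‖w z - F z‖ₑ ^ 2 * ENNReal.ofReal (Real.exp (- Ψ z)) ≤
        ENNReal.ofReal (∫ z, G z * Real.exp (- Ψ z)) ∧
      ∫⁻ z, ‖F z‖ₑ ^ 2 * ENNReal.ofReal (Real.exp (- Ψ z)) ≤
        ∫⁻ z, ‖w z‖ₑ ^ 2 * ENNReal.ofReal (Real.exp (- Ψ z)) := by
  have hd : Differentiable ℝ Ψ := hΨ.differentiable (by norm_num)
  have hr := rc_contDiff hΨ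
  have hr1 := c1_of_c2 hr
  set p : Fin n → (Fin n → ℂ) → ℂ := fun j z => (1/2 : ℂ) * dd j (rc Ψ) z with hp_def
  have hp : ∀ j, ContDiff ℝ 1 (p j) := fun j => contDiff_const.mul (dd_c1 hr j)
  have cmul_dd : ∀ (c : ℂ) {f : (Fin n → ℂ) → ℂ} (z) (_ : DifferentiableAt ℝ f z) j, dd j (fun z => c * f z) z = c * dd j f z := by
    intro c f z hf j
    rw [dd_mul (differentiableAt_const c) hf]; simp [dd]
  have cmul_dbar : ∀ (c : ℂ) {f : (Fin n → ℂ) → ℂ} (z) (_ : DifferentiableAt ℝ f z) j, dbar j (fun z => c * f z) z = c * dbar j f z := by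
    intro c f z hf j
    rw [dbar_mul (differentiableAt_const c) hf]; simp [dbar]
  have hdd1 : ∀ j z, DifferentiableAt ℝ (dd j (rc Ψ)) z := fun j z => (dd_c1 hr j).differentiable (by norm_num) z
  have hdb1 : ∀ j z, DifferentiableAt ℝ (dbar j (rc Ψ)) z := fun j z => (dbar_c1 hr j).differentiable (by norm_num) z
  have hsym : ∀ j k z, dd j (p k) z = dd k (p j) z := by
    intro j k z
    simp only [hp_def]
    rw [cmul_dd _ _ (hdd1 k z), cmul_dd _ _ (hdd1 j z), dd_dd_comm hr]
  have hcp : ∀ j z, cj (p j z) = (1/2 : ℂ) * dbar j (rc Ψ) z := by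
    intro j z
    simp only [hp_def, map_mul, cj_dd_rc (hd z)]; simp [map_ofNat]
  have hLev : ∀ j k z, Lev p j k z = dd j (dbar k (rc Ψ)) z := by
    intro j k z
    rw [Lev]
    simp_rw [hcp]
    rw [cmul_dd _ _ (hdb1 k z), cmul_dbar _ _ (hdd1 j z), ← dd_dbar_comm hr]
    ring
  have hlevE : ∀ z b, (∑ j, ∑ k, Lev p j k z * b j * cj (b k)).re = lev Ψ z b := by
    intro z b; simp_rw [hLev]; rfl
  set E : (Fin n → ℂ) → ℂ := rc fun x => Real.exp ((-(1/2) : ℝ) * Ψ x) with hE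
  set E' : (Fin n → ℂ) → ℂ := rc fun x => Real.exp ((1/2 : ℝ) * Ψ x) with hE'
  have hEE : ∀ z, E z * E' z = 1 := by
    intro z; simp only [hE, hE', rc]
    rw [← Complex.ofReal_mul, ← Real.exp_add]; simp
  have hEn : ∀ z, ‖E z‖ ^ 2 = Real.exp (- Ψ z) := by
    intro z; simp only [hE, rc, Complex.norm_real, Real.norm_eq_abs, Real.abs_exp]
    rw [← Real.exp_nat_mul]; congr 1; push_cast; ring
  have hEe : ∀ z, ‖E z‖ₑ ^ 2 = ENNReal.ofReal (Real.exp (- Ψ z)) := by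
    intro z; rw [← hEn, ← ofReal_norm_eq_enorm, ENNReal.ofReal_pow (norm_nonneg _)]
  have hEc : ContDiff ℝ 2 E := exp_rc_contDiff hΨ _
  have hE'c : ContDiff ℝ 2 E' := exp_rc_contDiff hΨ _
  have hw' : Tst (fun z => E z * w z) := ⟨hEc.mul hw.1, hw.2.mul_left⟩
  have hDb : ∀ j z, Db p j (fun z => E z * w z) z = E z * dbar j w z := by
    intro j z
    rw [Db, hE, dbar_expmul (hd z) _ (hw.1.differentiable (by norm_num) z), hcp]
    push_cast; ring
  obtain ⟨f, hf, hf1, hf2, hf3⟩ := horm (p := p) hp hsym hw' (G := fun z => G z * Real.exp (- Ψ z))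
    (hG.mul (Real.continuous_exp.comp hΨ.continuous.neg)) hGc.mul_right
    (fun z => mul_nonneg (hG0 z) (Real.exp_pos _).le)
    (fun z b => by rw [hlevE]; exact hL z b)
    (fun z b => by
      rw [hlevE]
      simp_rw [hDb, mul_assoc]
      rw [← Finset.mul_sum, norm_mul, mul_pow, hEn]
      have := mul_le_mul_of_nonneg_left (hGL z b) (Real.exp_pos (- Ψ z)).le
      linarith)
  have hweak : ∀ j η, ContDiff ℝ 2 η → HasCompactSupport η → ∫ t, (E' t * f t) * dbar j η t = 0 := by
    intro j η h1 h2
    have hη : Tst (fun z => E' z * η z) := ⟨hE'c.mul h1, h2.mul_left⟩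
    have := hf1 j _ hη.cj'
    rw [← this]
    congr 1; ext z
    rw [cj_Dp hη, hE', dbar_expmul (hd z) _ (h1.differentiable (by norm_num) z), hcp]
    push_cast; ring
  have hloc : ∀ R, MemLp ((Metric.ball 0 R).indicator fun t => E' t * f t) 2 volume := by
    intro R
    obtain ⟨C, hC⟩ := (isCompact_closedBall (0 : Fin n → ℂ) R).exists_bound_of_continuousOn hE'c.continuous.continuousOn
    refine hf.of_le_mul (c := |C|) ((hE'c.continuous.aestronglyMeasurable.mul hf.1).indicator measurableSet_ball)
      (Filter.Eventually.of_forall fun z => ?_)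
    by_cases hz : z ∈ Metric.ball 0 R
    · rw [indicator_of_mem hz, norm_mul]
      gcongr
      exact (hC z (Metric.ball_subset_closedBall hz)).trans (le_abs_self C)
    · rw [indicator_of_notMem hz, norm_zero]
      positivity
  obtain ⟨g, hg, hge⟩ := weyl hloc hweak
  have hfE : ∀ᵐ z, f z = E z * g z := by
    filter_upwards [hge] with z hz
    rw [← hz, ← mul_assoc, hEE, one_mul]
  refine ⟨g, hg, ?_, ?_⟩
  · have : ∫⁻ z, ‖w z - g z‖ₑ ^ 2 * ENNReal.ofReal (Real.exp (- Ψ z)) = ∫⁻ z, ‖E z * w z - f z‖ₑ ^ 2 := by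
      apply lintegral_congr_ae
      filter_upwards [hfE] with z hz
      rw [hz, ← mul_sub, enorm_mul, mul_pow, hEe, mul_comm]
    have m : MemLp (fun z => E z * w z - f z) 2 volume := hw'.mem.sub hf
    rw [this, memLp_to_lint m]
    exact ENNReal.ofReal_le_ofReal hf2
  · have e1 : ∫⁻ z, ‖g z‖ₑ ^ 2 * ENNReal.ofReal (Real.exp (- Ψ z)) = ∫⁻ z, ‖f z‖ₑ ^ 2 := by
      apply lintegral_congr_ae
      filter_upwards [hfE] with z hz
      rw [hz, enorm_mul, mul_pow, hEe, mul_comm]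
    have e2 : ∫⁻ z, ‖w z‖ₑ ^ 2 * ENNReal.ofReal (Real.exp (- Ψ z)) = ∫⁻ z, ‖E z * w z‖ₑ ^ 2 := by
      apply lintegral_congr
      intro z
      rw [enorm_mul, mul_pow, hEe, mul_comm]
    rw [e1, e2, memLp_to_lint hf, memLp_to_lint hw'.mem]
    exact ENNReal.ofReal_le_ofReal hf3
end SOC

namespace SOC
variable {n : ℕ}
local notation "cj" => starRingEnd ℂ

noncomputable def L0 (u : ℝ) : ℝ := Real.log (1 + Real.exp u)
noncomputable def L1 (u : ℝ) : ℝ := Real.exp u / (1 + Real.exp u)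
noncomputable def L2 (u : ℝ) : ℝ := Real.exp u / (1 + Real.exp u) ^ 2

lemma L2_pos (u : ℝ) : 0 < L2 u := by unfold L2; positivity
lemma L1_pos (u : ℝ) : 0 < L1 u := by unfold L1; positivity
lemma L0_nonneg (u : ℝ) : 0 ≤ L0 u := Real.log_nonneg (by have := Real.exp_pos u; linarith)
lemma L0_le {T : ℝ} (hT : 1 ≤ T) {u : ℝ} (hu : u ≤ T) : L0 u ≤ 2 * T := by
  unfold L0
  rw [Real.log_le_iff_le_exp (by positivity)]
  have h1 : Real.exp u ≤ Real.exp T := Real.exp_le_exp.2 hu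
  have h2 : Real.exp (2 * T) = Real.exp T * Real.exp T := by rw [← Real.exp_add]; ring_nf
  have h3 : 2 ≤ Real.exp T := by have := Real.add_one_le_exp T; linarith
  nlinarith
lemma L0_deriv (u : ℝ) : HasDerivAt L0 (L1 u) u := by
  have h := ((Real.hasDerivAt_exp u).const_add 1).log (by positivity)
  exact h
lemma L1_deriv (u : ℝ) : HasDerivAt L1 (L2 u) u := by
  have h := (Real.hasDerivAt_exp u).div ((Real.hasDerivAt_exp u).const_add 1) (by positivity)
  refine h.congr_deriv ?_
  unfold L2; congr 1; ring
lemma L0_contDiff : ContDiff ℝ 2 L0 := by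
  unfold L0
  exact ContDiff.log (contDiff_const.add Real.contDiff_exp) (fun x => by positivity)
lemma L2_continuous : Continuous L2 := by
  unfold L2
  exact Real.continuous_exp.div ((continuous_const.add Real.continuous_exp).pow 2) (fun x => by positivity)

noncomputable def chi (u : ℝ) : ℝ := Real.smoothTransition (-u)
lemma chi_contDiff (m : ℕ∞) : ContDiff ℝ m chi := Real.smoothTransition.contDiff.comp contDiff_neg
lemma chi_nonneg (u : ℝ) : 0 ≤ chi u := Real.smoothTransition.nonneg _
lemma chi_le (u : ℝ) : chi u ≤ 1 := Real.smoothTransition.le_one _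
lemma chi_one {u : ℝ} (h : u ≤ -1) : chi u = 1 := Real.smoothTransition.one_of_one_le (by linarith)
lemma chi_zero {u : ℝ} (h : 0 ≤ u) : chi u = 0 := Real.smoothTransition.zero_of_nonpos (by linarith)
lemma chi_deriv (u : ℝ) : HasDerivAt chi (deriv chi u) u :=
  ((chi_contDiff 1).differentiable (by norm_num) u).hasDerivAt
lemma chi1_continuous : Continuous (deriv chi) := (chi_contDiff 1).continuous_deriv (by norm_num)
lemma chi1_zero {u : ℝ} (h : 0 ≤ u) : deriv chi u = 0 :=
  IsLocalMin.deriv_eq_zero (Eventually.of_forall fun v => by rw [chi_zero h]; exact chi_nonneg v)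
lemma chi1_one {u : ℝ} (h : u ≤ -1) : deriv chi u = 0 :=
  IsLocalMax.deriv_eq_zero (Eventually.of_forall fun v => by rw [chi_one h]; exact chi_le v)
lemma chi_bound : ∃ C : ℝ, 0 < C ∧ ∀ u, (deriv chi u) ^ 2 / L2 u ≤ C := by
  have hc : Continuous fun u => (deriv chi u) ^ 2 / L2 u :=
    (chi1_continuous.pow 2).div L2_continuous fun u => (L2_pos u).ne'
  obtain ⟨C, hC⟩ := (isCompact_Icc (a := (-1:ℝ)) (b := 0)).bddAbove_image hc.continuousOn
  refine ⟨max C 1, by positivity, fun u => ?_⟩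
  by_cases h0 : 0 ≤ u
  · rw [chi1_zero h0]; simp
  by_cases h1 : u ≤ -1
  · rw [chi1_one h1]; simp
  exact le_max_of_le_left (hC ⟨u, ⟨by linarith, by linarith⟩, rfl⟩)

theorem smooth_est (n : ℕ) : ∃ C : ℝ, 0 < C ∧ ∀ (F : (Fin n → ℂ) → ℂ), DifferentiableOn ℂ F (Metric.ball 0 1) →
    ∀ (Φ : (Fin n → ℂ) → ℝ), ContDiff ℝ 2 Φ → (∀ z b, 0 ≤ lev Φ z b) → ∀ T : ℝ, 1 ≤ T →
    (∀ z, Φ z < -T → ‖z‖ ≤ 1/2) → ∀ R0 : ℝ, R0 ≤ 1/2 → (∀ z ∈ Metric.ball (0 : Fin n → ℂ) R0, Φ z ≤ 0) →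
    ∃ H : (Fin n → ℂ) → ℂ, Differentiable ℂ H ∧
      ∫⁻ z in Metric.ball 0 R0, ‖H z‖ₑ ^ 2 ≤ ENNReal.ofReal (C * T * Real.exp T) * ∫⁻ z in {z | Φ z < -T}, ‖F z‖ₑ ^ 2 ∧
      ∫⁻ z in Metric.ball 0 R0, ‖F z - H z‖ₑ ^ 2 * ENNReal.ofReal (Real.exp (- Φ z)) ≤
        ENNReal.ofReal (C * T * Real.exp T) * ∫⁻ z in Metric.closedBall 0 (1/2), ‖F z‖ₑ ^ 2 := by
  obtain ⟨C0, hC0, hC0'⟩ := chi_bound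
  refine ⟨2 * Real.exp 3 * (C0 + 1), by positivity, ?_⟩
  intro F hF Φ hΦ hL T hT hsub R0 hR0 hneg
  obtain ⟨F₀, hF₀, hFF⟩ := smooth_ext hF
  have hT0 : 0 < T := by linarith
  have hΦd : Differentiable ℝ Φ := hΦ.differentiable (by norm_num)
  have hΦc : Continuous Φ := hΦ.continuous
  set Ψ : (Fin n → ℂ) → ℝ := fun z => Φ z + (1/T) * L0 (Φ z + T) with hΨ_def
  have hΨ : ContDiff ℝ 2 Ψ := hΦ.add (contDiff_const.mul (L0_contDiff.comp (hΦ.add contDiff_const)))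
  have hlev : ∀ z b, lev Ψ z b = (1 + (1/T) * L1 (Φ z + T)) * lev Φ z b +
      ((1/T) * L2 (Φ z + T)) * ‖∑ j, dd j (rc Φ) z * b j‖ ^ 2 := by
    intro z b
    refine lev_comp (g := fun s => s + (1/T) * L0 (s + T)) (g1 := fun s => 1 + (1/T) * L1 (s + T))
      (g2 := fun s => (1/T) * L2 (s + T)) hΦ (fun s => ?_) (fun s => ?_) z b
    · exact (hasDerivAt_id s).add (((L0_deriv (s+T)).comp_add_const s T).const_mul (1/T))
    · exact (((L1_deriv (s+T)).comp_add_const s T).const_mul (1/T)).const_add 1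
  have hlevnn : ∀ z b, 0 ≤ lev Ψ z b := fun z b => by
    rw [hlev]
    have := L1_pos (Φ z + T); have := L2_pos (Φ z + T); have := hL z b
    positivity
  set w : (Fin n → ℂ) → ℂ := fun z => rc (fun x => chi (Φ x + T)) z * F₀ z with hw_def
  have hsuppz : ∀ z, 1/2 < ‖z‖ → 0 ≤ Φ z + T := fun z hz => by
    by_contra h; push Not at h
    have := hsub z (by linarith); linarith
  have hchiC : ContDiff ℝ 2 fun x => chi (Φ x + T) := (chi_contDiff 2).comp (hΦ.add contDiff_const)
  have hcomp : ∀ {E : Type} [NormedAddCommGroup E] (f : (Fin n → ℂ) → E), (∀ z, 1/2 < ‖z‖ → f z = 0) →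
      HasCompactSupport f := fun f hf =>
    HasCompactSupport.intro (isCompact_closedBall 0 (1/2)) (fun z hz => hf z (by simpa using hz))
  have hwT : Tst w := ⟨(rc_contDiff hchiC).mul hF₀, hcomp w fun z hz => by
    simp only [hw_def, rc]; rw [chi_zero (hsuppz z hz)]; simp⟩
  set G : (Fin n → ℂ) → ℝ := fun z => ‖F₀ z‖ ^ 2 * (T * ((deriv chi (Φ z + T)) ^ 2 / L2 (Φ z + T))) with hG_def
  have hG : Continuous G := (hF₀.continuous.norm.pow 2).mul (continuous_const.mul
    (((chi1_continuous.comp (hΦc.add continuous_const)).pow 2).div (L2_continuous.comp (hΦc.add continuous_const))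
      fun z => (L2_pos _).ne'))
  have hGc : HasCompactSupport G := hcomp G fun z hz => by
    simp only [hG_def]; rw [chi1_zero (hsuppz z hz)]; simp
  have hG0 : ∀ z, 0 ≤ G z := fun z => by
    have := L2_pos (Φ z + T); simp only [hG_def]; positivity
  have hdw : ∀ j z, dbar j w z = F₀ z * (((deriv chi (Φ z + T) : ℝ) : ℂ) * dbar j (rc Φ) z) := by
    intro j z
    have e1 : dbar j (rc fun x => chi (Φ x + T)) z = ((deriv chi (Φ z + T) : ℝ) : ℂ) * dbar j (rc Φ) z :=
      dbar_comp1 (g := fun s => chi (s + T)) (hΦd z) ((chi_deriv (Φ z + T)).comp_add_const (Φ z) T) j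
    have e2 := dbar_mul (((rc_contDiff hchiC).differentiable (by norm_num)) z)
      ((hF₀.differentiable (by norm_num)) z) j
    have e3 : rc (fun x => chi (Φ x + T)) z * dbar j F₀ z = 0 := by
      by_cases h : ‖z‖ ≤ 1/2
      · have hz : z ∈ Metric.ball (0 : Fin n → ℂ) (3/4) := by simp; linarith
        have : DifferentiableAt ℂ F₀ z := by
          have h1 : DifferentiableAt ℂ F z := (hF.differentiableAt (Metric.isOpen_ball.mem_nhds
            (by simp; linarith)))
          exact h1.congr_of_eventuallyEq (Filter.eventually_of_mem (Metric.isOpen_ball.mem_nhds hz) hFF)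
        rw [dbar_of_holo this j, mul_zero]
      · simp only [rc]; rw [chi_zero (hsuppz z (by linarith))]; simp
    rw [show w = fun z => rc (fun x => chi (Φ x + T)) z * F₀ z from rfl, e2, e1, e3]; ring
  have hGL : ∀ z (b : Fin n → ℂ), ‖∑ j, dbar j w z * cj (b j)‖ ^ 2 ≤ G z * lev Ψ z b := by
    intro z b
    have e1 : ∑ j, dbar j w z * cj (b j) = F₀ z * (((deriv chi (Φ z + T) : ℝ) : ℂ) *
        cj (∑ j, dd j (rc Φ) z * b j)) := by
      rw [map_sum, Finset.mul_sum, Finset.mul_sum]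
      refine Finset.sum_congr rfl fun j _ => ?_
      rw [hdw, map_mul, cj_dd_rc (hΦd z)]; ring
    rw [e1, norm_mul, norm_mul, RCLike.norm_conj, hlev, mul_pow, mul_pow, Complex.norm_real, Real.norm_eq_abs, sq_abs]
    have p1 := L1_pos (Φ z + T); have p2 := L2_pos (Φ z + T); have p3 := hL z b
    have e2 : ‖F₀ z‖ ^ 2 * ((deriv chi (Φ z + T)) ^ 2 * ‖∑ j, dd j (rc Φ) z * b j‖ ^ 2) =
      G z * (((1/T) * L2 (Φ z + T)) * ‖∑ j, dd j (rc Φ) z * b j‖ ^ 2) := by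
      simp only [hG_def]; field_simp
    rw [e2]
    refine mul_le_mul_of_nonneg_left ?_ (hG0 z)
    have : 0 ≤ (1 + (1/T) * L1 (Φ z + T)) * lev Φ z b := by positivity
    linarith
  obtain ⟨H, hH, h1, -⟩ := horm_wt hΨ hlevnn hwT hG hGc hG0 hGL
  refine ⟨H, hH, ?_⟩
  -- basic quantities
  set m := ∫⁻ z in {z | Φ z < -T}, ‖F z‖ₑ ^ 2 with hm
  have hmeas : MeasurableSet {z | Φ z < -T} := measurableSet_lt hΦc.measurable measurable_const
  have hΨge : ∀ z, Φ z ≤ Ψ z := fun z => by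
    have := L0_nonneg (Φ z + T); simp only [hΨ_def]; have : 0 ≤ 1/T * L0 (Φ z + T) := by positivity
    linarith
  have hΨle : ∀ z ∈ Metric.ball (0 : Fin n → ℂ) R0, Ψ z ≤ Φ z + 2 := fun z hz => by
    have := L0_le hT (u := Φ z + T) (by have := hneg z hz; linarith)
    have : 1/T * L0 (Φ z + T) ≤ 1/T*(2*T) := mul_le_mul_of_nonneg_left this (by positivity)
    have e : 1/T*(2*T) = 2 := by field_simp
    simp only [hΨ_def]; linarith
  have hFeq : ∀ z, ‖z‖ ≤ 1/2 → F₀ z = F z := fun z hz => hFF z (by simp; linarith)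
  have hGm : ENNReal.ofReal (∫ z, G z * Real.exp (- Ψ z)) ≤ ENNReal.ofReal (C0 * T * Real.exp (T + 1)) * m := by
    have hint : Integrable (fun z => G z * Real.exp (- Ψ z)) volume :=
      (hG.mul (Real.continuous_exp.comp hΨ.continuous.neg)).integrable_of_hasCompactSupport (hGc.mul_right)
    rw [ofReal_integral_eq_lintegral_ofReal hint
      (Eventually.of_forall fun z => mul_nonneg (hG0 z) (Real.exp_pos _).le), hm,
      ← lintegral_indicator hmeas, ← lintegral_const_mul' _ _ ENNReal.ofReal_ne_top]
    refine lintegral_mono fun z => ?_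
    by_cases hz : Φ z < -T
    · rw [indicator_of_mem (by exact hz)]
      rw [show ‖F z‖ₑ = ENNReal.ofReal ‖F₀ z‖ by rw [hFeq z (hsub z hz), ofReal_norm],
        ← ENNReal.ofReal_pow (norm_nonneg _), ← ENNReal.ofReal_mul (by positivity)]
      apply ENNReal.ofReal_le_ofReal
      simp only [hG_def]
      by_cases hz2 : Φ z + T ≤ -1
      · rw [chi1_one hz2]; simp; positivity
      · have e1 : Real.exp (-Ψ z) ≤ Real.exp (T+1) := Real.exp_le_exp.2 (by have := hΨge z; linarith)
        have e2 := hC0' (Φ z + T)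
        have := L2_pos (Φ z + T)
        calc _ ≤ ‖F₀ z‖ ^ 2 * (T * C0) * Real.exp (T+1) := by gcongr
          _ = _ := by ring
    · simp only [hG_def]; rw [chi1_zero (by linarith)]; simp
  have hA : ∫⁻ z in Metric.ball 0 R0, ‖w z - H z‖ₑ ^ 2 * ENNReal.ofReal (Real.exp (-Φ z)) ≤
      ENNReal.ofReal (Real.exp 2) * (ENNReal.ofReal (C0 * T * Real.exp (T + 1)) * m) := by
    refine le_trans ?_ (mul_le_mul' le_rfl (h1.trans hGm))
    rw [← lintegral_const_mul' _ _ ENNReal.ofReal_ne_top]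
    refine le_trans (setLIntegral_mono' Metric.isOpen_ball.measurableSet fun z hz => ?_) (setLIntegral_le_lintegral _ _)
    rw [mul_left_comm, ← ENNReal.ofReal_mul (Real.exp_pos _).le, ← Real.exp_add]
    gcongr
    have := hΨle z hz; linarith
  have hsq : ∀ a b : ℂ, ‖a + b‖ₑ ^ 2 ≤ 2 * ‖a‖ₑ ^ 2 + 2 * ‖b‖ₑ ^ 2 := by
    intro a b
    have : ‖a+b‖^2 ≤ 2 * ‖a‖^2 + 2 * ‖b‖^2 := by
      have := norm_add_le a b; nlinarith [sq_nonneg (‖a‖ - ‖b‖), norm_nonneg (a+b)]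
    rw [← ofReal_norm, ← ofReal_norm, ← ofReal_norm, ← ENNReal.ofReal_pow (norm_nonneg _), ← ENNReal.ofReal_pow (norm_nonneg _),
      ← ENNReal.ofReal_pow (norm_nonneg _), show (2:ℝ≥0∞) = ENNReal.ofReal 2 by simp, ← ENNReal.ofReal_mul (by norm_num),
      ← ENNReal.ofReal_mul (by norm_num), ← ENNReal.ofReal_add (by positivity) (by positivity)]
    exact ENNReal.ofReal_le_ofReal this
  have hwn : ∀ z, ‖w z‖ ≤ ‖F₀ z‖ := fun z => by
    simp only [hw_def, rc, norm_mul, Complex.norm_real, Real.norm_eq_abs, abs_of_nonneg (chi_nonneg _)]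
    exact mul_le_of_le_one_left (norm_nonneg _) (chi_le _)
  have hwF : ∫⁻ z, ‖w z‖ₑ ^ 2 ≤ m := by
    rw [hm, ← lintegral_indicator hmeas]
    refine lintegral_mono fun z => ?_
    by_cases hz : Φ z < -T
    · rw [indicator_of_mem (by exact hz), ← hFeq z (hsub z hz)]
      gcongr
      rw [← ofReal_norm, ← ofReal_norm]; exact ENNReal.ofReal_le_ofReal (hwn z)
    · simp only [hw_def, rc]; rw [chi_zero (by linarith)]; simp
  have hmle : m ≤ ∫⁻ z in Metric.closedBall 0 (1/2), ‖F z‖ₑ ^ 2 :=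
    lintegral_mono_set fun z hz => by simpa using hsub z hz
  have hwc : Continuous w := hwT.1.continuous
  have hconst : 2 * (ENNReal.ofReal (Real.exp 2) * ENNReal.ofReal (C0 * T * Real.exp (T + 1))) +
      2 * ENNReal.ofReal (Real.exp (T + 1)) ≤
      ENNReal.ofReal (2 * Real.exp 3 * (C0 + 1) * T * Real.exp T) := by
    rw [show (2:ℝ≥0∞) = ENNReal.ofReal 2 by simp, ← ENNReal.ofReal_mul (by positivity), ← ENNReal.ofReal_mul (by positivity),
      ← ENNReal.ofReal_mul (by positivity), ← ENNReal.ofReal_add (by positivity) (by positivity)]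
    apply ENNReal.ofReal_le_ofReal
    have e3 : Real.exp 3 = Real.exp 2 * Real.exp 1 := by rw [← Real.exp_add]; norm_num
    rw [Real.exp_add, e3]
    have g1 : 1 ≤ Real.exp 2 := Real.one_le_exp (by norm_num)
    have : Real.exp T * Real.exp 1 * 1 ≤ Real.exp T * Real.exp 1 * (Real.exp 2 * T) := by
      gcongr; nlinarith
    nlinarith
  constructor
  · calc ∫⁻ z in Metric.ball 0 R0, ‖H z‖ₑ ^ 2
        ≤ ∫⁻ z in Metric.ball 0 R0, (2 * ‖w z‖ₑ ^ 2 + 2 * (‖w z - H z‖ₑ ^ 2 * ENNReal.ofReal (Real.exp (-Φ z)))) := by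
          refine setLIntegral_mono' Metric.isOpen_ball.measurableSet fun z hz => ?_
          have h := hsq (w z) (-(w z - H z))
          rw [show w z + -(w z - H z) = H z by ring, enorm_neg] at h
          refine h.trans ?_
          gcongr
          refine le_mul_of_one_le_right' ?_
          rw [ENNReal.one_le_ofReal]
          exact Real.one_le_exp (by have := hneg z hz; linarith)
      _ = 2 * (∫⁻ z in Metric.ball 0 R0, ‖w z‖ₑ ^ 2) +
          2 * ∫⁻ z in Metric.ball 0 R0, (‖w z - H z‖ₑ ^ 2 * ENNReal.ofReal (Real.exp (-Φ z))) := by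
          rw [lintegral_add_left (by fun_prop), lintegral_const_mul' _ _ (by simp), lintegral_const_mul' _ _ (by simp)]
      _ ≤ 2 * m + 2 * (ENNReal.ofReal (Real.exp 2) * (ENNReal.ofReal (C0 * T * Real.exp (T + 1)) * m)) := by
          gcongr
          exact (setLIntegral_le_lintegral _ _).trans hwF
      _ ≤ (2 * (ENNReal.ofReal (Real.exp 2) * ENNReal.ofReal (C0 * T * Real.exp (T + 1))) +
      2 * ENNReal.ofReal (Real.exp (T + 1))) * m := by
          rw [add_comm, add_mul]
          refine add_le_add (by simp only [mul_assoc]; exact le_rfl) ?_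
          gcongr
          refine le_mul_of_one_le_right' ?_
          rw [ENNReal.one_le_ofReal]
          exact Real.one_le_exp (by linarith)
      _ ≤ _ := by gcongr
  · set m2 := ∫⁻ z in Metric.closedBall 0 (1/2), ‖F z‖ₑ ^ 2 with hm2
    calc ∫⁻ z in Metric.ball 0 R0, ‖F z - H z‖ₑ ^ 2 * ENNReal.ofReal (Real.exp (-Φ z))
        ≤ ∫⁻ z in Metric.ball 0 R0, (2 * (ENNReal.ofReal (Real.exp (T+1)) * ‖F₀ z‖ₑ ^ 2) +
            2 * (‖w z - H z‖ₑ ^ 2 * ENNReal.ofReal (Real.exp (-Φ z)))) := by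
          refine setLIntegral_mono' Metric.isOpen_ball.measurableSet fun z hz => ?_
          have hz' : ‖z‖ ≤ 1/2 := by simp at hz; linarith
          have h := hsq (F z - w z) (w z - H z)
          rw [show F z - w z + (w z - H z) = F z - H z by ring] at h
          refine (mul_le_mul' h le_rfl).trans ?_
          rw [add_mul, mul_assoc, mul_assoc]
          refine add_le_add (mul_le_mul' le_rfl ?_) le_rfl
          rw [← hFeq z hz', mul_comm]
          by_cases h2 : Φ z + T ≤ -1
          · simp only [hw_def, rc]; rw [chi_one h2]; simp
          · refine mul_le_mul' (ENNReal.ofReal_le_ofReal (Real.exp_le_exp.2 (by linarith))) ?_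
            gcongr
            rw [← ofReal_norm, ← ofReal_norm]
            apply ENNReal.ofReal_le_ofReal
            have : F₀ z - w z = ((1 - chi (Φ z + T) : ℝ) : ℂ) * F₀ z := by
              simp only [hw_def, rc]; push_cast; ring
            rw [this, norm_mul, Complex.norm_real, Real.norm_eq_abs, abs_of_nonneg (by linarith [chi_le (Φ z + T)])]
            exact mul_le_of_le_one_left (norm_nonneg _) (by linarith [chi_nonneg (Φ z + T)])
      _ = 2 * (ENNReal.ofReal (Real.exp (T+1)) * ∫⁻ z in Metric.ball 0 R0, ‖F₀ z‖ₑ ^ 2) +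
          2 * ∫⁻ z in Metric.ball 0 R0, (‖w z - H z‖ₑ ^ 2 * ENNReal.ofReal (Real.exp (-Φ z))) := by
          have := hF₀.continuous
          rw [lintegral_add_left (by fun_prop), lintegral_const_mul' _ _ (by simp), lintegral_const_mul' _ _ (by simp),
            lintegral_const_mul' _ _ (by simp)]
      _ ≤ 2 * (ENNReal.ofReal (Real.exp (T+1)) * m2) +
           2 * (ENNReal.ofReal (Real.exp 2) * (ENNReal.ofReal (C0 * T * Real.exp (T + 1)) * m2)) := by
          gcongr
          · rw [hm2]
            rw [setLIntegral_congr_fun Metric.isOpen_ball.measurableSet (g := fun z => ‖F z‖ₑ ^ 2)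
              (fun z hz => by simp at hz; simp only []; rw [hFeq z (by linarith)])]
            exact lintegral_mono_set ((Metric.ball_subset_ball hR0).trans Metric.ball_subset_closedBall)
          · exact hA.trans (by gcongr)
      _ = (2 * (ENNReal.ofReal (Real.exp 2) * ENNReal.ofReal (C0 * T * Real.exp (T + 1))) +
      2 * ENNReal.ofReal (Real.exp (T + 1))) * m2 := by ring
      _ ≤ _ := by gcongr
end SOC

namespace SOC
variable {n : ℕ}
local notation "cj" => starRingEnd ℂ

/-- circle mean -/
noncomputable def cmean (u : (Fin n → ℂ) → ℝ) (z w : Fin n → ℂ) : ℝ :=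
  (2 * Real.pi)⁻¹ * ∫ θ in (0 : ℝ)..(2 * Real.pi), u (z + Complex.exp (θ * I) • w)

/-- sub-mean value property for circles of radius less than `δ` -/
def SubM (u : (Fin n → ℂ) → ℝ) (δ : ℝ) : Prop := ∀ z w : Fin n → ℂ, ‖w‖ < δ → u z ≤ cmean u z w

lemma trig_mean (c α β A B D : ℝ) : (2 * Real.pi)⁻¹ * (∫ θ in (0 : ℝ)..(2 * Real.pi),
    (c + (α * Real.cos θ + β * Real.sin θ) + (A * Real.cos θ ^ 2 + B * (Real.sin θ * Real.cos θ) + D * Real.sin θ ^ 2)))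
    = c + (A + D) / 2 := by
  have i : ∀ {f : ℝ → ℝ}, Continuous f → IntervalIntegrable f volume 0 (2 * Real.pi) := fun h => h.intervalIntegrable _ _
  rw [intervalIntegral.integral_add (i (by fun_prop)) (i (by fun_prop)),
    intervalIntegral.integral_add (i (by fun_prop)) (i (by fun_prop)),
    intervalIntegral.integral_add (i (by fun_prop)) (i (by fun_prop)),
    intervalIntegral.integral_add (i (by fun_prop)) (i (by fun_prop)),
    intervalIntegral.integral_add (i (by fun_prop)) (i (by fun_prop))]
  simp only [intervalIntegral.integral_const_mul, integral_cos, integral_sin, integral_cos_sq, integral_sin_sq,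
    integral_sin_mul_cos₁, intervalIntegral.integral_const]
  simp
  have := Real.pi_pos
  field_simp

lemma exp_smul (θ : ℝ) (w : Fin n → ℂ) :
    Complex.exp (θ * I) • w = Real.cos θ • w + Real.sin θ • (I • w) := by
  ext i
  simp only [Pi.smul_apply, Pi.add_apply, smul_eq_mul, Complex.real_smul, Complex.exp_mul_I, Complex.ofReal_cos, Complex.ofReal_sin]
  ring

lemma exp_circle_cont (z w : Fin n → ℂ) : Continuous fun θ : ℝ => z + Complex.exp (θ * I) • w := by fun_prop

lemma taylor2 {Φ : (Fin n → ℂ) → ℝ} (hΦ : ContDiff ℝ 2 Φ) (z : Fin n → ℂ) {η : ℝ} (hη : 0 < η) :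
    ∃ δ > 0, ∀ v, ‖v‖ < δ → |Φ (z + v) - Φ z - fderiv ℝ Φ z v - (1/2) * fderiv ℝ (fderiv ℝ Φ) z v v| ≤ η * ‖v‖ ^ 2 := by
  have hd : Differentiable ℝ Φ := hΦ.differentiable (by norm_num)
  have hd2 : DifferentiableAt ℝ (fderiv ℝ Φ) z :=
    (hΦ.fderiv_right (m := 1) (by norm_num)).differentiable (by norm_num) z
  have hs : ∀ v w, fderiv ℝ (fderiv ℝ Φ) z v w = fderiv ℝ (fderiv ℝ Φ) z w v := fun v w =>
    (hΦ.contDiffAt.isSymmSndFDerivAt (by simp)).eq v w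
  have h1 := (hasFDerivAt_iff_isLittleO_nhds_zero.1 hd2.hasFDerivAt).def hη
  obtain ⟨δ, hδ, h2⟩ := Metric.eventually_nhds_iff_ball.1 h1
  refine ⟨δ, hδ, fun v hv => ?_⟩
  set A := fderiv ℝ (fderiv ℝ Φ) z with hA
  set g : (Fin n → ℂ) → ℝ := fun v => Φ (z + v) - Φ z - fderiv ℝ Φ z v - (1/2) * A v v with hg
  have hgd : ∀ x, HasFDerivAt g (fderiv ℝ Φ (z + x) - fderiv ℝ Φ z - A x) x := by
    intro x
    have a1 : HasFDerivAt (fun v => Φ (z + v)) (fderiv ℝ Φ (z + x)) x := by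
      have := (hd (z + x)).hasFDerivAt.comp x ((hasFDerivAt_id x).const_add z)
      exact this
    have a2 : HasFDerivAt (fun v => A v v) ((A x) + (A.flip x)) x := by
      have := A.hasFDerivAt.clm_apply (hasFDerivAt_id x)
      refine this.congr_fderiv ?_
      ext; simp
    have := ((a1.sub_const (Φ z)).sub (fderiv ℝ Φ z).hasFDerivAt).sub (a2.const_mul (1/2))
    refine this.congr_fderiv ?_
    ext y
    simp [hs y x]
    rw [hs x y]; ring
  have h3 := (convex_segment (0 : Fin n → ℂ) v).norm_image_sub_le_of_norm_hasFDerivWithin_le (f := g) (C := η * ‖v‖)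
    (fun x _ => (hgd x).hasFDerivWithinAt) (fun x hx => by
      have hxv : ‖x‖ ≤ ‖v‖ := by
        obtain ⟨a, b, ha, hb, hab, rfl⟩ := hx
        simp only [smul_zero, zero_add, norm_smul, Real.norm_of_nonneg hb]
        exact mul_le_of_le_one_left (norm_nonneg _) (by linarith)
      refine (h2 x (by simpa using lt_of_le_of_lt hxv hv)).trans ?_
      gcongr) (left_mem_segment ℝ 0 v) (right_mem_segment ℝ 0 v)
  have hg0 : g 0 = 0 := by simp [hg]
  rw [hg0, sub_zero, sub_zero, Real.norm_eq_abs] at h3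
  refine h3.trans (le_of_eq (by ring))

lemma lev_eq {Φ : (Fin n → ℂ) → ℝ} (hΦ : ContDiff ℝ 2 Φ) (z b : Fin n → ℂ) :
    lev Φ z b = (1/4) * (fderiv ℝ (fderiv ℝ Φ) z b b + fderiv ℝ (fderiv ℝ Φ) z (I • b) (I • b)) := by
  have hd : Differentiable ℝ Φ := hΦ.differentiable (by norm_num)
  have hd2 : DifferentiableAt ℝ (fderiv ℝ Φ) z :=
    (hΦ.fderiv_right (m := 1) (by norm_num)).differentiable (by norm_num) z
  have hfa : ∀ v w, fderiv ℝ (fderiv ℝ (rc Φ)) z v w = ((fderiv ℝ (fderiv ℝ Φ) z v w : ℝ) : ℂ) := by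
    intro v w
    rw [← fderiv_fderiv_apply (rc_contDiff hΦ)]
    have : (fun x => fderiv ℝ (rc Φ) x w) = rc (fun x => fderiv ℝ Φ x w) := by
      ext x; rw [fderiv_rc (hd x)]; rfl
    rw [this]
    have e := hd2.hasFDerivAt.clm_apply (hasFDerivAt_const w z)
    rw [fderiv_rc e.differentiableAt, e.fderiv]; simp
  set A := fderiv ℝ (fderiv ℝ Φ) z with hA
  have hb : b = ∑ j, ((b j).re • (Pi.single j 1 : Fin n → ℂ) + (b j).im • (Pi.single j I : Fin n → ℂ)) := by
    ext i
    rw [Finset.sum_apply, Finset.sum_eq_single i]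
    · simp
    · intro j _ hj; simp [Pi.single_apply, hj.symm]
    · simp
  have hIb : I • b = ∑ j, ((-(b j).im) • (Pi.single j 1 : Fin n → ℂ) + (b j).re • (Pi.single j I : Fin n → ℂ)) := by
    ext i
    rw [Finset.sum_apply, Finset.sum_eq_single i]
    · apply Complex.ext <;> simp
    · intro j _ hj; simp [Pi.single_apply, hj.symm]
    · simp
  have hexp : ∀ (x y : Fin n → ℝ), A (∑ j, (x j • (Pi.single j 1 : Fin n → ℂ) + y j • (Pi.single j I : Fin n → ℂ)))
      (∑ j, (x j • (Pi.single j 1 : Fin n → ℂ) + y j • (Pi.single j I : Fin n → ℂ))) =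
      ∑ j, ∑ k, (x j * x k * A (Pi.single j 1) (Pi.single k 1) + x j * y k * A (Pi.single j 1) (Pi.single k I) +
        y j * x k * A (Pi.single j I) (Pi.single k 1) + y j * y k * A (Pi.single j I) (Pi.single k I)) := by
    intro x y
    rw [map_sum, Finset.sum_comm]
    refine Finset.sum_congr rfl fun j _ => ?_
    rw [map_sum, ContinuousLinearMap.sum_apply]
    refine Finset.sum_congr rfl fun k _ => ?_
    simp only [map_add, map_smul, ContinuousLinearMap.add_apply, ContinuousLinearMap.smul_apply, smul_eq_mul]
    ring
  rw [hIb]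
  conv_rhs => enter [2, 1]; rw [hb]
  rw [hexp (fun j => (b j).re) (fun j => (b j).im), hexp (fun j => -(b j).im) (fun j => (b j).re)]
  rw [← Finset.sum_add_distrib, Finset.mul_sum]
  unfold lev
  rw [Complex.re_sum]
  refine Finset.sum_congr rfl fun j _ => ?_
  rw [← Finset.sum_add_distrib, Finset.mul_sum, Complex.re_sum]
  refine Finset.sum_congr rfl fun k _ => ?_
  have hre : ∀ a : ℂ, (dd j (dbar k (rc Φ)) z) = (((1/4) * (A (Pi.single j 1) (Pi.single k 1) + A (Pi.single j I) (Pi.single k I)) : ℝ) : ℂ)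
     + (((1/4) * (A (Pi.single j 1) (Pi.single k I) - A (Pi.single j I) (Pi.single k 1)) : ℝ) : ℂ) * I := by
    intro _
    rw [dd, fderiv_dbar (rc_contDiff hΦ), fderiv_dbar (rc_contDiff hΦ), hfa, hfa, hfa, hfa]
    push_cast
    ring_nf
    rw [Complex.I_sq]; ring
  rw [hre 0, mul_assoc]
  simp only [Complex.mul_re, Complex.mul_im, Complex.add_re, Complex.add_im, Complex.ofReal_re, Complex.ofReal_im,
    Complex.I_re, Complex.I_im, Complex.conj_re, Complex.conj_im]
  ring

lemma lev_nonneg {Φ : (Fin n → ℂ) → ℝ} (hΦ : ContDiff ℝ 2 Φ) {δ : ℝ} (hδ : 0 < δ) (hs : SubM Φ δ)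
    (z b : Fin n → ℂ) : 0 ≤ lev Φ z b := by
  rw [lev_eq hΦ]
  set A := fderiv ℝ (fderiv ℝ Φ) z with hA
  set L := fderiv ℝ Φ z with hL
  suffices h : ∀ η > 0, -(4 * η * ‖b‖ ^ 2) ≤ A b b + A (I • b) (I • b) by
    have : 0 ≤ A b b + A (I • b) (I • b) := by
      by_contra hc; push Not at hc
      have h1 := h (-(A b b + A (I • b) (I • b)) / (8 * (‖b‖ ^ 2 + 1))) (by
        apply div_pos <;> [linarith; positivity])
      have h2 : 4 * (-(A b b + A (I • b) (I • b)) / (8 * (‖b‖ ^ 2 + 1))) * ‖b‖ ^ 2 ≤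
          -(A b b + A (I • b) (I • b)) / 2 := by
        have : 4 * (-(A b b + A (I • b) (I • b)) / (8 * (‖b‖ ^ 2 + 1))) * ‖b‖ ^ 2 =
          -(A b b + A (I • b) (I • b)) / 2 * (‖b‖ ^ 2 / (‖b‖ ^ 2 + 1)) := by field_simp; ring
        rw [this]
        refine mul_le_of_le_one_right (by linarith) ?_
        rw [div_le_one (by positivity)]; linarith
      linarith
    positivity
  intro η hη
  obtain ⟨δ', hδ', ht⟩ := taylor2 hΦ z hη
  obtain ⟨s, hs0, hs1⟩ : ∃ s : ℝ, 0 < s ∧ s * ‖b‖ < min δ δ' := by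
    refine ⟨min δ δ' / (‖b‖ + 1), by positivity, ?_⟩
    rw [div_mul_eq_mul_div, div_lt_iff₀ (by positivity)]
    have : 0 < min δ δ' := by positivity
    nlinarith
  have hn : ‖s • b‖ = s * ‖b‖ := by rw [norm_smul, Real.norm_of_nonneg hs0.le]
  have h1 := hs z (s • b) (by rw [hn]; exact lt_of_lt_of_le hs1 (min_le_left _ _))
  have hpt : ∀ θ : ℝ, Φ (z + Complex.exp (θ * I) • (s • b)) ≤ ((Φ z + η * (s * ‖b‖) ^ 2) +
      ((s * L b) * Real.cos θ + (s * L (I • b)) * Real.sin θ) +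
      ((s ^ 2 / 2 * A b b) * Real.cos θ ^ 2 + (s ^ 2 / 2 * (A b (I • b) + A (I • b) b)) * (Real.sin θ * Real.cos θ) +
       (s ^ 2 / 2 * A (I • b) (I • b)) * Real.sin θ ^ 2)) := by
    intro θ
    have hv : ‖Complex.exp (θ * I) • (s • b)‖ = s * ‖b‖ := by
      rw [norm_smul, Complex.norm_exp_ofReal_mul_I, one_mul, hn]
    have h2 := (abs_le.1 (ht _ (by rw [hv]; exact lt_of_lt_of_le hs1 (min_le_right _ _)))).2
    rw [hv] at h2
    have e : Complex.exp (θ * I) • (s • b) = (s * Real.cos θ) • b + (s * Real.sin θ) • (I • b) := by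
      rw [exp_smul, smul_comm I s b, smul_smul, smul_smul, mul_comm s, mul_comm s]
    have e1 : L (Complex.exp (θ * I) • (s • b)) = s * Real.cos θ * L b + s * Real.sin θ * L (I • b) := by
      rw [e, map_add, map_smul, map_smul]; rfl
    have e2 : A (Complex.exp (θ * I) • (s • b)) (Complex.exp (θ * I) • (s • b)) =
        s ^ 2 * (Real.cos θ ^ 2 * A b b + Real.sin θ * Real.cos θ * (A b (I • b) + A (I • b) b) +
          Real.sin θ ^ 2 * A (I • b) (I • b)) := by
      rw [e]
      simp only [map_add, map_smul, ContinuousLinearMap.add_apply, ContinuousLinearMap.smul_apply, smul_eq_mul]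
      ring
    rw [e1, e2] at h2
    linarith
  have h3 : cmean Φ z (s • b) ≤ _ := mul_le_mul_of_nonneg_left (intervalIntegral.integral_mono (by positivity)
    ((hΦ.continuous.comp (exp_circle_cont z (s • b))).intervalIntegrable _ _)
    (Continuous.intervalIntegrable (by fun_prop) _ _) hpt) (by positivity)
  rw [trig_mean] at h3
  have h4 : 0 ≤ s ^ 2 * (4 * η * ‖b‖ ^ 2 + (A b b + A (I • b) (I • b))) := by nlinarith
  have h5 := nonneg_of_mul_nonneg_right h4 (by positivity)
  linarith
end SOC

namespace SOC
variable {n : ℕ}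

/-- measurable and bounded on bounded sets -/
def LocB (u : (Fin n → ℂ) → ℝ) : Prop := Measurable u ∧ ∀ R : ℝ, ∃ C, ∀ z, ‖z‖ ≤ R → |u z| ≤ C

lemma LocB.locInt {u : (Fin n → ℂ) → ℝ} (h : LocB u) : LocallyIntegrable u volume := by
  rw [locallyIntegrable_iff]
  intro K hK
  obtain ⟨R, hR⟩ := hK.isBounded.subset_closedBall (0 : Fin n → ℂ)
  obtain ⟨C, hC⟩ := h.2 R
  haveI : IsFiniteMeasure (volume.restrict K) := ⟨by simpa using hK.measure_lt_top⟩
  refine Integrable.of_bound (C := C) h.1.aestronglyMeasurable ?_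
  filter_upwards [ae_restrict_mem hK.measurableSet] with z hz
  exact hC z (by simpa using hR hz)

lemma moll_sub_const {u : (Fin n → ℂ) → ℝ} (h : LocallyIntegrable u volume) {ε : ℝ} (hε : 0 < ε) (c : ℝ) (z : Fin n → ℂ) :
    moll ε (fun x => u x - c) z = moll ε u z - c := by
  rw [moll_eq, moll_eq]
  simp only [smul_eq_mul, mul_sub]
  have h1 := kap_smul_integrable' hε h z
  simp only [smul_eq_mul] at h1
  rw [integral_sub h1 ((kap_integrable hε).mul_const c), integral_mul_const, kap_integral hε, one_mul]

lemma circ_int {u : (Fin n → ℂ) → ℝ} (h : LocB u) (z w : Fin n → ℂ) :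
    IntervalIntegrable (fun θ : ℝ => u (z + Complex.exp (θ * I) • w)) volume 0 (2 * Real.pi) := by
  obtain ⟨C, hC⟩ := h.2 (‖z‖ + ‖w‖)
  rw [intervalIntegrable_iff]
  haveI : IsFiniteMeasure (volume.restrict (Set.uIoc 0 (2 * Real.pi))) := ⟨by simp [ENNReal.mul_lt_top]⟩
  refine Integrable.of_bound (C := C)
    (h.1.comp (exp_circle_cont z w).measurable).aestronglyMeasurable (Eventually.of_forall fun θ => ?_)
  refine hC _ ((norm_add_le _ _).trans ?_)
  rw [norm_smul, Complex.norm_exp_ofReal_mul_I, one_mul]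

lemma moll_ge {u : (Fin n → ℂ) → ℝ} (h : LocB u) {δ ε : ℝ} (hε : 0 < ε) (hεδ : ε ≤ δ) (hs : SubM u δ) (z : Fin n → ℂ) :
    u z ≤ moll ε u z := by
  have h1 := moll_sub_const h.locInt hε (u z) z
  obtain ⟨C, hC⟩ := h.2 (‖z‖ + ε)
  have h2 := moll_avg hε (f := fun x => u x - u z) (h.1.sub_const _).stronglyMeasurable z (C := C + |u z|) (fun t ht => by
    have : ‖t‖ ≤ ‖z‖ + ε := by
      have a := norm_add_le z (t - z)
      rw [add_sub_cancel] at a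
      rw [Metric.mem_ball, dist_eq_norm] at ht; linarith
    exact (norm_sub_le _ _).trans (add_le_add (hC t this) le_rfl))
  have h3 : 0 ≤ moll ε (fun x => u x - u z) z := by
    rw [h2]
    refine integral_nonneg fun t => ?_
    by_cases ht : ε ≤ ‖t‖
    · simp [kap_zero hε ht]
    push Not at ht
    simp only [smul_eq_mul]
    refine mul_nonneg (kap_nonneg hε t) ?_
    have h4 := hs z t (by linarith)
    unfold cmean at h4
    rw [intervalIntegral.integral_sub (circ_int h z t) (by simp), intervalIntegral.integral_const, mul_sub]
    simp only [smul_eq_mul, sub_zero]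
    rw [← mul_assoc, inv_mul_cancel₀ (by positivity)]
    linarith
  linarith

lemma moll_le {u : (Fin n → ℂ) → ℝ} (h : LocB u) {ε : ℝ} (hε : 0 < ε) {c : ℝ} {z : Fin n → ℂ}
    (hc : ∀ t ∈ Metric.ball z ε, u t ≤ c) : moll ε u z ≤ c := by
  have h1 := moll_sub_const h.locInt hε c z
  have h3 : moll ε (fun x => u x - c) z ≤ 0 := by
    unfold moll
    refine integral_nonpos fun t => ?_
    by_cases ht : ε ≤ ‖z - t‖
    · simp [kap_zero hε ht]
    simp only [smul_eq_mul]
    refine mul_nonpos_of_nonneg_of_nonpos (kap_nonneg hε _) ?_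
    have := hc t (by rw [Metric.mem_ball, dist_comm, dist_eq_norm]; exact not_le.1 ht)
    linarith
  linarith

lemma moll_subM {u : (Fin n → ℂ) → ℝ} (h : LocB u) {δ ε : ℝ} (hε : 0 < ε) (hs : SubM u δ) : SubM (moll ε u) δ := by
  intro z w hw
  have hsw : ∫ θ in (0 : ℝ)..(2 * Real.pi), moll ε u (z + Complex.exp (θ * I) • w) =
      ∫ t, kap ε t * ∫ θ in (0 : ℝ)..(2 * Real.pi), u (z - t + Complex.exp (θ * I) • w) ∧
      Integrable (fun t => kap ε t * ∫ θ in (0 : ℝ)..(2 * Real.pi), u (z - t + Complex.exp (θ * I) • w)) := by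
    have hI : Integrable (Function.uncurry fun (θ : ℝ) (t : Fin n → ℂ) => kap ε t * u (z - t + Complex.exp (θ * I) • w))
        ((volume.restrict (Ioc 0 (2 * Real.pi))).prod volume) := by
      obtain ⟨C, hC⟩ := h.2 (‖z‖ + ε + ‖w‖)
      have hm : Continuous fun p : ℝ × (Fin n → ℂ) => z - p.2 + Complex.exp (p.1 * I) • w := by fun_prop
      have hk : Continuous fun p : ℝ × (Fin n → ℂ) => kap ε p.2 := (kap_continuous ε).comp continuous_snd
      have hI : Integrable (fun p : ℝ × (Fin n → ℂ) => C * kap ε p.2)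
          ((volume.restrict (Ioc 0 (2 * Real.pi))).prod volume) := by
        have := (integrable_const (μ := volume.restrict (Ioc 0 (2 * Real.pi))) C).mul_prod
          (kap_integrable (n := n) hε)
        exact this
      refine hI.mono' (hk.aestronglyMeasurable.mul (h.1.comp hm.measurable).aestronglyMeasurable) ?_
      refine Filter.Eventually.of_forall fun p => ?_
      simp only [Function.uncurry]
      by_cases ht : ε ≤ ‖p.2‖
      · simp [kap_zero hε ht]
      · rw [norm_mul, Real.norm_of_nonneg (kap_nonneg hε _), mul_comm]
        refine mul_le_mul_of_nonneg_right (hC _ ?_) (kap_nonneg hε _)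
        refine (norm_add_le _ _).trans ?_
        rw [norm_smul, Complex.norm_exp_ofReal_mul_I, one_mul]
        have := norm_sub_le z p.2
        linarith
    constructor
    · rw [intervalIntegral.integral_of_le (by positivity)]
      simp_rw [moll_eq, smul_eq_mul]
      have e : ∀ (θ : ℝ) (t : Fin n → ℂ), z + Complex.exp (θ * I) • w - t = z - t + Complex.exp (θ * I) • w := fun θ t => by abel
      simp_rw [e]
      rw [integral_integral_swap hI]
      congr 1; ext t
      rw [intervalIntegral.integral_of_le (by positivity), integral_const_mul]
    · refine hI.integral_prod_right.congr (Eventually.of_forall fun t => ?_)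
      simp only [Function.uncurry]
      rw [intervalIntegral.integral_of_le (by positivity), integral_const_mul]
  unfold cmean
  rw [hsw.1, ← integral_const_mul, moll_eq]
  simp only [smul_eq_mul]
  have h1 := kap_smul_integrable' hε h.locInt z
  simp only [smul_eq_mul] at h1
  refine integral_mono h1 (hsw.2.const_mul _) fun t => ?_
  have := hs (z - t) w hw
  unfold cmean at this
  simp only []
  rw [mul_left_comm]
  exact mul_le_mul_of_nonneg_left this (kap_nonneg hε t)
end SOC

namespace SOC
variable {n : ℕ}

/-- approximability of `F` by a small power series in the weighted norm -/
def QQ (F : (Fin n → ℂ) → ℂ) (R : ℝ) (W : (Fin n → ℂ) → ℝ≥0∞) (K1 : ℝ) (K2 : ℝ≥0∞) : Prop :=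
  ∃ b : (Fin n → ℕ) → ℂ, (∀ α, ‖b α‖ * R ^ (∑ i, α i) ≤ K1) ∧
    ∫⁻ z in Metric.ball 0 R, ‖F z - ev b z‖ₑ ^ 2 * W z ≤ K2

lemma QQ_lim {F : (Fin n → ℂ) → ℂ} {R : ℝ} (hR : 0 < R) (hF : ContinuousOn F (Metric.ball 0 R))
    {W : (Fin n → ℂ) → ℝ≥0∞} {Wk : ℕ → (Fin n → ℂ) → ℝ≥0∞} {K1 : ℝ} {K2 : ℝ≥0∞}
    (hW : ∀ z ∈ Metric.ball (0 : Fin n → ℂ) R, Tendsto (fun k => Wk k z) atTop (nhds (W z)))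
    (hm : ∀ k, Measurable (Wk k)) (hQ : ∀ k, QQ F R (Wk k) K1 K2) : QQ F R W K1 K2 := by
  choose b hb1 hb2 using hQ
  obtain ⟨b', σ, hσ, hb', hlim⟩ := coef_compact hR b hb1
  refine ⟨b', hb', ?_⟩
  obtain ⟨s, hs⟩ := CV_of_bound (n := n) hR
  have hcont : ∀ k, ContinuousOn (ev (b k)) (Metric.ball 0 R) := by
    intro k
    intro z hz
    have hz' : ‖z‖ < R := by simpa using hz
    obtain ⟨R', h1, h2⟩ := exists_between hz'
    have := continuousOn_ev hR (hb1 k) h2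
    refine (this.continuousAt ?_).continuousWithinAt
    exact mem_of_superset (Metric.isOpen_ball.mem_nhds (by simpa using h1)) Metric.ball_subset_closedBall
  calc ∫⁻ z in Metric.ball 0 R, ‖F z - ev b' z‖ₑ ^ 2 * W z
      ≤ ∫⁻ z in Metric.ball 0 R, liminf (fun k => ‖F z - ev (b (σ k)) z‖ₑ ^ 2 * Wk (σ k) z) atTop := by
        refine setLIntegral_mono' Metric.isOpen_ball.measurableSet fun z hz => ?_
        have hz' : ‖z‖ < R := by simpa using hz
        by_cases h0 : ‖F z - ev b' z‖ₑ ^ 2 = 0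
        · rw [h0, zero_mul]; exact zero_le
        refine le_of_eq (Tendsto.liminf_eq ?_).symm
        refine ENNReal.Tendsto.mul ?_ (Or.inl h0) ((hW z hz).comp hσ.tendsto_atTop) (Or.inr ?_)
        · exact ((ENNReal.continuous_pow 2).tendsto _).comp ((continuous_enorm.tendsto _).comp ((hlim z hz').const_sub (F z)))
        · exact ENNReal.pow_ne_top enorm_ne_top
    _ ≤ liminf (fun k => ∫⁻ z in Metric.ball 0 R, ‖F z - ev (b (σ k)) z‖ₑ ^ 2 * Wk (σ k) z) atTop := by
        refine lintegral_liminf_le' fun k => ?_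
        refine AEMeasurable.mul ?_ (hm _).aemeasurable
        exact ((hF.sub (hcont _)).aestronglyMeasurable Metric.isOpen_ball.measurableSet).enorm.pow_const 2
    _ ≤ K2 := by
        refine liminf_le_of_frequently_le' (Frequently.of_forall fun k => hb2 (σ k))

theorem smooth_Q (n : ℕ) {R0 : ℝ} (hR0 : 0 < R0) (hR2 : R0 ≤ 1/2) : ∃ C : ℝ, 0 < C ∧ ∀ (F : (Fin n → ℂ) → ℂ),
    DifferentiableOn ℂ F (Metric.ball 0 1) →
    ∀ (Φ : (Fin n → ℂ) → ℝ), ContDiff ℝ 2 Φ → (∀ z b, 0 ≤ lev Φ z b) → ∀ T : ℝ, 1 ≤ T →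
    (∀ z, Φ z < -T → ‖z‖ ≤ 1/2) → (∀ z ∈ Metric.ball (0 : Fin n → ℂ) R0, Φ z ≤ 0) →
    ∀ (m : ℝ≥0∞), m ≠ ⊤ → ∫⁻ z in {z | Φ z < -T}, ‖F z‖ₑ ^ 2 ≤ m →
    QQ F (R0/4) (fun z => ENNReal.ofReal (Real.exp (- Φ z))) (Real.sqrt (C * T * Real.exp T * m.toReal))
      (ENNReal.ofReal (C * T * Real.exp T) * ∫⁻ z in Metric.closedBall 0 (1/2), ‖F z‖ₑ ^ 2) := by
  obtain ⟨C0, hC0, h0⟩ := smooth_est n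
  obtain ⟨C1, hC1, h1⟩ := holo_sup (n := n) (δ := R0/2) (by positivity)
  refine ⟨C0 * (C1 + 1), by positivity, ?_⟩
  intro F hF Φ hΦ hL T hT hsub hneg m hm hmle
  obtain ⟨H, hH, hH1, hH2⟩ := h0 F hF Φ hΦ hL T hT hsub R0 hR2 hneg
  have hsup : ∀ z ∈ Metric.ball (0 : Fin n → ℂ) (R0/2), ‖H z‖ ≤ Real.sqrt (C0 * (C1 + 1) * T * Real.exp T * m.toReal) := by
    intro z hz
    apply Real.le_sqrt_of_sq_le
    have a1 : ‖H z‖ₑ ^ 2 ≤ ENNReal.ofReal (C0 * (C1 + 1) * T * Real.exp T * m.toReal) := by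
      calc ‖H z‖ₑ ^ 2 ≤ ENNReal.ofReal C1 * ∫⁻ t in Metric.ball z (R0/2), ‖H t‖ₑ ^ 2 := h1 H hH z
        _ ≤ ENNReal.ofReal C1 * ∫⁻ t in Metric.ball 0 R0, ‖H t‖ₑ ^ 2 := by
          gcongr
          refine Metric.ball_subset_ball' ?_
          rw [Metric.mem_ball] at hz; linarith
        _ ≤ ENNReal.ofReal C1 * (ENNReal.ofReal (C0 * T * Real.exp T) * ENNReal.ofReal m.toReal) := by
          rw [ENNReal.ofReal_toReal hm]
          gcongr
          exact hH1.trans (by gcongr)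
        _ ≤ _ := by
          rw [← ENNReal.ofReal_mul (by positivity), ← ENNReal.ofReal_mul (by positivity)]
          apply ENNReal.ofReal_le_ofReal
          have : 0 ≤ C0 * T * Real.exp T * m.toReal := by positivity
          nlinarith
    rw [← ofReal_norm, ← ENNReal.ofReal_pow (norm_nonneg _)] at a1
    exact (ENNReal.ofReal_le_ofReal_iff (by positivity)).1 a1
  obtain ⟨a, ha, hsum⟩ := exists_powerseries n (R := R0/2) (R' := R0/4) (by positivity) (by linarith) _ H hH.differentiableOn hsup
  refine ⟨a, ha, ?_⟩
  calc ∫⁻ z in Metric.ball 0 (R0/4), ‖F z - ev a z‖ₑ ^ 2 * ENNReal.ofReal (Real.exp (- Φ z))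
      = ∫⁻ z in Metric.ball 0 (R0/4), ‖F z - H z‖ₑ ^ 2 * ENNReal.ofReal (Real.exp (- Φ z)) := by
        refine setLIntegral_congr_fun Metric.isOpen_ball.measurableSet fun z hz => ?_
        have : ev a z = H z := (hsum z (by simpa using hz)).tsum_eq
        simp only [this]
    _ ≤ ∫⁻ z in Metric.ball 0 R0, ‖F z - H z‖ₑ ^ 2 * ENNReal.ofReal (Real.exp (- Φ z)) :=
        lintegral_mono_set (Metric.ball_subset_ball (by linarith))
    _ ≤ _ := hH2.trans (by
        gcongr
        have : 0 < C0 := hC0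
        nlinarith)

theorem usc_Q (n : ℕ) {R0 : ℝ} (hR0 : 0 < R0) (hR2 : R0 ≤ 1/2) : ∃ C : ℝ, 0 < C ∧ ∀ (F : (Fin n → ℂ) → ℂ),
    DifferentiableOn ℂ F (Metric.ball 0 1) →
    ∀ (u : (Fin n → ℂ) → ℝ), LocB u → UpperSemicontinuous u → SubM u (1/2) → ∀ T : ℝ, 1 ≤ T →
    (∀ z, u z < -T → ‖z‖ ≤ 1/2) → (∀ z ∈ Metric.ball (0 : Fin n → ℂ) (2 * R0), u z ≤ 0) →
    ∀ (m : ℝ≥0∞), m ≠ ⊤ → ∫⁻ z in {z | u z < -T}, ‖F z‖ₑ ^ 2 ≤ m →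
    QQ F (R0/4) (fun z => ENNReal.ofReal (Real.exp (- u z))) (Real.sqrt (C * T * Real.exp T * m.toReal))
      (ENNReal.ofReal (C * T * Real.exp T) * ∫⁻ z in Metric.closedBall 0 (1/2), ‖F z‖ₑ ^ 2) := by
  obtain ⟨C, hC, h⟩ := smooth_Q n hR0 hR2
  refine ⟨C, hC, fun F hF u hu husc hs T hT hsub hneg m hm hmle => ?_⟩
  have hεk : ∀ k : ℕ, 0 < R0 * ee k := fun k => mul_pos hR0 (ee_pos k)
  have hεk1 : ∀ k : ℕ, R0 * ee k ≤ R0 := fun k => mul_le_of_le_one_right hR0.le (ee_le k)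
  have hcd : ∀ k, ContDiff ℝ 2 (moll (R0 * ee k) u) := fun k => moll_contDiff (m := 2) (hεk k) hu.locInt
  have hge : ∀ k z, u z ≤ moll (R0 * ee k) u z := fun k z => moll_ge hu (hεk k) ((hεk1 k).trans hR2) hs z
  refine QQ_lim (by positivity) (hF.continuousOn.mono (Metric.ball_subset_ball (by linarith)))
    (Wk := fun k z => ENNReal.ofReal (Real.exp (- moll (R0 * ee k) u z))) ?_ ?_ ?_
  · intro z _
    refine ENNReal.tendsto_ofReal ((Real.continuous_exp.tendsto _).comp (Filter.Tendsto.neg ?_))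
    rw [Metric.tendsto_atTop]
    intro η hη
    obtain ⟨δ, hδ, h1⟩ := Metric.eventually_nhds_iff_ball.1 (husc z (u z + η/2) (by linarith))
    have h2 : Tendsto (fun k => R0 * ee k) atTop (nhds 0) := by
      have := ee_tendsto.const_mul R0
      simpa using this
    obtain ⟨N, hN⟩ := eventually_atTop.1 (h2.eventually (gt_mem_nhds hδ))
    refine ⟨N, fun k hk => ?_⟩
    have h3 : moll (R0 * ee k) u z ≤ u z + η / 2 := moll_le hu (hεk k) fun t ht =>
      (h1 t (Metric.ball_subset_ball (hN k hk).le ht)).le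
    rw [Real.dist_eq, abs_lt]
    have := hge k z
    constructor <;> linarith
  · intro k
    have := (hcd k).continuous
    fun_prop
  · intro k
    refine h F hF _ (hcd k) (lev_nonneg (hcd k) (by norm_num) (moll_subM hu (hεk k) hs)) T hT
      (fun z hz => hsub z (lt_of_le_of_lt (hge k z) hz)) (fun z hz => ?_) m hm
      (le_trans (lintegral_mono_set fun z hz => lt_of_le_of_lt (hge k z) hz) hmle)
    refine moll_le hu (hεk k) fun t ht => hneg t ?_
    rw [Metric.mem_ball, dist_zero_right] at hz ⊢
    rw [Metric.mem_ball, dist_eq_norm] at ht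
    have := norm_add_le (t - z) z
    rw [sub_add_cancel] at this
    have := hεk1 k
    linarith
end SOC

namespace SOC
variable {n : ℕ}

/-- truncation -/
noncomputable def tr (N : ℝ) (x : EReal) : ℝ := (x ⊔ ((-N : ℝ) : EReal)).toReal

lemma tr_coe {N : ℝ} {x : EReal} (hx : x < 0) : ((tr N x : ℝ) : EReal) = x ⊔ ((-N : ℝ) : EReal) := by
  unfold tr
  refine EReal.coe_toReal ?_ ?_
  · exact (max_lt (hx.trans (by simp)) (EReal.coe_lt_top _)).ne
  · exact (lt_of_lt_of_le (EReal.bot_lt_coe _) le_sup_right).ne'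
lemma tr_ge {N : ℝ} {x : EReal} (hx : x < 0) : -N ≤ tr N x := by
  have := le_sup_right (a := x) (b := ((-N : ℝ) : EReal))
  rw [← tr_coe hx] at this; exact_mod_cast this
lemma le_tr {N : ℝ} {x : EReal} (hx : x < 0) : x ≤ (tr N x : ℝ) := by
  rw [tr_coe hx]; exact le_sup_left
lemma tr_lt {N c : ℝ} {x : EReal} (hx : x < 0) (h1 : x < c) (h2 : -N < c) : tr N x < c := by
  have : ((tr N x : ℝ) : EReal) < c := by rw [tr_coe hx]; exact max_lt h1 (by exact_mod_cast h2)
  exact_mod_cast this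
lemma tr_le {N c : ℝ} {x : EReal} (hx : x < 0) (h1 : x ≤ c) (h2 : -N ≤ c) : tr N x ≤ c := by
  have : ((tr N x : ℝ) : EReal) ≤ c := by rw [tr_coe hx]; exact max_le h1 (by exact_mod_cast h2)
  exact_mod_cast this

noncomputable def qN (N : ℝ) (z : Fin n → ℂ) : ℝ := N * (4 * qq z - 1)
open Classical in
noncomputable def vN (φ : (Fin n → ℂ) → EReal) (N : ℝ) (z : Fin n → ℂ) : ℝ :=
  if ‖z‖ < 1 then max (tr N (φ z)) (qN N z) else qN N z

lemma qN_continuous (N : ℝ) : Continuous (qN (n := n) N) := by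
  unfold qN; have := qq_continuous (n := n); fun_prop

lemma qq_mean (z w : Fin n → ℂ) (N : ℝ) : cmean (qN N) z w = qN N z + 4 * N * qq w := by
  unfold cmean
  have : ∀ θ : ℝ, qN N (z + Complex.exp (θ * I) • w) = ((qN N z + 4 * N * qq w) +
      ((8 * N * ∑ i, (z i * (starRingEnd ℂ) (w i)).re) * Real.cos θ +
        (8 * N * ∑ i, (z i * (starRingEnd ℂ) (w i)).im) * Real.sin θ) +
        (0 * Real.cos θ ^ 2 + 0 * (Real.sin θ * Real.cos θ) + 0 * Real.sin θ ^ 2)) := by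
    intro θ
    have e : qq (z + Complex.exp (θ * I) • w) = qq z + qq w + ((2 * ∑ i, (z i * (starRingEnd ℂ) (w i)).re) * Real.cos θ +
        (2 * ∑ i, (z i * (starRingEnd ℂ) (w i)).im) * Real.sin θ) := by
      unfold qq
      simp only [Finset.mul_sum, Finset.sum_mul]
      rw [← Finset.sum_add_distrib, ← Finset.sum_add_distrib, ← Finset.sum_add_distrib]
      refine Finset.sum_congr rfl fun i _ => ?_
      have h1 := Real.sin_sq_add_cos_sq θ
      have hre : (Complex.exp (θ * I)).re = Real.cos θ := Complex.exp_ofReal_mul_I_re θ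
      have him : (Complex.exp (θ * I)).im = Real.sin θ := Complex.exp_ofReal_mul_I_im θ
      simp only [Pi.add_apply, Pi.smul_apply, smul_eq_mul, Complex.normSq_apply, Complex.add_re, Complex.add_im,
        Complex.mul_re, Complex.mul_im, hre, him, Complex.conj_re, Complex.conj_im]
      linear_combination ((w i).re ^ 2 + (w i).im ^ 2) * h1
    unfold qN
    rw [e]; ring
  simp_rw [this]
  rw [trig_mean]; ring

section
variable {φ : (Fin n → ℂ) → EReal} (hneg : ∀ z ∈ Metric.ball (0 : Fin n → ℂ) 1, φ z < 0)

lemma norm_lt_of_qq {z : Fin n → ℂ} {r : ℝ} (hr : 0 < r) (h : qq z < r ^ 2) : ‖z‖ < r :=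
  lt_of_pow_lt_pow_left₀ 2 hr.le (lt_of_le_of_lt (sq_norm_le_qq z) h)

lemma vN_ge (N : ℝ) (z : Fin n → ℂ) : qN N z ≤ vN φ N z := by
  unfold vN; split_ifs
  · exact le_max_right _ _
  · exact le_rfl

lemma vN_le (hneg : ∀ z ∈ Metric.ball (0 : Fin n → ℂ) 1, φ z < 0) {N : ℝ} (hN : 0 ≤ N) (z : Fin n → ℂ) :
    vN φ N z ≤ max 0 (qN N z) := by
  unfold vN; split_ifs with h
  · refine max_le_max ?_ le_rfl
    have := hneg z (by simpa using h)
    exact tr_le this (by simpa using this.le) (by linarith)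
  · exact le_max_right _ _

lemma vN_eq_q (hneg : ∀ z ∈ Metric.ball (0 : Fin n → ℂ) 1, φ z < 0) {N : ℝ} (hN : 0 ≤ N) {z : Fin n → ℂ} (hz : 1/4 ≤ qq z) :
    vN φ N z = qN N z := by
  refine le_antisymm ((vN_le hneg hN z).trans (max_le ?_ le_rfl)) (vN_ge N z)
  unfold qN; exact mul_nonneg hN (by linarith)

lemma vN_usc (hneg : ∀ z ∈ Metric.ball (0 : Fin n → ℂ) 1, φ z < 0) (husc : UpperSemicontinuousOn φ (Metric.ball 0 1))
    {N : ℝ} (hN : 0 ≤ N) : UpperSemicontinuous (vN φ N) := by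
  intro z c hc
  have hq : ∀ᶠ t in nhds z, qN N t < c :=
    (qN_continuous N).continuousAt.eventually_lt_const (lt_of_le_of_lt (vN_ge N z) hc)
  by_cases hz : ‖z‖ < 1
  · have hzb : z ∈ Metric.ball (0 : Fin n → ℂ) 1 := by simpa using hz
    have h1 : tr N (φ z) < c := by
      unfold vN at hc; rw [if_pos hz] at hc; exact lt_of_le_of_lt (le_max_left _ _) hc
    have h2 : φ z < (c : EReal) := lt_of_le_of_lt (le_tr (hneg z hzb)) (by exact_mod_cast h1)
    have h3 := husc z hzb _ h2
    rw [Metric.isOpen_ball.nhdsWithin_eq hzb] at h3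
    filter_upwards [hq, h3, Metric.isOpen_ball.mem_nhds hzb] with t ht1 ht2 ht3
    unfold vN
    rw [if_pos (by simpa using ht3)]
    exact max_lt (tr_lt (hneg t ht3) ht2 (lt_of_le_of_lt (tr_ge (hneg z hzb)) h1)) ht1
  · have h4 : (1:ℝ)/4 < qq z := by have := sq_norm_le_qq z; push Not at hz; nlinarith
    filter_upwards [hq, qq_continuous.continuousAt.eventually_const_lt h4] with t ht1 ht2
    rw [vN_eq_q hneg hN ht2.le]; exact ht1

lemma vN_locB (hneg : ∀ z ∈ Metric.ball (0 : Fin n → ℂ) 1, φ z < 0) (husc : UpperSemicontinuousOn φ (Metric.ball 0 1))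
    {N : ℝ} (hN : 0 ≤ N) : LocB (vN φ N) := by
  refine ⟨(vN_usc hneg husc hN).measurable, fun R => ?_⟩
  obtain ⟨C, hC⟩ := (isCompact_closedBall (0 : Fin n → ℂ) R).exists_bound_of_continuousOn (qN_continuous N).continuousOn
  refine ⟨C, fun z hz => ?_⟩
  have h1 := abs_le.1 (hC z (by simpa using hz))
  have h2 := vN_le hneg hN z
  have h3 := vN_ge (φ := φ) N z
  refine abs_le.2 ⟨by linarith, h2.trans (max_le (by linarith) h1.2)⟩

lemma vN_subM (hneg : ∀ z ∈ Metric.ball (0 : Fin n → ℂ) 1, φ z < 0) (husc : UpperSemicontinuousOn φ (Metric.ball 0 1))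
    (hsm : ∀ z₀ ∈ Metric.ball (0 : Fin n → ℂ) 1, ∀ w : Fin n → ℂ, ∀ ρ : ℝ, 0 < ρ →
    (∀ t : ℂ, ‖t‖ ≤ ρ → z₀ + t • w ∈ Metric.ball (0 : Fin n → ℂ) 1) →
    ∀ M : ℝ, φ z₀ ≤
      (((2 * Real.pi)⁻¹ * ∫ θ in (0 : ℝ)..(2 * Real.pi),
        (φ (z₀ + ((ρ : ℂ) * Complex.exp (θ * Complex.I)) • w) ⊔ (M : EReal)).toReal : ℝ) : EReal))
    {N : ℝ} (hN : 0 ≤ N) : SubM (vN φ N) (1/2) := by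
  intro z w hw
  have hB := vN_locB hneg husc hN
  have hq : qN N z ≤ cmean (vN φ N) z w := by
    have h1 := qq_mean z w N
    have h2 : cmean (qN N) z w ≤ cmean (vN φ N) z w := by
      unfold cmean
      refine mul_le_mul_of_nonneg_left (intervalIntegral.integral_mono (by positivity) 
        (((qN_continuous N).comp (exp_circle_cont z w)).intervalIntegrable _ _) (circ_int hB z w) fun θ => vN_ge N _) (by positivity)
    have := qq_nonneg w
    nlinarith [mul_nonneg hN this]
  by_cases hz : 1/4 ≤ qq z
  · rw [vN_eq_q hneg hN hz]; exact hq
  push Not at hz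
  have hz2 : ‖z‖ < 1/2 := norm_lt_of_qq (by norm_num) (by linarith)
  have hzb : z ∈ Metric.ball (0 : Fin n → ℂ) 1 := by simp; linarith
  have hdisc : ∀ t : ℂ, ‖t‖ ≤ 1 → ‖z + t • w‖ < 1 := fun t ht => by
    have := norm_add_le z (t • w)
    rw [norm_smul] at this
    nlinarith [norm_nonneg w]
  have h1 := hsm z hzb w 1 one_pos (fun t ht => by simpa using hdisc t ht) (-N)
  have hexp : ∀ θ : ℝ, ‖z + Complex.exp (θ * I) • w‖ < 1 := fun θ =>
    hdisc _ (by rw [Complex.norm_exp_ofReal_mul_I])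
  have htr : IntervalIntegrable (fun θ : ℝ => tr N (φ (z + Complex.exp (θ * I) • w))) volume 0 (2 * Real.pi) := by
    have hu : UpperSemicontinuous (fun θ : ℝ => tr N (φ (z + Complex.exp (θ * I) • w))) := by
      intro θ c hc
      have hb : z + Complex.exp (θ * I) • w ∈ Metric.ball (0 : Fin n → ℂ) 1 := by simpa using hexp θ
      have h2 : φ (z + Complex.exp (θ * I) • w) < (c : EReal) :=
        lt_of_le_of_lt (le_tr (N := N) (hneg _ hb)) (by exact_mod_cast hc)
      have h3 := husc _ hb _ h2
      rw [Metric.isOpen_ball.nhdsWithin_eq hb] at h3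
      have h4 := (exp_circle_cont z w).continuousAt.eventually h3
      filter_upwards [h4] with t ht
      exact tr_lt (hneg _ (by simpa using hexp t)) ht (lt_of_le_of_lt (tr_ge (hneg _ hb)) hc)
    rw [intervalIntegrable_iff]
    haveI : IsFiniteMeasure (volume.restrict (Set.uIoc 0 (2 * Real.pi))) := ⟨by simp [ENNReal.mul_lt_top]⟩
    refine Integrable.of_bound hu.measurable.aestronglyMeasurable N (Filter.Eventually.of_forall fun θ => ?_)
    have hb := hneg (z + Complex.exp (θ * I) • w) (by simpa using hexp θ)
    rw [Real.norm_eq_abs, abs_le]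
    exact ⟨tr_ge hb, (tr_le (c := 0) hb (by simpa using hb.le) (by linarith)).trans hN⟩
  have h2 : φ z ≤ ((cmean (vN φ N) z w : ℝ) : EReal) := by
    refine h1.trans ?_
    rw [EReal.coe_le_coe_iff]
    unfold cmean
    refine mul_le_mul_of_nonneg_left ?_ (by positivity)
    simp only [Complex.ofReal_one, one_mul]
    refine intervalIntegral.integral_mono (by positivity) htr (circ_int hB z w) fun θ => ?_
    unfold vN
    simp only [if_pos (hexp θ)]
    exact le_max_left _ _
  have h3 : -N ≤ cmean (vN φ N) z w := by
    refine le_trans ?_ hq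
    unfold qN; nlinarith [mul_nonneg hN (qq_nonneg z)]
  unfold vN
  rw [if_pos (by linarith)]
  exact max_le (tr_le (hneg z hzb) h2 h3) hq
end
end SOC

namespace SOC
variable {n : ℕ}

lemma LocB.const_mul {u : (Fin n → ℂ) → ℝ} (h : LocB u) (p : ℝ) : LocB (fun z => p * u z) := by
  refine ⟨h.1.const_mul p, fun R => ?_⟩
  obtain ⟨C, hC⟩ := h.2 R
  refine ⟨|p| * C, fun z hz => ?_⟩
  rw [abs_mul]
  exact mul_le_mul_of_nonneg_left (hC z hz) (abs_nonneg _)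

lemma SubM.const_mul {u : (Fin n → ℂ) → ℝ} {δ : ℝ} (h : SubM u δ) {p : ℝ} (hp : 0 ≤ p) :
    SubM (fun z => p * u z) δ := by
  intro z w hw
  have := mul_le_mul_of_nonneg_left (h z w hw) hp
  refine this.trans (le_of_eq ?_)
  unfold cmean
  rw [intervalIntegral.integral_const_mul]; ring

lemma usc_const_mul {u : (Fin n → ℂ) → ℝ} (h : UpperSemicontinuous u) {p : ℝ} (hp : 0 < p) :
    UpperSemicontinuous (fun z => p * u z) := by
  intro z c hc
  have h1 : u z < c / p := by rw [lt_div_iff₀ hp]; linarith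
  filter_upwards [h z _ h1] with t ht
  rw [lt_div_iff₀ hp] at ht; linarith

lemma vN_tendsto {φ : (Fin n → ℂ) → EReal} (hneg : ∀ z ∈ Metric.ball (0 : Fin n → ℂ) 1, φ z < 0)
    {p : ℝ} (hp : 0 < p) {z : Fin n → ℂ} (hz1 : ‖z‖ < 1) (hz : qq z < 1/4) :
    Tendsto (fun k : ℕ => ENNReal.ofReal (Real.exp (-(p * vN φ (k : ℝ) z)))) atTop
      (nhds (EReal.exp (-((p : EReal) * φ z)))) := by
  have hn := hneg z (by simpa using hz1)
  have hd : 0 < 1 - 4 * qq z := by linarith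
  have hlim : Tendsto (fun k : ℕ => (k : ℝ) * (1 - 4 * qq z)) atTop atTop :=
    tendsto_natCast_atTop_atTop.atTop_mul_const hd
  have hq := qq_nonneg z
  induction hx : φ z with
  | top => rw [hx] at hn; simp at hn
  | bot =>
    rw [EReal.coe_mul_bot_of_pos hp, EReal.neg_bot, EReal.exp_top]
    refine ENNReal.tendsto_ofReal_nhds_top.2 (Real.tendsto_exp_atTop.comp ?_)
    have : ∀ k : ℕ, vN φ (k : ℝ) z = -((k : ℝ) * (1 - 4 * qq z)) := by
      intro k
      unfold vN
      rw [if_pos hz1, hx]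
      have : tr (k:ℝ) ⊥ = -(k:ℝ) := by unfold tr; simp [-EReal.coe_neg]
      rw [this]
      unfold qN
      rw [max_eq_right]
      · ring
      · nlinarith [mul_nonneg (Nat.cast_nonneg (α := ℝ) k) hq]
    simp_rw [this]
    have e : ∀ k : ℕ, -(p * -((k:ℝ) * (1 - 4 * qq z))) = p * ((k:ℝ) * (1 - 4 * qq z)) := fun k => by ring
    simp_rw [e]
    exact hlim.const_mul_atTop hp
  | coe x =>
    have e : -((p : EReal) * (x : EReal)) = ((-(p * x) : ℝ) : EReal) := by push_cast; rfl
    rw [e, EReal.exp_coe]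
    refine tendsto_const_nhds.congr' ?_
    filter_upwards [hlim.eventually_ge_atTop (-x)] with k hk
    congr 4
    unfold vN
    rw [if_pos hz1, hx]
    have : tr (k:ℝ) (x : EReal) = x := by
      unfold tr
      rw [sup_eq_left.2]
      · simp
      · rw [EReal.coe_le_coe_iff]
        nlinarith [mul_nonneg (Nat.cast_nonneg (α := ℝ) k) hq]
    rw [this, max_eq_left]
    unfold qN; nlinarith

theorem psh_Q (n : ℕ) : ∃ C R : ℝ, 0 < C ∧ 0 < R ∧ R ≤ 1/4 ∧ ∀ (F : (Fin n → ℂ) → ℂ),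
    DifferentiableOn ℂ F (Metric.ball 0 1) →
    ∀ (φ : (Fin n → ℂ) → EReal), (∀ z ∈ Metric.ball (0 : Fin n → ℂ) 1, φ z < 0) →
    UpperSemicontinuousOn φ (Metric.ball 0 1) →
    (∀ z₀ ∈ Metric.ball (0 : Fin n → ℂ) 1, ∀ w : Fin n → ℂ, ∀ ρ : ℝ, 0 < ρ →
    (∀ t : ℂ, ‖t‖ ≤ ρ → z₀ + t • w ∈ Metric.ball (0 : Fin n → ℂ) 1) →
    ∀ M : ℝ, φ z₀ ≤
      (((2 * Real.pi)⁻¹ * ∫ θ in (0 : ℝ)..(2 * Real.pi),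
        (φ (z₀ + ((ρ : ℂ) * Complex.exp (θ * Complex.I)) • w) ⊔ (M : EReal)).toReal : ℝ) : EReal)) →
    ∀ p T : ℝ, 0 < p → 1 ≤ T → ∀ m : ℝ≥0∞, m ≠ ⊤ →
    ∫⁻ z in {z | z ∈ Metric.ball 0 1 ∧ φ z < ((-(T / p) : ℝ) : EReal)}, ‖F z‖ₑ ^ 2 ≤ m →
    QQ F R (fun z => EReal.exp (-((p : EReal) * φ z))) (Real.sqrt (C * T * Real.exp T * m.toReal))
      (ENNReal.ofReal (C * T * Real.exp T) * ∫⁻ z in Metric.closedBall 0 (1/2), ‖F z‖ₑ ^ 2) := by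
  set R0 : ℝ := 1 / (4 * ((n:ℝ) + 1)) with hR0d
  have hn1 : (0:ℝ) < (n:ℝ) + 1 := by positivity
  have hR0 : 0 < R0 := by positivity
  have hR0n : R0 * ((n:ℝ)+1) = 1/4 := by rw [hR0d]; field_simp
  have hnn : (0:ℝ) ≤ n := Nat.cast_nonneg n
  have hR4 : R0 ≤ 1/4 := by nlinarith [mul_nonneg hR0.le hnn]
  have hqq : ∀ z : Fin n → ℂ, ‖z‖ < 2 * R0 → qq z < 1/4 := by
    intro z hz
    have h1 := qq_le z
    have h0 := norm_nonneg z
    have h2 : (n:ℝ) * ‖z‖ ≤ ((n:ℝ)+1) * (2 * R0) := by nlinarith [mul_nonneg hnn (sub_nonneg.2 hz.le)]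
    have h3 : (n:ℝ) * ‖z‖ ≤ 1/2 := by nlinarith
    have h4 : (n:ℝ) * ‖z‖ ^ 2 ≤ 1/2 * ‖z‖ := by nlinarith
    nlinarith
  obtain ⟨C, hC, h⟩ := usc_Q n hR0 (by linarith : R0 ≤ 1/2)
  refine ⟨C, R0 / 4, hC, by positivity, by linarith, fun F hF φ hneg husc hsm p T hp hT m hm hle => ?_⟩
  have hw : ∀ k : ℕ, Measurable (fun z => ENNReal.ofReal (Real.exp (-(p * vN φ (k : ℝ) z)))) := by
    intro k
    have := (vN_locB hneg husc (Nat.cast_nonneg (α := ℝ) k)).1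
    exact ENNReal.measurable_ofReal.comp (Real.measurable_exp.comp (this.const_mul p).neg)
  refine QQ_lim (by positivity) (hF.continuousOn.mono (Metric.ball_subset_ball (by linarith)))
    (Wk := fun k z => ENNReal.ofReal (Real.exp (-(p * vN φ (k : ℝ) z)))) ?_ hw ?_
  · intro z hz
    have hz' : ‖z‖ < R0 / 4 := by simpa using hz
    exact vN_tendsto hneg hp (by linarith) (hqq z (by linarith))
  · intro k
    have hk : (0:ℝ) ≤ (k:ℝ) := Nat.cast_nonneg k
    have hsub : ∀ z, p * vN φ (k : ℝ) z < -T → ‖z‖ < 1/2 ∧ φ z < ((-(T / p) : ℝ) : EReal) := by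
      intro z hz
      have h1 : vN φ (k : ℝ) z < -(T / p) := by
        rw [← neg_div, lt_div_iff₀ hp]; linarith
      have hTp : 0 < T / p := by positivity
      have h2 : qq z < 1/4 := by
        by_contra hcon
        push Not at hcon
        have := vN_ge (φ := φ) (k:ℝ) z
        unfold qN at this
        nlinarith [mul_nonneg hk (by linarith : 0 ≤ 4 * qq z - 1)]
      have h3 : ‖z‖ < 1/2 := norm_lt_of_qq (by norm_num) (by linarith)
      refine ⟨h3, ?_⟩
      have hb : ‖z‖ < 1 := by linarith
      refine lt_of_le_of_lt (le_tr (N := (k:ℝ)) (hneg z (by simpa using hb))) ?_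
      rw [EReal.coe_lt_coe_iff]
      refine lt_of_le_of_lt ?_ h1
      unfold vN
      rw [if_pos hb]; exact le_max_left _ _
    refine h F hF _ ((vN_locB hneg husc hk).const_mul p) (usc_const_mul (vN_usc hneg husc hk) hp)
      ((vN_subM hneg husc hsm hk).const_mul hp.le) T hT (fun z hz => (hsub z hz).1.le) ?_ m hm ?_
    · intro z hz
      have hz' := hqq z (by simpa using hz)
      have h1 := vN_le hneg hk z
      have h2 : qN (k:ℝ) z ≤ 0 := by unfold qN; nlinarith [mul_nonneg hk (by linarith : 0 ≤ 1 - 4 * qq z)]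
      rw [max_eq_left h2] at h1
      nlinarith
    · refine le_trans (lintegral_mono_set ?_) hle
      intro z hz
      have := hsub z hz
      exact ⟨by simp; linarith [this.1], this.2⟩
end SOC

namespace SOC
variable {n : ℕ}

/-- the weight -/
noncomputable def wt (φ : (Fin n → ℂ) → EReal) (p : ℝ) (z : Fin n → ℂ) : ℝ≥0∞ := EReal.exp (-((p : EReal) * φ z))

lemma wt_mono {φ : (Fin n → ℂ) → EReal} {p p' : ℝ} (hp : 0 < p) (h : p ≤ p') {z : Fin n → ℂ} (hz : φ z < 0) :
    wt φ p z ≤ wt φ p' z := by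
  unfold wt
  have hp' := hp.trans_le h
  induction hx : φ z with
  | top => rw [hx] at hz; simp at hz
  | bot => rw [EReal.coe_mul_bot_of_pos hp, EReal.coe_mul_bot_of_pos hp']
  | coe x =>
    have e : ∀ p : ℝ, -((p : EReal) * (x : EReal)) = ((-(p * x) : ℝ) : EReal) := fun p => by push_cast; rfl
    rw [hx] at hz
    have hx0 : x < 0 := by exact_mod_cast hz
    rw [e, e, EReal.exp_le_exp_iff, EReal.coe_le_coe_iff]
    nlinarith

lemma wt_anti {p : ℝ} (hp : 0 < p) : Antitone (fun x : EReal => EReal.exp (-((p : EReal) * x))) := by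
  intro x y hxy
  refine EReal.exp_monotone ?_
  rw [EReal.neg_le_neg_iff]
  exact mul_le_mul_of_nonneg_left hxy (by exact_mod_cast hp.le)

lemma open_sub {φ : (Fin n → ℂ) → EReal} (husc : UpperSemicontinuousOn φ (Metric.ball 0 1)) (c : EReal) :
    IsOpen {z | z ∈ Metric.ball (0 : Fin n → ℂ) 1 ∧ φ z < c} := by
  rw [isOpen_iff_mem_nhds]
  rintro z ⟨hz, hc⟩
  have h3 := husc z hz _ hc
  rw [Metric.isOpen_ball.nhdsWithin_eq hz] at h3
  filter_upwards [h3, Metric.isOpen_ball.mem_nhds hz] with t h1 h2 using ⟨h2, h1⟩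

lemma wt_meas {φ : (Fin n → ℂ) → EReal} (husc : UpperSemicontinuousOn φ (Metric.ball 0 1)) {p : ℝ} (hp : 0 < p)
    {ρ : ℝ} (hρ : ρ ≤ 1) : AEMeasurable (wt φ p) (volume.restrict (Metric.ball 0 ρ)) := by
  classical
  have h1 : Measurable (fun z => if z ∈ Metric.ball (0 : Fin n → ℂ) 1 then φ z else ⊤) := by
    refine measurable_of_Iio fun c => ?_
    convert (open_sub husc c).measurableSet using 1
    ext z
    by_cases h : z ∈ Metric.ball (0 : Fin n → ℂ) 1
    · simp only [mem_preimage, mem_Iio, mem_setOf_eq, h, true_and, ↓reduceIte]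
    · simp only [mem_preimage, mem_Iio, mem_setOf_eq, h, false_and, ↓reduceIte, not_top_lt]
  have h2 := ((wt_anti hp).measurable).comp h1
  refine h2.aemeasurable.congr ?_
  filter_upwards [ae_restrict_mem Metric.isOpen_ball.measurableSet] with z hz
  have := Metric.ball_subset_ball hρ hz
  simp only [Function.comp, if_pos this, wt]

/-- multiplier ideal of exponents larger than one -/
def JJ (φ : (Fin n → ℂ) → EReal) : Set ((Fin n → ℂ) → ℂ) :=
  {f | ∃ p ρ : ℝ, 1 < p ∧ 0 < ρ ∧ ρ ≤ 1 ∧ ContinuousOn f (Metric.ball 0 ρ) ∧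
    ∫⁻ z in Metric.ball 0 ρ, ‖f z‖ₑ ^ 2 * wt φ p z < ⊤}

lemma enorm_add_sq (a b : ℂ) : ‖a + b‖ₑ ^ 2 ≤ 2 * ‖a‖ₑ ^ 2 + 2 * ‖b‖ₑ ^ 2 := by
  have h : ‖a + b‖ ^ 2 ≤ 2 * ‖a‖ ^ 2 + 2 * ‖b‖ ^ 2 := by
    have := norm_add_le a b
    nlinarith [sq_nonneg (‖a‖ - ‖b‖), norm_nonneg (a+b), norm_nonneg a, norm_nonneg b]
  have e : ∀ a : ℂ, ‖a‖ₑ ^ 2 = ENNReal.ofReal (‖a‖ ^ 2) := fun a => by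
    rw [← ofReal_norm_eq_enorm, ENNReal.ofReal_pow (norm_nonneg _)]
  have e2 : (2 : ℝ≥0∞) = ENNReal.ofReal 2 := by simp
  rw [e, e, e, e2, ← ENNReal.ofReal_mul (by norm_num), ← ENNReal.ofReal_mul (by norm_num),
    ← ENNReal.ofReal_add (by positivity) (by positivity)]
  exact ENNReal.ofReal_le_ofReal h

lemma JJ_germ {φ : (Fin n → ℂ) → EReal} (hneg : ∀ z ∈ Metric.ball (0 : Fin n → ℂ) 1, φ z < 0)
    (husc : UpperSemicontinuousOn φ (Metric.ball 0 1)) : GermMod (JJ φ) where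
  zero := ⟨2, 1, by norm_num, by norm_num, le_rfl, continuousOn_const, by simp⟩
  add := by
    rintro f ⟨p, ρ, hp, hρ, hρ1, hf, hfi⟩ g ⟨p', ρ', hp', hρ', hρ1', hg, hgi⟩
    refine ⟨min p p', min ρ ρ', lt_min hp hp', lt_min hρ hρ', (min_le_left _ _).trans hρ1,
      (hf.mono (Metric.ball_subset_ball (min_le_left _ _))).add (hg.mono (Metric.ball_subset_ball (min_le_right _ _))), ?_⟩
    have hmin : 0 < min p p' := lt_min (by linarith) (by linarith)
    have hfm : AEMeasurable (fun z => 2 * (‖f z‖ₑ ^ 2 * wt φ (min p p') z)) (volume.restrict (Metric.ball 0 (min ρ ρ'))) := by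
      refine AEMeasurable.const_mul (AEMeasurable.mul ?_ (wt_meas husc hmin ((min_le_left _ _).trans hρ1))) _
      have := (hf.mono (Metric.ball_subset_ball (min_le_left ρ ρ'))).aemeasurable (μ := volume) Metric.isOpen_ball.measurableSet
      exact this.enorm.pow_const 2
    calc ∫⁻ z in Metric.ball 0 (min ρ ρ'), ‖f z + g z‖ₑ ^ 2 * wt φ (min p p') z
        ≤ ∫⁻ z in Metric.ball 0 (min ρ ρ'), (2 * (‖f z‖ₑ ^ 2 * wt φ (min p p') z) + 2 * (‖g z‖ₑ ^ 2 * wt φ (min p p') z)) := by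
          refine lintegral_mono fun z => ?_
          have := mul_le_mul_left (enorm_add_sq (f z) (g z)) (wt φ (min p p') z)
          refine this.trans (le_of_eq (by ring))
      _ = (∫⁻ z in Metric.ball 0 (min ρ ρ'), 2 * (‖f z‖ₑ ^ 2 * wt φ (min p p') z)) +
          ∫⁻ z in Metric.ball 0 (min ρ ρ'), 2 * (‖g z‖ₑ ^ 2 * wt φ (min p p') z) := lintegral_add_left' hfm _
      _ < ⊤ := by
          rw [lintegral_const_mul' _ _ (by simp), lintegral_const_mul' _ _ (by simp)]
          refine ENNReal.add_lt_top.2 ⟨ENNReal.mul_lt_top (by simp) (lt_of_le_of_lt ?_ hfi),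
            ENNReal.mul_lt_top (by simp) (lt_of_le_of_lt ?_ hgi)⟩
          · refine le_trans (lintegral_mono_set (Metric.ball_subset_ball (min_le_left _ _))) ?_
            refine setLIntegral_mono' Metric.isOpen_ball.measurableSet fun z hz => ?_
            gcongr
            exact wt_mono hmin (min_le_left _ _) (hneg z (Metric.ball_subset_ball hρ1 hz))
          · refine le_trans (lintegral_mono_set (Metric.ball_subset_ball (min_le_right _ _))) ?_
            refine setLIntegral_mono' Metric.isOpen_ball.measurableSet fun z hz => ?_
            gcongr
            exact wt_mono hmin (min_le_right _ _) (hneg z (Metric.ball_subset_ball hρ1' hz))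
  smul := by
    rintro c f ⟨p, ρ, hp, hρ, hρ1, hf, hfi⟩
    refine ⟨p, ρ, hp, hρ, hρ1, continuousOn_const.mul hf, ?_⟩
    have : ∀ z, ‖c * f z‖ₑ ^ 2 * wt φ p z = ‖c‖ₑ ^ 2 * (‖f z‖ₑ ^ 2 * wt φ p z) := fun z => by
      rw [enorm_mul]; ring
    simp_rw [this]
    rw [lintegral_const_mul' _ _ (by simp)]
    exact ENNReal.mul_lt_top (by simp) hfi
  mul := by
    rintro s q hq f ⟨p, ρ, hp, hρ, hρ1, hf, hfi⟩
    obtain ⟨ρ', hρ', hsub⟩ := PD_nhds (n := n) s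
    obtain ⟨C, hC⟩ := hq.bound
    have hb : ∀ z ∈ Metric.ball (0 : Fin n → ℂ) (min ρ ρ'), z ∈ PD s := fun z hz => by
      refine hsub z ((pi_norm_lt_iff hρ').1 ?_)
      exact lt_of_lt_of_le (by simpa using hz) (min_le_right ρ ρ')
    refine ⟨p, min ρ ρ', hp, lt_min hρ hρ', (min_le_left _ _).trans hρ1,
      (hq.continuousOn.mono hb).mul (hf.mono (Metric.ball_subset_ball (min_le_left _ _))), ?_⟩
    have : ∀ z ∈ Metric.ball (0 : Fin n → ℂ) (min ρ ρ'), ‖ev q z * f z‖ₑ ^ 2 * wt φ p z ≤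
        ENNReal.ofReal C ^ 2 * (‖f z‖ₑ ^ 2 * wt φ p z) := fun z hz => by
      rw [enorm_mul, mul_pow, mul_assoc]
      gcongr
      rw [← ofReal_norm_eq_enorm]
      exact ENNReal.ofReal_le_ofReal (hC z (hb z hz))
    refine lt_of_le_of_lt (setLIntegral_mono' Metric.isOpen_ball.measurableSet this) ?_
    rw [lintegral_const_mul' _ _ (by simp)]
    refine ENNReal.mul_lt_top (by simp) (lt_of_le_of_lt (lintegral_mono_set (Metric.ball_subset_ball (min_le_left _ _))) hfi)
  loc := by
    rintro f ⟨p, ρ, hp, hρ, hρ1, hf, hfi⟩ g ρ' hρ' hfg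
    have hb : ∀ z ∈ Metric.ball (0 : Fin n → ℂ) (min ρ ρ'), f z = g z := fun z hz => by
      refine hfg z ((pi_norm_lt_iff hρ').1 ?_)
      exact lt_of_lt_of_le (by simpa using hz) (min_le_right ρ ρ')
    refine ⟨p, min ρ ρ', hp, lt_min hρ hρ', (min_le_left _ _).trans hρ1,
      (hf.mono (Metric.ball_subset_ball (min_le_left _ _))).congr fun z hz => (hb z hz).symm, ?_⟩
    rw [setLIntegral_congr_fun (g := fun z => ‖f z‖ₑ ^ 2 * wt φ p z) Metric.isOpen_ball.measurableSet
      (fun z hz => by simp only [hb z hz])]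
    exact lt_of_le_of_lt (lintegral_mono_set (Metric.ball_subset_ball (min_le_left _ _))) hfi

lemma geo_aux (y : ℝ) (N : ℕ) :
    ∑ k ∈ Finset.range N, (if (k:ℝ) < y then Real.exp k else 0) ≤ Real.exp N ∧
    ∑ k ∈ Finset.range N, (if (k:ℝ) < y then Real.exp k else 0) ≤ Real.exp (y + 1) := by
  induction N with
  | zero => simp; positivity
  | succ N ih =>
    rw [Finset.sum_range_succ]
    have h2 : 2 * Real.exp N ≤ Real.exp ((N+1 : ℕ)) := by
      push_cast
      rw [Real.exp_add]
      have := Real.add_one_le_exp (1:ℝ)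
      nlinarith [Real.exp_pos (N:ℝ)]
    have h3 := Real.exp_pos (N:ℝ)
    split_ifs with h
    · refine ⟨by linarith [ih.1], ?_⟩
      have : Real.exp ((N+1:ℕ)) ≤ Real.exp (y+1) := Real.exp_le_exp.2 (by push_cast; linarith)
      linarith [ih.1]
    · exact ⟨by linarith [ih.1], by linarith [ih.2]⟩

lemma choose_k {a : ℕ → ℝ} (ha : ∀ k, 0 ≤ a k) {B : ℝ}
    (hB : ∀ N, ∑ k ∈ Finset.range N, Real.exp k * a k ≤ B) {η : ℝ} (hη : 0 < η) :
    ∃ k : ℕ, 1 ≤ k ∧ ((k:ℝ) + 1) * Real.exp ((k:ℝ) + 1) * a k < η := by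
  by_contra hcon
  push Not at hcon
  have hs : Summable (fun k : ℕ => Real.exp k * a k) :=
    summable_of_sum_range_le (fun k => mul_nonneg (Real.exp_pos _).le (ha k)) hB
  have h1 : Summable (fun k : ℕ => Real.exp 1 / η * (Real.exp (k+1 : ℕ) * a (k+1))) :=
    ((summable_nat_add_iff 1).2 hs).mul_left _
  have h2 : Summable (fun k : ℕ => 1 / (((k + 2 : ℕ)) : ℝ)) := by
    refine Summable.of_nonneg_of_le (fun k => by positivity) (fun k => ?_) h1
    have := hcon (k+1) (by omega)
    rw [Real.exp_add] at this
    push_cast at this ⊢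
    rw [div_mul_eq_mul_div, div_le_div_iff₀ (by positivity) hη]
    nlinarith
  exact Real.not_summable_one_div_natCast ((summable_nat_add_iff 2).1 h2)
end SOC

namespace SOC
variable {n : ℕ}

lemma sum_mass {φ : (Fin n → ℂ) → EReal} (hneg : ∀ z ∈ Metric.ball (0 : Fin n → ℂ) 1, φ z < 0)
    (husc : UpperSemicontinuousOn φ (Metric.ball 0 1)) {F : (Fin n → ℂ) → ℂ} (hF : ContinuousOn F (Metric.ball 0 1)) (N : ℕ) :
    ∑ k ∈ Finset.range N, ENNReal.ofReal (Real.exp k) *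
      (∫⁻ z in {z | z ∈ Metric.ball 0 1 ∧ φ z < ((-(k:ℝ) : ℝ) : EReal)}, ‖F z‖ₑ ^ 2) ≤
    ENNReal.ofReal (Real.exp 1) * ∫⁻ z in Metric.ball 0 1, ‖F z‖ₑ ^ 2 * wt φ 1 z := by
  have hSm : ∀ k : ℕ, MeasurableSet {z | z ∈ Metric.ball (0 : Fin n → ℂ) 1 ∧ φ z < ((-(k:ℝ) : ℝ) : EReal)} :=
    fun k => (open_sub husc _).measurableSet
  have hFm : AEMeasurable (fun z => ‖F z‖ₑ ^ 2) (volume.restrict (Metric.ball 0 1)) :=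
    ((hF.aemeasurable (μ := volume) Metric.isOpen_ball.measurableSet).enorm.pow_const 2)
  have h1 : ∀ k : ℕ, ENNReal.ofReal (Real.exp k) *
      (∫⁻ z in {z | z ∈ Metric.ball 0 1 ∧ φ z < ((-(k:ℝ) : ℝ) : EReal)}, ‖F z‖ₑ ^ 2) =
      ∫⁻ z in Metric.ball 0 1, ENNReal.ofReal (Real.exp k) *
        ({z | z ∈ Metric.ball (0 : Fin n → ℂ) 1 ∧ φ z < ((-(k:ℝ) : ℝ) : EReal)}.indicator (fun z => ‖F z‖ₑ ^ 2) z) := by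
    intro k
    rw [lintegral_const_mul' _ _ (by simp), lintegral_indicator (hSm k), Measure.restrict_restrict (hSm k),
      inter_eq_left.2 (fun z hz => hz.1)]
  simp_rw [h1]
  rw [← lintegral_finsetSum' _ (fun k _ => (hFm.indicator (hSm k)).const_mul _), ← lintegral_const_mul' _ _ (by simp)]
  refine setLIntegral_mono' Metric.isOpen_ball.measurableSet fun z hz => ?_
  have hz0 := hneg z hz
  have key : ∑ k ∈ Finset.range N, (if φ z < ((-(k:ℝ) : ℝ) : EReal) then ENNReal.ofReal (Real.exp k) else 0) ≤
      ENNReal.ofReal (Real.exp 1) * wt φ 1 z := by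
    unfold wt
    induction hx : φ z with
    | top => rw [hx] at hz0; simp at hz0
    | bot =>
      rw [EReal.coe_mul_bot_of_pos one_pos, EReal.neg_bot, EReal.exp_top, ENNReal.mul_top]
      · exact le_top
      · simp [Real.exp_pos]
    | coe x =>
      have e : -(((1:ℝ) : EReal) * (x : EReal)) = ((-x : ℝ) : EReal) := by push_cast; rw [one_mul]
      rw [e, EReal.exp_coe, ← ENNReal.ofReal_mul (Real.exp_pos _).le, ← Real.exp_add]
      have h := (geo_aux (-x) N).2
      rw [add_comm 1]
      refine le_trans (le_of_eq ?_) (ENNReal.ofReal_le_ofReal h)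
      rw [ENNReal.ofReal_sum_of_nonneg (fun k _ => by split_ifs; exacts [(Real.exp_pos _).le, le_rfl])]
      refine Finset.sum_congr rfl fun k _ => ?_
      by_cases hk : (k:ℝ) < -x
      · rw [if_pos hk, if_pos (by rw [EReal.coe_lt_coe_iff]; linarith)]
      · rw [if_neg hk, if_neg (by rw [EReal.coe_lt_coe_iff]; intro; exact hk (by linarith)), ENNReal.ofReal_zero]
  calc ∑ k ∈ Finset.range N, ENNReal.ofReal (Real.exp k) *
        ({z | z ∈ Metric.ball (0 : Fin n → ℂ) 1 ∧ φ z < ((-(k:ℝ) : ℝ) : EReal)}.indicator (fun z => ‖F z‖ₑ ^ 2) z)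
      = (∑ k ∈ Finset.range N, (if φ z < ((-(k:ℝ) : ℝ) : EReal) then ENNReal.ofReal (Real.exp k) else 0)) * ‖F z‖ₑ ^ 2 := by
        rw [Finset.sum_mul]
        refine Finset.sum_congr rfl fun k _ => ?_
        by_cases hk : φ z < ((-(k:ℝ) : ℝ) : EReal)
        · rw [if_pos hk, indicator_of_mem (show z ∈ {z | z ∈ Metric.ball (0 : Fin n → ℂ) 1 ∧ φ z < ((-(k:ℝ) : ℝ) : EReal)} from ⟨hz, hk⟩)]
        · rw [if_neg hk, indicator_of_notMem (fun h => hk h.2)]; simp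
    _ ≤ (ENNReal.ofReal (Real.exp 1) * wt φ 1 z) * ‖F z‖ₑ ^ 2 := by gcongr
    _ = _ := by ring

theorem main_ball (φ : (Fin n → ℂ) → EReal) (hneg : ∀ z ∈ Metric.ball (0 : Fin n → ℂ) 1, φ z < 0)
    (husc : UpperSemicontinuousOn φ (Metric.ball 0 1))
    (hsm : ∀ z₀ ∈ Metric.ball (0 : Fin n → ℂ) 1, ∀ w : Fin n → ℂ, ∀ ρ : ℝ, 0 < ρ →
    (∀ t : ℂ, ‖t‖ ≤ ρ → z₀ + t • w ∈ Metric.ball (0 : Fin n → ℂ) 1) →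
    ∀ M : ℝ, φ z₀ ≤
      (((2 * Real.pi)⁻¹ * ∫ θ in (0 : ℝ)..(2 * Real.pi),
        (φ (z₀ + ((ρ : ℂ) * Complex.exp (θ * Complex.I)) • w) ⊔ (M : EReal)).toReal : ℝ) : EReal))
    (F : (Fin n → ℂ) → ℂ) (hF : DifferentiableOn ℂ F (Metric.ball 0 1))
    (hint : ∫⁻ z in Metric.ball 0 1, ‖F z‖ₑ ^ 2 * wt φ 1 z < ⊤) : F ∈ JJ φ := by
  obtain ⟨C, R, hC, hR, hR4, hQ⟩ := psh_Q n
  have hJ := JJ_germ hneg husc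
  -- total mass
  have hmass : ∫⁻ z in Metric.ball 0 1, ‖F z‖ₑ ^ 2 < ⊤ := by
    refine lt_of_le_of_lt (setLIntegral_mono' Metric.isOpen_ball.measurableSet fun z hz => ?_) hint
    refine le_mul_of_one_le_right zero_le ?_
    unfold wt
    rw [EReal.one_le_exp_iff, EReal.coe_one, one_mul, EReal.le_neg, neg_zero]
    exact (hneg z hz).le
  set m : ℕ → ℝ≥0∞ := fun k => ∫⁻ z in {z | z ∈ Metric.ball 0 1 ∧ φ z < ((-(k:ℝ) : ℝ) : EReal)}, ‖F z‖ₑ ^ 2 with hm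
  have hmt : ∀ k, m k ≠ ⊤ := fun k =>
    (lt_of_le_of_lt (lintegral_mono_set (fun z hz => hz.1)) hmass).ne
  have hB : ∀ N, ∑ k ∈ Finset.range N, Real.exp k * (m k).toReal ≤
      (ENNReal.ofReal (Real.exp 1) * ∫⁻ z in Metric.ball 0 1, ‖F z‖ₑ ^ 2 * wt φ 1 z).toReal := by
    intro N
    have h1 := ENNReal.toReal_mono (ENNReal.mul_lt_top (by simp) hint).ne (sum_mass hneg husc hF.continuousOn N)
    rw [ENNReal.toReal_sum (fun k _ => (ENNReal.mul_lt_top (by simp) (hmt k).lt_top).ne)] at h1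
    refine le_trans (le_of_eq (Finset.sum_congr rfl fun k _ => ?_)) h1
    rw [ENNReal.toReal_mul, ENNReal.toReal_ofReal (Real.exp_pos _).le]
  have hk : ∀ j : ℕ, ∃ k : ℕ, 1 ≤ k ∧ ((k:ℝ) + 1) * Real.exp ((k:ℝ) + 1) * (m k).toReal < 1 / ((j:ℝ) + 1) :=
    fun j => choose_k (fun k => ENNReal.toReal_nonneg) hB (by positivity)
  have hb : ∀ j : ℕ, ∃ (p : ℝ) (b : (Fin n → ℕ) → ℂ), 1 < p ∧ (∀ α, ‖b α‖ * R ^ (∑ i, α i) ≤ Real.sqrt (C * (1 / ((j:ℝ) + 1)))) ∧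
      ∫⁻ z in Metric.ball 0 R, ‖F z - ev b z‖ₑ ^ 2 * wt φ p z < ⊤ := by
    intro j
    obtain ⟨k, hk1, hk2⟩ := hk j
    have hk0 : (0:ℝ) < k := by exact_mod_cast hk1
    have hT : ((k:ℝ) + 1) / (((k:ℝ) + 1) / k) = k := by field_simp
    obtain ⟨b, hb1, hb2⟩ := hQ F hF φ hneg husc hsm (((k:ℝ) + 1) / k) ((k:ℝ) + 1) (by positivity) (by linarith) (m k) (hmt k)
      (by rw [hT])
    refine ⟨((k:ℝ) + 1) / k, b, by rw [one_lt_div hk0]; linarith, fun α => (hb1 α).trans (Real.sqrt_le_sqrt ?_), lt_of_le_of_lt hb2 ?_⟩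
    · nlinarith
    · refine ENNReal.mul_lt_top (by simp) (lt_of_le_of_lt (lintegral_mono_set ?_) hmass)
      exact Metric.closedBall_subset_ball (by norm_num)
  choose p b hp hb1 hb2 using hb
  -- power series of F
  obtain ⟨M, hM⟩ := (isCompact_closedBall (0 : Fin n → ℂ) (1/2)).exists_bound_of_continuousOn
    (hF.continuousOn.mono (Metric.closedBall_subset_ball (by norm_num)))
  obtain ⟨a, ha1, ha2⟩ := exists_powerseries n (R := 1/2) (R' := 1/4) (by norm_num) (by norm_num) M F
    (hF.mono (Metric.ball_subset_ball (by norm_num))) (fun z hz => hM z (Metric.ball_subset_closedBall hz))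
  obtain ⟨s1, hs1⟩ := CV_of_bound (n := n) (R := 1/4) (by norm_num)
  obtain ⟨s2, hs2⟩ := CV_of_bound (n := n) hR
  have hcva : CV (max s1 s2) a := (hs1 a M ha1).mono (le_max_left _ _)
  have hcvb : ∀ j, CV (max s1 s2) (b j) := fun j => (hs2 _ _ (hb1 j)).mono (le_max_right _ _)
  have hFa : ∀ z : Fin n → ℂ, ‖z‖ < 1/4 → F z = ev a z := fun z hz => (ha2 z hz).tsum_eq.symm
  obtain ⟨ρ, hρ, hsub⟩ := PD_nhds (n := n) (max s1 s2)
  have hcJ : ∀ j, ev (a - b j) ∈ JJ φ := by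
    intro j
    have hpd : ∀ z ∈ Metric.ball (0 : Fin n → ℂ) (min R ρ), z ∈ PD (max s1 s2) := fun z hz => by
      refine hsub z ((pi_norm_lt_iff hρ).1 ?_)
      exact lt_of_lt_of_le (by simpa using hz) (min_le_right R ρ)
    refine ⟨p j, min R ρ, hp j, lt_min hR hρ, (min_le_left _ _).trans (by linarith),
      ((hcva.sub (hcvb j)).continuousOn).mono hpd, ?_⟩
    refine lt_of_le_of_lt ?_ (hb2 j)
    refine le_trans (le_of_eq ?_) (lintegral_mono_set (Metric.ball_subset_ball (min_le_left R ρ)))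
    refine setLIntegral_congr_fun Metric.isOpen_ball.measurableSet fun z hz => ?_
    have hzR : ‖z‖ < 1/4 := lt_of_lt_of_le (by simpa using Metric.ball_subset_ball (min_le_left R ρ) hz) hR4
    rw [ev_sub hcva (hcvb j) (hpd z hz), hFa z hzR]
  have hlim : ∀ α, Tendsto (fun j => (a - b j) α) atTop (nhds (a α)) := by
    intro α
    have h0 : Tendsto (fun j => b j α) atTop (nhds 0) := by
      have hRp : 0 < R ^ (∑ i, α i) := by positivity
      refine squeeze_zero_norm (a := fun j : ℕ => Real.sqrt (C * (1 / ((j:ℝ) + 1))) / R ^ (∑ i, α i))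
        (fun j => by rw [le_div_iff₀ hRp]; exact hb1 j α) ?_
      have h1 : Tendsto (fun j : ℕ => Real.sqrt (C * (1 / ((j:ℝ) + 1))) / R ^ (∑ i, α i)) atTop
          (nhds (Real.sqrt (C * 0) / R ^ (∑ i, α i))) :=
        ((Real.continuous_sqrt.tendsto _).comp (tendsto_one_div_add_atTop_nhds_zero_nat.const_mul C)).div_const _
      simpa using h1
    simpa using tendsto_const_nhds.sub h0
  have hev : ev a ∈ JJ φ := closure2 hJ hcva (fun j => a - b j) (fun j => ⟨_, hcva.sub (hcvb j)⟩) hcJ hlim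
  refine hJ.loc _ hev F (1/4) (by norm_num) fun z hz => (hFa z ?_).symm
  exact (pi_norm_lt_iff (by norm_num)).2 hz
end SOC

/-- Strong openness conjecture: if `φ` is a negative plurisubharmonic function on
the unit polydisc `Δⁿ ⊂ ℂⁿ` and `F` is holomorphic on `Δⁿ` with
`∫_{Δⁿ} |F|² e^{−φ} dλₙ < ∞`, then there exist `r ∈ (0,1)` and `p > 1` with
`∫_{Δⁿ_r} |F|² e^{−pφ} dλₙ < ∞`. -/
theorem stmt_0 {n : ℕ} (φ : (Fin n → ℂ) → EReal)
    (hpsh : PlurisubharmonicOn φ {z : Fin n → ℂ | ∀ i, ‖z i‖ < 1})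
    (hneg : ∀ z ∈ {z : Fin n → ℂ | ∀ i, ‖z i‖ < 1}, φ z < 0)
    (F : (Fin n → ℂ) → ℂ)
    (hF : DifferentiableOn ℂ F {z : Fin n → ℂ | ∀ i, ‖z i‖ < 1})
    (hint : ∫⁻ z in {z : Fin n → ℂ | ∀ i, ‖z i‖ < 1},
        ENNReal.ofReal (‖F z‖ ^ 2) * EReal.exp (-(φ z)) < ⊤) :
    ∃ r ∈ Set.Ioo (0 : ℝ) 1, ∃ p : ℝ, 1 < p ∧
      ∫⁻ z in {z : Fin n → ℂ | ∀ i, ‖z i‖ < r},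
        ENNReal.ofReal (‖F z‖ ^ 2) * EReal.exp (-((p : EReal) * φ z)) < ⊤ := by
  have hball : ∀ r : ℝ, 0 < r → {z : Fin n → ℂ | ∀ i, ‖z i‖ < r} = Metric.ball 0 r := by
    intro r hr
    ext z
    rw [mem_ball_zero_iff, pi_norm_lt_iff hr]; rfl
  have e : ∀ a : ℂ, ENNReal.ofReal (‖a‖ ^ 2) = ‖a‖ₑ ^ 2 := fun a => by
    rw [← ofReal_norm_eq_enorm, ENNReal.ofReal_pow (norm_nonneg _)]
  rw [hball 1 one_pos] at hpsh hneg hF hint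
  obtain ⟨husc, -, -, hsm⟩ := hpsh
  have hint2 : ∫⁻ z in Metric.ball 0 1, ‖F z‖ₑ ^ 2 * SOC.wt φ 1 z < ⊤ := by
    refine lt_of_le_of_lt (le_of_eq ?_) hint
    refine lintegral_congr fun z => ?_
    rw [e, SOC.wt, EReal.coe_one, one_mul]
  obtain ⟨p, ρ, hp, hρ, hρ1, -, hfin⟩ := SOC.main_ball φ hneg husc hsm F hF hint2
  refine ⟨ρ / 2, ⟨by positivity, by linarith⟩, p, hp, ?_⟩
  rw [hball (ρ / 2) (by positivity)]
  refine lt_of_le_of_lt ?_ hfin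
  refine le_trans (le_of_eq ?_) (lintegral_mono_set (Metric.ball_subset_ball (by linarith : ρ / 2 ≤ ρ)))
  refine lintegral_congr fun z => ?_
  rw [e, SOC.wt]
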